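/- arXiv:2204.03462 — 3 statements merged into one kernel-verified Lean document; each statement's English description precedes it below -/
import Mathlib

section
/- For all integers k, p, t ≥ 2 there exist δ > 0 and n₀ such that for all n ≥ n₀ the following holds: for all positive integers a₁ ≤ a₂ ≤ ⋯ ≤ a_{p−1} ≤ t and a_{p−1} ≤ a_p ≤ δn, if a₁ = a₂ = 1 then r(K_p(a₁,…,a_p), B_{k,n}) = (p−1)(n−1) + 1. -/
open SimpleGraph

/-- `G` contains a copy of `H` (as a subgraph, i.e. there is an injective graph homomorphism). -/
def HasCopy {V W : Type*} (G : SimpleGraph V) (H : SimpleGraph W) : Prop :=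
  ∃ f : H →g G, Function.Injective f

/-- The Ramsey number `r(H₁, H₂)`: the smallest `N` such that every graph `G` on `N` vertices
contains `H₁` as a subgraph or its complement contains `H₂` as a subgraph. -/
noncomputable def ramseyNumber {V W : Type*} (H₁ : SimpleGraph V) (H₂ : SimpleGraph W) : ℕ :=
  sInf {N : ℕ | ∀ G : SimpleGraph (Fin N), HasCopy G H₁ ∨ HasCopy Gᶜ H₂}

/-- The complete multipartite graph `K_p(a₁,…,a_p)` with parts of sizes `a 0, …, a (p-1)`. -/
def KMulti {p : ℕ} (a : Fin p → ℕ) : SimpleGraph (Σ i : Fin p, Fin (a i)) :=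
  completeMultipartiteGraph fun i => Fin (a i)

/-- The book graph `B_{k,n}`: the join of `K_k` with an independent set of `n - k` vertices,
realized as the complete multipartite graph with `k` parts of size `1` and one part of
size `n - k`. -/
def Book (k n : ℕ) : SimpleGraph (Σ i : Fin (k + 1), Fin (if (i : ℕ) < k then 1 else n - k)) :=
  completeMultipartiteGraph fun i : Fin (k + 1) => Fin (if (i : ℕ) < k then 1 else n - k)

namespace BookGoodness

open Finset
open scoped Classical

/-- Every vertex of `A` is adjacent to every vertex of `B`. -/
def Complete {α : Type} (G : SimpleGraph α) (A B : Finset α) : Prop :=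
  ∀ x ∈ A, ∀ y ∈ B, G.Adj x y

/-- The sets `V i` span a complete multipartite subgraph. -/
def PairwiseComplete {α ι : Type} (G : SimpleGraph α) (V : ι → Finset α) : Prop :=
  ∀ i j, i ≠ j → Complete G (V i) (V j)

/-- No two vertices of `T` are adjacent. -/
def Indep {α : Type} (G : SimpleGraph α) (T : Finset α) : Prop :=
  ∀ x ∈ T, ∀ y ∈ T, ¬ G.Adj x y

/-- Every independent `k`-set has fewer than `n` common non-neighbours, itself included. -/
def NoBook {α : Type} [Fintype α] (G : SimpleGraph α) (k n : ℕ) : Prop :=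
  ∀ T : Finset α, T.card = k → Indep G T → #{v | ∀ x ∈ T, ¬ G.Adj v x} < n

/-- `G` has no complete `p`-partite subgraph with two nonempty parts, all other parts of size at
least `t`, and one of these others of size at least `n / K`. -/
def NoTarget {α : Type} (G : SimpleGraph α) (p t n K : ℕ) : Prop :=
  ∀ (ι : Type) [Fintype ι] (V : ι → Finset α) (i₀ i₁ i₂ : ι), Fintype.card ι = p →
    i₀ ≠ i₁ → i₀ ≠ i₂ → i₁ ≠ i₂ → PairwiseComplete G V → (∀ i, (V i).Nonempty) →
    (∀ i, i ≠ i₀ → i ≠ i₁ → t ≤ #(V i)) → n ≤ K * #(V i₂) → False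

lemma NoTarget.mono {α : Type} {G : SimpleGraph α} {p t n K L : ℕ} (h : NoTarget G p t n K)
    (hL : L ≤ K) : NoTarget G p t n L :=
  fun ι _ V i₀ i₁ i₂ hc h01 h02 h12 hV hne ht hn =>
    h ι V i₀ i₁ i₂ hc h01 h02 h12 hV hne ht (hn.trans (Nat.mul_le_mul_right _ hL))

lemma Complete.mono {α : Type} {G : SimpleGraph α} {A B A' B' : Finset α} (h : Complete G A B)
    (hA : A' ⊆ A) (hB : B' ⊆ B) : Complete G A' B' :=
  fun x hx y hy => h x (hA hx) y (hB hy)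

lemma Complete.symm {α : Type} {G : SimpleGraph α} {A B : Finset α} (h : Complete G A B) :
    Complete G B A :=
  fun x hx y hy => (h y hy x hx).symm

lemma PairwiseComplete.option {α ι : Type} {G : SimpleGraph α} {V : ι → Finset α} {W : Finset α}
    (hV : PairwiseComplete G V) (hW : ∀ i, Complete G W (V i)) :
    PairwiseComplete G (fun o : Option ι => o.elim W V) := by
  rintro (_ | i) (_ | j) hij
  · exact absurd rfl hij
  · exact hW j
  · exact (hW i).symm
  · exact hV i j (fun h => hij (by rw [h]))

lemma PairwiseComplete.cons {α : Type} {r : ℕ} {G : SimpleGraph α} {V : Fin r → Finset α}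
    {W : Finset α} (hV : PairwiseComplete G V) (hW : ∀ i, Complete G W (V i)) :
    PairwiseComplete G (Fin.cons W V : Fin (r + 1) → Finset α) := by
  intro i j
  refine Fin.cases ?_ (fun i => ?_) i <;> refine Fin.cases ?_ (fun j => ?_) j
  · exact fun h => absurd rfl h
  · exact fun _ => by simpa using hW j
  · exact fun _ => by simpa using (hW i).symm
  · exact fun h => by simpa using hV i j (fun h' => h (by rw [h']))

lemma sum_choose_le {α : Type} [Fintype α] {G : SimpleGraph α} {k n : ℕ} (hB : NoBook G k n)
    {V : Finset α} (hV : Indep G V) :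
    ∑ v, (#{x ∈ V | ¬ G.Adj v x}).choose k ≤ (#V).choose k * (n - 1) := by
  have h1 : ∀ v, (#{x ∈ V | ¬ G.Adj v x}).choose k =
      #{T ∈ V.powersetCard k | ∀ x ∈ T, ¬ G.Adj v x} := by
    intro v
    rw [← card_powersetCard]
    congr 1
    ext T
    simp only [mem_powersetCard, mem_filter, subset_iff]
    grind
  simp_rw [h1, card_filter]
  rw [sum_comm]
  simp_rw [← card_filter]
  rw [← card_powersetCard, ← smul_eq_mul]
  refine sum_le_card_nsmul _ _ _ fun T hT => ?_
  rw [mem_powersetCard] at hT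
  have := hB T hT.2 (fun x hx y hy => hV x (hT.1 hx) y (hT.1 hy))
  omega

lemma choose_le_choose_sub_add (m k x : ℕ) :
    m.choose (k + 1) ≤ (m - x).choose (k + 1) + x * (m - 1).choose k := by
  induction x with
  | zero => simp
  | succ x ih =>
    rcases Nat.lt_or_ge x m with h | h
    · obtain ⟨y, rfl⟩ : ∃ y, m = x + y + 1 := ⟨m - x - 1, by omega⟩
      have e1 : x + y + 1 - x = y + 1 := by omega
      have e2 : x + y + 1 - (x + 1) = y := by omega
      rw [e1, Nat.choose_succ_succ y] at ih
      rw [e2]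
      have : y.choose k ≤ (x + y + 1 - 1).choose k := Nat.choose_le_choose _ (by omega)
      nlinarith
    · have e : m - (x + 1) = m - x := by omega
      rw [e]
      nlinarith [Nat.zero_le ((m - 1).choose k)]

lemma choose_mul_sub_le {m k : ℕ} (hk : 1 ≤ k) (x : ℕ) :
    m.choose k * m ≤ (m - x).choose k * m + x * k * m.choose k := by
  obtain ⟨k, rfl⟩ : ∃ j, k = j + 1 := ⟨k - 1, by omega⟩
  rcases m with _ | m
  · simp
  have h := choose_le_choose_sub_add (m + 1) k x
  have h2 := Nat.add_one_mul_choose_eq m k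
  simp only [Nat.add_sub_cancel] at h
  nlinarith

lemma choose_le_pow_mul_choose {m d k K : ℕ} (h : m ≤ K * d) (hd : 2 * k ≤ d) :
    m.choose k ≤ (2 * K) ^ k * d.choose k := by
  have h1 : m.descFactorial k ≤ m ^ k := Nat.descFactorial_le_pow m k
  have h2 : (d + 1 - k) ^ k ≤ d.descFactorial k := Nat.pow_sub_le_descFactorial d k
  have h3 : m ^ k ≤ (2 * K) ^ k * (d + 1 - k) ^ k := by
    rw [← mul_pow]
    refine Nat.pow_le_pow_left (h.trans ?_) k
    have : d ≤ 2 * (d + 1 - k) := by omega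
    nlinarith
  rw [Nat.descFactorial_eq_factorial_mul_choose] at h1 h2
  have h4 : k.factorial * m.choose k ≤ k.factorial * ((2 * K) ^ k * d.choose k) := by
    calc _ ≤ (2 * K) ^ k * (d + 1 - k) ^ k := h1.trans h3
      _ ≤ (2 * K) ^ k * (k.factorial * d.choose k) := Nat.mul_le_mul_left _ h2
      _ = _ := by ring
  exact Nat.le_of_mul_le_mul_left h4 k.factorial_pos

lemma exists_large_degree {α : Type} {G : SimpleGraph α} {U : Finset α} {S : ℕ}
    (hU : U.Nonempty) (h : ∀ T ⊆ U, #T = S → ¬ Indep G T) :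
    ∃ u ∈ U, #U ≤ S * (1 + #{x ∈ U | G.Adj u x}) := by
  obtain ⟨I, hI, hmax⟩ := exists_max_image (U.powerset.filter (Indep G)) card
    ⟨∅, by simp [Indep]⟩
  simp only [mem_filter, mem_powerset] at hI hmax
  have hIS : #I < S := by
    by_contra! hS
    obtain ⟨T, hT, hTc⟩ := exists_subset_card_eq hS
    exact h T (hT.trans hI.1) hTc fun x hx y hy => hI.2 x (hT hx) y (hT hy)
  by_contra! hlt
  have hcov : U ⊆ I.biUnion fun u => insert u {x ∈ U | G.Adj u x} := by
    intro v hv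
    by_contra hcon
    simp only [mem_biUnion, mem_insert, mem_filter, not_exists, not_and, not_or] at hcon
    have hvI : v ∉ I := fun hvI => (hcon v hvI).1 rfl
    have hind : Indep G (insert v I) := by
      intro x hx y hy
      rw [mem_insert] at hx hy
      rcases hx with rfl | hx <;> rcases hy with rfl | hy
      · exact G.loopless.irrefl _
      · exact fun ha => (hcon y hy).2 hv ha.symm
      · exact fun ha => (hcon x hx).2 hv ha
      · exact hI.2 x hx y hy
    have := hmax (insert v I) ⟨insert_subset hv hI.1, hind⟩
    rw [card_insert_of_notMem hvI] at this
    omega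
  have h1 : #U ≤ ∑ u ∈ I, (1 + #{x ∈ U | G.Adj u x}) := by
    refine (card_le_card hcov).trans (card_biUnion_le.trans (sum_le_sum fun u _ => ?_))
    exact (card_insert_le _ _).trans (by omega)
  have h2 : S * #U ≤ #I * #U := by
    calc S * #U ≤ S * ∑ u ∈ I, (1 + #{x ∈ U | G.Adj u x}) := Nat.mul_le_mul_left _ h1
      _ = ∑ u ∈ I, S * (1 + #{x ∈ U | G.Adj u x}) := mul_sum _ _ _
      _ ≤ #I * #U := by
        rw [← smul_eq_mul]
        exact sum_le_card_nsmul _ _ _ fun u hu => (hlt u (hI.1 hu)).le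
  have := Nat.le_of_mul_le_mul_right h2 hU.card_pos
  omega

lemma exists_complete_pair {α : Type} {G : SimpleGraph α} {U : Finset α} {S : ℕ}
    (h : ∀ T ⊆ U, #T = S → ¬ Indep G T) (j : ℕ) :
    ∀ m, 1 ≤ m → (2 * S) ^ j * m ≤ #U →
      ∃ X ⊆ U, ∃ Y ⊆ U, #X = j ∧ m ≤ #Y ∧ Complete G X Y := by
  induction j with
  | zero =>
    intro m _ hU
    exact ⟨∅, empty_subset _, U, Subset.rfl, rfl, by simpa using hU, by simp [Complete]⟩
  | succ j ih =>
    intro m hm hU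
    have hS : 1 ≤ S := by
      by_contra! hS
      exact h ∅ (empty_subset _) (by simp; omega) (by simp [Indep])
    obtain ⟨X, hX, Y, hY, hXc, hYc, hXY⟩ := ih (2 * S * m) (by nlinarith) (by
      rw [pow_succ] at hU; linarith)
    obtain ⟨u, hu, hdeg⟩ := exists_large_degree (card_pos.1 (by nlinarith : 0 < #Y))
      (fun T hT => h T (hT.trans hY))
    have hm2 : 2 * m ≤ 1 + #{x ∈ Y | G.Adj u x} := by
      have : S * (2 * m) ≤ S * (1 + #{x ∈ Y | G.Adj u x}) := by linarith
      exact Nat.le_of_mul_le_mul_left this hS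
    refine ⟨insert u X, insert_subset (hY hu) hX, {x ∈ Y | G.Adj u x},
      (filter_subset _ _).trans hY, ?_, by omega, ?_⟩
    · rw [card_insert_of_notMem, hXc]
      exact fun huX => G.loopless.irrefl _ (hXY u huX u hu)
    · intro x hx y hy
      rw [mem_filter] at hy
      rcases mem_insert.1 hx with rfl | hx
      · exact hy.2
      · exact hXY x hx y hy.1

lemma exists_common_trace {α : Type} (G : SimpleGraph α) (W X : Finset α) :
    ∃ W' ⊆ W, ∃ P : Finset α, #W ≤ 2 ^ #X * #W' ∧ ∀ v ∈ W', {x ∈ X | G.Adj v x} = P := by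
  let f : α → Finset α := fun v => {x ∈ X | G.Adj v x}
  obtain ⟨P, -, hmax⟩ := exists_max_image X.powerset (fun P => #{v ∈ W | f v = P})
    ⟨∅, by simp⟩
  refine ⟨{v ∈ W | f v = P}, filter_subset _ _, P, ?_, fun v hv => (mem_filter.1 hv).2⟩
  have := card_le_mul_card_image_of_maps_to (s := W) (t := X.powerset) (f := f)
    (fun v _ => mem_powerset.2 (filter_subset _ _)) _ hmax
  rwa [card_powerset, mul_comm] at this

/-- `G` has a complete `r`-partite subgraph with parts of size at least `s`, one of which has size
at least `n / C`. -/
def HasParts {α : Type} (G : SimpleGraph α) (r s C n : ℕ) : Prop :=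
  ∃ V : Fin r → Finset α, PairwiseComplete G V ∧ (∀ i, s ≤ #(V i)) ∧ ∃ l, n ≤ C * #(V l)

/-- `G` has an induced complete `r`-partite subgraph with parts of size `S`. -/
def HasIndepParts {α : Type} (G : SimpleGraph α) (r S : ℕ) : Prop :=
  ∃ V : Fin r → Finset α, PairwiseComplete G V ∧ ∀ i, Indep G (V i) ∧ #(V i) = S

lemma HasParts.indep_or_succ {α : Type} {G : SimpleGraph α} {r S s C n : ℕ} (hS : 1 ≤ S)
    (hs : 1 ≤ s) (h : HasParts G r ((2 * S) ^ s * s) C n) :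
    HasIndepParts G r S ∨ HasParts G (r + 1) s (2 * (2 * S) ^ s * C) n := by
  obtain ⟨V, hV, hVs, l, hl⟩ := h
  have hD : 1 ≤ (2 * S) ^ s := Nat.one_le_pow _ _ (by omega)
  set D := (2 * S) ^ s
  by_cases hind : ∀ i, ∃ T ⊆ V i, #T = S ∧ Indep G T
  · choose T hT hTc hTi using hind
    exact Or.inl ⟨T, fun i j hij => (hV i j hij).mono (hT i) (hT j), fun i => ⟨hTi i, hTc i⟩⟩
  right
  push Not at hind
  obtain ⟨i, hi⟩ := hind
  have hm : s ≤ #(V i) / D := by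
    rw [Nat.le_div_iff_mul_le hD, mul_comm]
    exact hVs i
  obtain ⟨X, hX, Y, hY, hXc, hYc, hXY⟩ := exists_complete_pair hi s (#(V i) / D) (hs.trans hm)
    (Nat.mul_div_le _ _)
  have hYc' : #(V i) ≤ 2 * D * #Y := by
    have h1 : #(V i) < D * (#(V i) / D + 1) := Nat.lt_mul_div_succ _ hD
    nlinarith
  have hsub : ∀ j, Function.update V i Y j ⊆ V j := by
    intro j
    by_cases hj : j = i
    · subst hj; simpa using hY
    · simp [hj]
  refine ⟨Fin.cons X (Function.update V i Y), PairwiseComplete.cons ?_ ?_, ?_, l.succ, ?_⟩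
  · exact fun j j' hjj => (hV j j' hjj).mono (hsub j) (hsub j')
  · intro j
    by_cases hj : j = i
    · subst hj; simpa using hXY
    · exact (hV i j (Ne.symm hj)).mono hX (hsub j)
  · refine Fin.cases (by simp [hXc]) fun j => ?_
    by_cases hj : j = i
    · subst hj; simpa using hm.trans hYc
    · simp only [Fin.cons_succ, ne_eq, hj, not_false_eq_true, Function.update_of_ne]
      nlinarith [hVs j]
  · by_cases hj : l = i
    · subst hj
      simp only [Fin.cons_succ, Function.update_self]
      nlinarith
    · simp only [Fin.cons_succ, ne_eq, hj, not_false_eq_true, Function.update_of_ne]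
      have : C * #(V l) ≤ (2 * D) * (C * #(V l)) := Nat.le_mul_of_pos_left _ (by omega)
      nlinarith

lemma HasIndepParts.succ {α : Type} [Fintype α] {G : SimpleGraph α} {k q r s n : ℕ} (hk : 1 ≤ k)
    (hs : 1 ≤ s) (hr : r < q) (hcard : Fintype.card α = q * (n - 1) + 1) (hB : NoBook G k n)
    (h : HasIndepParts G r (s * k * (2 * q + 1)))
    (hn : 2 * q * 2 ^ (r * (s * k * (2 * q + 1))) * s ≤ n) :
    HasParts G (r + 1) s (2 * q * 2 ^ (r * (s * k * (2 * q + 1)))) n := by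
  obtain ⟨V, hV, hVi⟩ := h
  set S := s * k * (2 * q + 1) with hSdef
  have hsk : 1 ≤ s * k := Nat.mul_pos hs hk
  have hkS : k ≤ S := by nlinarith
  have hfew : ∀ i, 2 * q * #{v | #{x ∈ V i | G.Adj v x} < s} ≤ (2 * q + 1) * (n - 1) := by
    intro i
    have h1 := sum_choose_le hB (hVi i).1
    rw [(hVi i).2] at h1
    have h2 : #{v | #{x ∈ V i | G.Adj v x} < s} * (S - s).choose k ≤ S.choose k * (n - 1) := by
      refine le_trans ?_ h1
      rw [← smul_eq_mul]
      refine (card_nsmul_le_sum _ _ _ fun v hv => ?_).trans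
        (sum_le_sum_of_subset (subset_univ {v | #{x ∈ V i | G.Adj v x} < s}))
      rw [mem_filter] at hv
      apply Nat.choose_le_choose
      have := card_filter_add_card_filter_not (s := V i) (fun x => G.Adj v x)
      rw [(hVi i).2] at this
      omega
    have h3 := choose_mul_sub_le (m := S) hk s
    have hc : 0 < S.choose k := Nat.choose_pos hkS
    set b := #{v | #{x ∈ V i | G.Adj v x} < s}
    have h4 : S.choose k * (2 * q * b * (s * k)) ≤
        S.choose k * ((2 * q + 1) * (n - 1) * (s * k)) := by
      have e1 : S.choose k * (2 * q * (s * k)) ≤ (S - s).choose k * S := by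
        rw [hSdef] at h3 ⊢
        nlinarith
      calc _ = b * (S.choose k * (2 * q * (s * k))) := by ring
        _ ≤ b * ((S - s).choose k * S) := Nat.mul_le_mul_left _ e1
        _ = b * (S - s).choose k * S := by ring
        _ ≤ S.choose k * (n - 1) * S := Nat.mul_le_mul_right _ h2
        _ = _ := by rw [hSdef]; ring
    exact Nat.le_of_mul_le_mul_right (Nat.le_of_mul_le_mul_left h4 hc) hsk
  set W : Finset α := {v | ∀ i, s ≤ #{x ∈ V i | G.Adj v x}} with hW
  have hWc : n ≤ 2 * q * #W := by
    have hcov : (univ : Finset α) ⊆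
        W ∪ univ.biUnion fun i => {v | #{x ∈ V i | G.Adj v x} < s} := by
      intro v _
      by_cases hv : ∀ i, s ≤ #{x ∈ V i | G.Adj v x}
      · simp [hW, hv]
      · push Not at hv
        obtain ⟨i, hi⟩ := hv
        simp only [mem_union, mem_biUnion, mem_univ, mem_filter, true_and]
        exact Or.inr ⟨i, hi⟩
    have h1 := (card_le_card hcov).trans ((card_union_le _ _).trans
      (Nat.add_le_add_left card_biUnion_le _))
    rw [card_univ, hcard] at h1
    have h2 : 2 * q * ∑ i, #{v | #{x ∈ V i | G.Adj v x} < s} ≤ r * ((2 * q + 1) * (n - 1)) := by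
      rw [mul_sum]
      refine (sum_le_card_nsmul _ _ _ fun i _ => hfew i).trans ?_
      simp
    obtain ⟨d, rfl⟩ : ∃ d, q = r + 1 + d := ⟨q - r - 1, by omega⟩
    rcases n with _ | n
    · simp
    simp only [Nat.add_sub_cancel] at h1 h2 ⊢
    have h3 := Nat.mul_le_mul_left (2 * (r + 1 + d)) h1
    rw [mul_add] at h3
    have h4 : n * r ≤ n * (r + d) := Nat.mul_le_mul_left _ (by omega)
    nlinarith [Nat.zero_le (n * r * d), Nat.zero_le (n * d), Nat.zero_le (n * d * d)]
  obtain ⟨W', hW', P, hWP, hP⟩ := exists_common_trace G W (univ.biUnion V)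
  have hX : #(univ.biUnion V) ≤ r * S := by
    refine card_biUnion_le.trans ?_
    simp [hVi]
  have hWn : n ≤ 2 * q * 2 ^ (r * S) * #W' := by
    have h1 : 2 ^ #(univ.biUnion V) ≤ 2 ^ (r * S) := Nat.pow_le_pow_right (by norm_num) hX
    calc n ≤ 2 * q * #W := hWc
      _ ≤ 2 * q * (2 ^ (r * S) * #W') :=
        Nat.mul_le_mul_left _ (hWP.trans (Nat.mul_le_mul_right _ h1))
      _ = _ := by ring
  have hsW : s ≤ #W' := Nat.le_of_mul_le_mul_left (hn.trans hWn) (by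
    have := Nat.one_le_two_pow (n := r * S)
    have : 0 < q := by omega
    positivity)
  obtain ⟨w, hw⟩ := card_pos.1 (hs.trans hsW)
  have hmemP : ∀ v ∈ W', ∀ x, x ∈ P ↔ (∃ i, x ∈ V i) ∧ G.Adj v x := by
    intro v hv x
    rw [← hP v hv]
    simp
  refine ⟨Fin.cons W' fun i => V i ∩ P, PairwiseComplete.cons ?_ ?_, ?_, 0, by simpa using hWn⟩
  · exact fun i j hij => (hV i j hij).mono inter_subset_left inter_subset_left
  · exact fun i v hv x hx => ((hmemP v hv x).1 (mem_inter.1 hx).2).2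
  · refine Fin.cases (by simpa using hsW) fun i => ?_
    have hwW := hW' hw
    rw [hW, mem_filter] at hwW
    refine (hwW.2 i).trans (card_le_card fun x hx => ?_)
    rw [mem_filter] at hx
    simp only [Fin.cons_succ, mem_inter]
    exact ⟨hx.1, (hmemP w hw x).2 ⟨⟨i, hx.1⟩, hx.2⟩⟩

lemma HasParts.mono {α : Type} {G : SimpleGraph α} {r s s' C C' n : ℕ} (h : HasParts G r s C n)
    (hs : s' ≤ s) (hC : C ≤ C') : HasParts G r s' C' n := by
  obtain ⟨V, hV, hVs, l, hl⟩ := h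
  exact ⟨V, hV, fun i => hs.trans (hVs i), l, hl.trans (Nat.mul_le_mul_right _ hC)⟩

lemma exists_hasParts {k q : ℕ} (hk : 1 ≤ k) (r : ℕ) (hr : 1 ≤ r) :
    r ≤ q → ∀ s, ∃ C, ∀ n, C ≤ n → ∀ (α : Type) [Fintype α] (G : SimpleGraph α),
      Fintype.card α = q * (n - 1) + 1 → NoBook G k n → HasParts G r s C n := by
  induction r, hr using Nat.le_induction with
  | base =>
    intro hq s
    refine ⟨max s 1, fun n hn α _ G hcard _ => ?_⟩
    have h1 : n ≤ Fintype.card α := by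
      rw [hcard]
      have : 1 * (n - 1) ≤ q * (n - 1) := Nat.mul_le_mul_right _ hq
      omega
    refine ⟨fun _ => univ, fun i j hij => absurd (Subsingleton.elim i j) hij, fun i => ?_, 0, ?_⟩
    · rw [card_univ]; omega
    · rw [card_univ]
      exact h1.trans (Nat.le_mul_of_pos_left _ (by omega))
  | succ r hr ih =>
    intro hq s
    set s' := max s 1
    set S := s' * k * (2 * q + 1) with hS
    have hs' : 1 ≤ s' := le_max_right _ _
    have hS1 : 1 ≤ S := Nat.mul_pos (Nat.mul_pos hs' hk) (by omega)
    obtain ⟨C, hC⟩ := ih (by omega) ((2 * S) ^ s' * s')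
    refine ⟨C + 2 * (2 * S) ^ s' * C + 2 * q * 2 ^ (r * S) * s', fun n hn α _ G hcard hB => ?_⟩
    have hle : 2 * q * 2 ^ (r * S) ≤ 2 * q * 2 ^ (r * S) * s' := Nat.le_mul_of_pos_right _ hs'
    rcases (hC n (by omega) α G hcard hB).indep_or_succ hS1 hs' with h | h
    · have hn' : 2 * q * 2 ^ (r * S) * s' ≤ n := by omega
      exact (h.succ hk hs' (by omega) hcard hB hn').mono (le_max_left _ _)
        (show 2 * q * 2 ^ (r * S) ≤ _ by omega)
    · exact h.mono (le_max_left _ _) (by omega)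

lemma exists_hasIndepParts {k q : ℕ} (hk : 1 ≤ k) (hq : 2 ≤ q) (t : ℕ) {S : ℕ} (hS : 1 ≤ S) :
    ∃ K, ∀ n, K ≤ n → ∀ (α : Type) [Fintype α] (G : SimpleGraph α),
      Fintype.card α = q * (n - 1) + 1 → NoBook G k n → NoTarget G (q + 1) t n K →
      HasIndepParts G q S := by
  set t' := max t 1
  have ht' : 1 ≤ t' := le_max_right _ _
  obtain ⟨C, hC⟩ := exists_hasParts hk q (by omega) le_rfl ((2 * S) ^ t' * t')
  refine ⟨C + 2 * (2 * S) ^ t' * C, fun n hn α _ G hcard hB hT => ?_⟩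
  refine ((hC n (by omega) α G hcard hB).indep_or_succ hS ht').resolve_right ?_
  rintro ⟨V, hV, hVt, l, hl⟩
  obtain ⟨i₀, h₀, i₁, h₁, hne⟩ := one_lt_card.1 (show 1 < #(univ.erase l) by
    rw [card_erase_of_mem (mem_univ _), card_univ, Fintype.card_fin]; omega)
  refine hT _ V i₀ i₁ l (by simp) hne (ne_of_mem_erase h₀) (ne_of_mem_erase h₁) hV
    (fun i => card_pos.1 (ht'.trans (hVt i))) (fun i _ _ => (le_max_left _ _).trans (hVt i))
    (hl.trans (Nat.mul_le_mul_right _ (by omega)))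

lemma card_few_nonNeighbours_lt {α : Type} {G : SimpleGraph α} {q t n M S : ℕ}
    (hq : 2 ≤ q) {V : Fin q → Finset α} (hV : PairwiseComplete G V) (hVc : ∀ i, #(V i) = S)
    (hT : NoTarget G (q + 1) t n (M * 2 ^ (q * S))) (hM : 1 ≤ M)
    (hn : M * 2 ^ (q * S) * (t + 1) ≤ n) {E : Finset α}
    (hE : ∀ v ∈ E, (∀ i, #{x ∈ V i | ¬ G.Adj v x} < S) ∧
      ∃ i₀, ∀ i, i ≠ i₀ → #{x ∈ V i | ¬ G.Adj v x} + t ≤ S) :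
    M * #E < n := by
  by_contra! hlt
  obtain ⟨W, hW, P, hWP, hP⟩ := exists_common_trace G E (univ.biUnion V)
  have hX : #(univ.biUnion V) ≤ q * S := by
    refine card_biUnion_le.trans ?_
    simp [hVc]
  have hWn : n ≤ M * 2 ^ (q * S) * #W := by
    have h1 : 2 ^ #(univ.biUnion V) ≤ 2 ^ (q * S) := Nat.pow_le_pow_right (by norm_num) hX
    calc n ≤ M * #E := hlt
      _ ≤ M * (2 ^ (q * S) * #W) :=
        Nat.mul_le_mul_left _ (hWP.trans (Nat.mul_le_mul_right _ h1))
      _ = _ := by ring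
  have hsW : t + 1 ≤ #W := Nat.le_of_mul_le_mul_left (hn.trans hWn) (by positivity)
  obtain ⟨w, hw⟩ := card_pos.1 (by omega : 0 < #W)
  have hmemP : ∀ v ∈ W, ∀ x, x ∈ P ↔ (∃ i, x ∈ V i) ∧ G.Adj v x := by
    intro v hv x
    rw [← hP v hv]
    simp
  have hcard : ∀ i, #(V i ∩ P) + #{x ∈ V i | ¬ G.Adj w x} = S := by
    intro i
    rw [← hVc i, ← card_filter_add_card_filter_not (s := V i) (fun x => G.Adj w x)]
    congr 2
    ext x
    simp only [mem_inter, mem_filter, hmemP w hw]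
    exact ⟨fun h => ⟨h.1, h.2.2⟩, fun h => ⟨h.1, ⟨i, h.1⟩, h.2⟩⟩
  obtain ⟨hlt, i₀, hi₀⟩ := hE w (hW hw)
  have : Nontrivial (Fin q) := Fin.nontrivial_iff_two_le.2 hq
  obtain ⟨i₁, hi₁⟩ := exists_ne i₀
  refine hT (Option (Fin q)) (fun o => o.elim W fun i => V i ∩ P) (some i₀) (some i₁) none
    (by simp) (by simpa using hi₁.symm) (by simp) (by simp)
    (PairwiseComplete.option ?_ ?_) ?_ ?_ hWn
  · exact fun i j hij => (hV i j hij).mono inter_subset_left inter_subset_left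
  · exact fun i v hv x hx => ((hmemP v hv x).1 (mem_inter.1 hx).2).2
  · rintro (_ | i)
    · exact ⟨w, hw⟩
    · rw [← card_pos]
      have := hcard i
      have := hlt i
      simp only [Option.elim_some]
      omega
  · rintro (_ | i) h0 h1
    · simp only [Option.elim_none]; omega
    · have := hcard i
      have := hi₀ i (by simpa using h0)
      simp only [Option.elim_some]
      omega

lemma few_internal_neighbours {α : Type} {G : SimpleGraph α} {q t n M S : ℕ}
    (hq : 2 ≤ q) {V : Fin q → Finset α} (hV : PairwiseComplete G V) (hVc : ∀ i, #(V i) = S)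
    (hT : NoTarget G (q + 1) t n (M * 2 ^ (q * S))) (hM : 1 ≤ M) (hSt : 3 * t ≤ S)
    (hn : M * 2 ^ (q * S) * (t + 1) ≤ n) {i : Fin q} {A : Finset α}
    (hA : ∀ v ∈ A, ∀ j, j ≠ i → 3 * #{x ∈ V j | ¬ G.Adj v x} < S) {v : α} (hv : v ∈ A) :
    M * #{x ∈ A | G.Adj v x} < n := by
  by_contra! hlt
  obtain ⟨W, hW, P, hWP, hP⟩ := exists_common_trace G {x ∈ A | G.Adj v x} (univ.biUnion V)
  have hX : #(univ.biUnion V) ≤ q * S := by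
    refine card_biUnion_le.trans ?_
    simp [hVc]
  have hWn : n ≤ M * 2 ^ (q * S) * #W := by
    have h1 : 2 ^ #(univ.biUnion V) ≤ 2 ^ (q * S) := Nat.pow_le_pow_right (by norm_num) hX
    calc n ≤ M * #{x ∈ A | G.Adj v x} := hlt
      _ ≤ M * (2 ^ (q * S) * #W) :=
        Nat.mul_le_mul_left _ (hWP.trans (Nat.mul_le_mul_right _ h1))
      _ = _ := by ring
  have hsW : t + 1 ≤ #W := Nat.le_of_mul_le_mul_left (hn.trans hWn) (by positivity)
  obtain ⟨w, hw⟩ := card_pos.1 (by omega : 0 < #W)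
  have hmemP : ∀ v ∈ W, ∀ x, x ∈ P ↔ (∃ i, x ∈ V i) ∧ G.Adj v x := by
    intro v hv x
    rw [← hP v hv]
    simp
  have hcard : ∀ j, j ≠ i → S < 3 * #{x ∈ V j ∩ P | G.Adj v x} := by
    intro j hj
    have h1 := hA v hv j hj
    have h2 := hA w (mem_filter.1 (hW hw)).1 j hj
    have h3 : V j ⊆ {x ∈ V j ∩ P | G.Adj v x} ∪
        ({x ∈ V j | ¬ G.Adj v x} ∪ {x ∈ V j | ¬ G.Adj w x}) := by
      intro x hx
      have := hmemP w hw x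
      simp only [mem_union, mem_filter, mem_inter]
      grind
    have h4 := (card_le_card h3).trans ((card_union_le _ _).trans
      (Nat.add_le_add_left (card_union_le _ _) _))
    rw [hVc] at h4
    omega
  have : Nontrivial (Fin q) := Fin.nontrivial_iff_two_le.2 hq
  obtain ⟨i₁, hi₁⟩ := exists_ne i
  set U : Fin q → Finset α := Function.update (fun j => {x ∈ V j ∩ P | G.Adj v x}) i W with hU
  have hUi : U i = W := by simp [hU]
  have hUj : ∀ j, j ≠ i → U j = {x ∈ V j ∩ P | G.Adj v x} := fun j hj => by simp [hU, hj]
  have hWc : ∀ j, j ≠ i → Complete G W (U j) := by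
    intro j hj x hx y hy
    rw [hUj j hj, mem_filter, mem_inter] at hy
    exact ((hmemP x hx y).1 hy.1.2).2
  refine hT (Option (Fin q)) (fun o => o.elim {v} U) none (some i₁) (some i)
    (by simp) (by simp) (by simp) (by simpa using hi₁) (PairwiseComplete.option ?_ ?_) ?_ ?_
    (by simpa [hUi] using hWn)
  · intro j j' hjj
    by_cases hj : j = i
    · subst hj; rw [hUi]; exact hWc j' hjj.symm
    by_cases hj' : j' = i
    · subst hj'; rw [hUi]; exact (hWc j hjj).symm
    · rw [hUj j hj, hUj j' hj']
      exact (hV j j' hjj).mono ((filter_subset _ _).trans inter_subset_left)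
        ((filter_subset _ _).trans inter_subset_left)
  · intro j x hx y hy
    rw [mem_singleton.1 hx]
    by_cases hj : j = i
    · subst hj
      rw [hUi] at hy
      exact (mem_filter.1 (hW hy)).2
    · rw [hUj j hj] at hy
      exact (mem_filter.1 hy).2
  · rintro (_ | j)
    · exact ⟨v, by simp⟩
    · simp only [Option.elim_some]
      by_cases hj : j = i
      · subst hj; rw [hUi]; exact ⟨w, hw⟩
      · rw [hUj j hj, ← card_pos]
        have := hcard j hj
        omega
  · rintro (_ | j) h0 h1
    · exact absurd rfl h0
    · simp only [Option.elim_some]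
      by_cases hj : j = i
      · subst hj; rw [hUi]; omega
      · rw [hUj j hj]
        have := hcard j hj
        omega

lemma card_compl_clusters_le {α : Type} [Fintype α] {G : SimpleGraph α} {k q t n S : ℕ}
    (hk : 1 ≤ k) (hq : 1 ≤ q) (hSk : 6 * k ≤ S) (hSt : 4 * (t * k) ≤ S)
    (hcard : Fintype.card α = q * (n - 1) + 1) (hB : NoBook G k n)
    {V : Fin q → Finset α} (hVi : ∀ i, Indep G (V i)) (hVc : ∀ i, #(V i) = S) {E R : Finset α}
    (hE : ∀ v ∉ E, (∃ i, #{x ∈ V i | ¬ G.Adj v x} = S) ∨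
      ∀ i₀, ∃ i, i ≠ i₀ ∧ S < #{x ∈ V i | ¬ G.Adj v x} + t)
    (hR : ∀ v ∉ R, ∀ i, #{x ∈ V i | ¬ G.Adj v x} = S →
      ∃ j, j ≠ i ∧ S ≤ 3 * #{x ∈ V j | ¬ G.Adj v x}) :
    #Rᶜ ≤ (6 ^ k + 1) * #E := by
  set W := S.choose k with hW
  set Q := 6 ^ k with hQ
  have hQ6 : 6 ≤ Q := by
    calc 6 = 6 ^ 1 := by norm_num
      _ ≤ 6 ^ k := Nat.pow_le_pow_right (by norm_num) hk
  have hW0 : 0 < W := Nat.choose_pos (by omega)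
  let f : Fin q → α → ℕ := fun i v => (#{x ∈ V i | ¬ G.Adj v x}).choose k
  have htwo : ∀ v i j, i ≠ j → f i v + f j v ≤ ∑ i, f i v := by
    intro v i j hij
    rw [← sum_pair hij (f := fun i => f i v)]
    exact sum_le_sum_of_subset (subset_univ _)
  have hone : ∀ v i, f i v ≤ ∑ i, f i v := fun v i =>
    single_le_sum (f := fun i => f i v) (fun _ _ => Nat.zero_le _) (mem_univ i)
  have hbig : 3 * W ≤ 4 * (S - t).choose k := by
    have h := choose_mul_sub_le (m := S) hk t
    have : S * (3 * W) ≤ S * (4 * (S - t).choose k) := by nlinarith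
    exact Nat.le_of_mul_le_mul_left this (by omega)
  have hpt : ∀ v, Q * W + (if v ∈ (E ∪ R)ᶜ then W else 0) ≤
      Q * ∑ i, f i v + (if v ∈ E then Q * W else 0) := by
    intro v
    by_cases hvE : v ∈ E
    · simp [hvE]
    simp only [mem_compl, mem_union, hvE, false_or, if_false, add_zero]
    rcases hE v hvE with ⟨i, hi⟩ | h
    · have hfi : f i v = W := by simp only [f, hi, hW]
      by_cases hvR : v ∈ R
      · have := hone v i
        rw [hfi] at this
        simpa [hvR] using Nat.mul_le_mul_left Q this
      · obtain ⟨j, hj, hjS⟩ := hR v hvR i hi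
        have h1 : W ≤ Q * f j v := by
          have := choose_le_pow_mul_choose (k := k) hjS (by omega)
          simpa using this
        have h2 := Nat.mul_le_mul_left Q (htwo v i j hj.symm)
        rw [hfi, mul_add] at h2
        simp only [hvR, not_false_eq_true, if_true]
        omega
    · obtain ⟨i, -, hi⟩ := h ⟨0, hq⟩
      obtain ⟨j, hj, hjS⟩ := h i
      have h1 : (S - t).choose k ≤ f i v := Nat.choose_le_choose _ (by omega)
      have h2 : (S - t).choose k ≤ f j v := Nat.choose_le_choose _ (by omega)
      have h3 := htwo v i j hj.symm
      have h4 : 3 * W ≤ 2 * ∑ i, f i v := by omega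
      have h5 := Nat.mul_le_mul_left Q h4
      have h6 := Nat.mul_le_mul_right W hQ6
      split_ifs <;> nlinarith
  have hsum := sum_le_sum fun v (_ : v ∈ (univ : Finset α)) => hpt v
  rw [sum_add_distrib, sum_add_distrib, ← mul_sum univ (fun v => ∑ i, f i v) Q,
    sum_comm] at hsum
  have hf : ∑ i, ∑ v, f i v ≤ q * (W * (n - 1)) := by
    refine (sum_le_card_nsmul univ _ (W * (n - 1)) fun i _ => ?_).trans (by simp)
    have := sum_choose_le hB (hVi i)
    rwa [hVc i] at this
  simp only [sum_const, card_univ, hcard, smul_eq_mul, sum_ite_mem, univ_inter] at hsum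
  have h1 : #(E ∪ R)ᶜ ≤ Q * #E := by
    have h2 := Nat.mul_le_mul_left Q hf
    have h3 : W * #(E ∪ R)ᶜ ≤ W * (Q * #E) := by nlinarith
    exact Nat.le_of_mul_le_mul_left h3 hW0
  have h2 : Rᶜ ⊆ (E ∪ R)ᶜ ∪ E := by
    intro v
    simp only [mem_compl, mem_union]
    tauto
  have h3 := (card_le_card h2).trans (card_union_le _ _)
  linarith

lemma exists_clusters {k q t : ℕ} (hk : 1 ≤ k) (hq : 2 ≤ q) (ht : 1 ≤ t) (D : ℕ) (hD : 1 ≤ D) :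
    ∃ K, ∀ n, K ≤ n → ∀ (α : Type) [Fintype α] (G : SimpleGraph α),
      Fintype.card α = q * (n - 1) + 1 → NoBook G k n → NoTarget G (q + 1) t n K →
      ∃ A : Fin q → Finset α, (∀ i j, i ≠ j → Disjoint (A i) (A j)) ∧
        (∀ i, #(A i) ≤ n) ∧ (∀ i, D * n ≤ D * #(A i) + n) ∧
        ∀ i, ∀ v ∈ A i, D * #{x ∈ A i | G.Adj v x} ≤ n := by
  set S := 12 * (t * k) with hS
  have htk : 1 ≤ t * k := Nat.mul_pos ht hk
  have hkk : k ≤ t * k := Nat.le_mul_of_pos_left _ ht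
  have htt : t ≤ t * k := Nat.le_mul_of_pos_right _ hk
  obtain ⟨K₀, hK₀⟩ := exists_hasIndepParts hk hq t (show 1 ≤ S by omega)
  set M := D * (6 ^ k + 1) with hM
  have hDM : D ≤ M := Nat.le_mul_of_pos_right _ (Nat.succ_pos _)
  refine ⟨K₀ + M * 2 ^ (q * S) * (t + 1), fun n hn α _ G hcard hB hT => ?_⟩
  have hMS : M * 2 ^ (q * S) ≤ M * 2 ^ (q * S) * (t + 1) := Nat.le_mul_of_pos_right _ (by omega)
  have hTM : NoTarget G (q + 1) t n (M * 2 ^ (q * S)) := hT.mono (by omega)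
  obtain ⟨V, hV, hVi⟩ := hK₀ n (by omega) α G hcard hB (hT.mono (by omega))
  let d : Fin q → α → ℕ := fun i v => #{x ∈ V i | ¬ G.Adj v x}
  have hdS : ∀ i v, d i v ≤ S := fun i v => (card_filter_le _ _).trans (hVi i).2.le
  set E : Finset α := {v | (∀ i, d i v < S) ∧ ∃ i₀, ∀ i, i ≠ i₀ → d i v + t ≤ S} with hE
  let A : Fin q → Finset α := fun i => {v | d i v = S ∧ ∀ j, j ≠ i → 3 * d j v < S}
  have hEc : M * #E < n := card_few_nonNeighbours_lt hq hV (fun i => (hVi i).2) hTM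
    (by omega) (by omega) (fun v hv => (mem_filter.1 hv).2)
  have hRc := card_compl_clusters_le (t := t) (E := E) (R := univ.biUnion A) hk (by omega)
    (by omega) (by omega) hcard hB (fun i => (hVi i).1) (fun i => (hVi i).2) (by
      intro v hv
      simp only [hE, mem_filter, mem_univ, true_and, not_and_or, not_forall, not_exists] at hv
      rcases hv with ⟨i, hi⟩ | h
      · exact Or.inl ⟨i, le_antisymm (hdS i v) (not_lt.1 hi)⟩
      · refine Or.inr fun i₀ => ?_
        obtain ⟨i, hi, hlt⟩ := h i₀
        exact ⟨i, hi, not_le.1 hlt⟩) (by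
      intro v hv i hi
      simp only [mem_biUnion, mem_univ, true_and, not_exists] at hv
      have := hv i
      simp only [A, mem_filter, mem_univ, true_and, not_and, not_forall] at this
      obtain ⟨j, hj, hlt⟩ := this hi
      exact ⟨j, hj, not_lt.1 hlt⟩)
  have hAn : ∀ i, #(A i) ≤ n - 1 := by
    intro i
    obtain ⟨T, hTV, hTc⟩ := exists_subset_card_eq (show k ≤ #(V i) by rw [(hVi i).2]; omega)
    have h1 := hB T hTc fun x hx y hy => (hVi i).1 x (hTV hx) y (hTV hy)
    refine (card_le_card fun v hv => ?_).trans (Nat.le_pred_of_lt h1)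
    simp only [A, mem_filter, mem_univ, true_and] at hv ⊢
    have h2 := card_filter_eq_iff.1 (hv.1.trans (hVi i).2.symm)
    exact fun x hx => h2 x (hTV hx)
  refine ⟨A, fun i j hij => ?_, fun i => (hAn i).trans (Nat.sub_le _ _), fun i => ?_,
    fun i v hv => ?_⟩
  · rw [Finset.disjoint_left]
    intro v hvi hvj
    simp only [A, mem_filter, mem_univ, true_and] at hvi hvj
    have := hvj.2 i hij
    omega
  · have h1 : Fintype.card α ≤ #(univ.biUnion A) + #(univ.biUnion A)ᶜ := by
      rw [card_add_card_compl]
    have h2 : #(univ.biUnion A) ≤ #(A i) + (q - 1) * (n - 1) := by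
      refine card_biUnion_le.trans ?_
      rw [← add_sum_erase _ _ (mem_univ i)]
      refine Nat.add_le_add_left ((sum_le_card_nsmul _ _ _ fun j _ => hAn j).trans ?_) _
      simp [card_erase_of_mem]
    have h3 : D * #(univ.biUnion A)ᶜ ≤ n := by
      calc _ ≤ D * ((6 ^ k + 1) * #E) := Nat.mul_le_mul_left _ hRc
        _ = M * #E := by rw [hM]; ring
        _ ≤ n := hEc.le
    have h4 : n ≤ #(A i) + #(univ.biUnion A)ᶜ := by
      obtain ⟨q, rfl⟩ : ∃ r, q = r + 1 := ⟨q - 1, by omega⟩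
      rw [hcard, add_mul, one_mul] at h1
      simp only [Nat.add_sub_cancel] at h2
      omega
    calc D * n ≤ D * (#(A i) + #(univ.biUnion A)ᶜ) := Nat.mul_le_mul_left _ h4
      _ ≤ _ := by rw [mul_add]; omega
  · exact (Nat.mul_le_mul_right _ hDM).trans (few_internal_neighbours (i := i) hq hV
      (fun i => (hVi i).2) hTM (by omega) (by omega) (by omega)
      (fun v hv => (mem_filter.1 hv).2.2) hv).le

/-- Disjoint, almost independent sets of almost `n` vertices each, with almost no sparse pairs. -/
structure Clusters {α : Type} [Fintype α] {q : ℕ} (G : SimpleGraph α) (k D n : ℕ)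
    (A : Fin q → Finset α) : Prop where
  disjoint : ∀ i j, i ≠ j → Disjoint (A i) (A j)
  card_le : ∀ i, #(A i) ≤ n
  le_card : ∀ i, D * n ≤ D * #(A i) + n
  degree_le : ∀ i, ∀ v ∈ A i, D * #{x ∈ A i | G.Adj v x} ≤ n
  nonadj_le : ∀ i, ∀ T ⊆ A i, #T = k → Indep G T →
    D * #{v ∈ (A i)ᶜ | ∀ x ∈ T, ¬ G.Adj v x} ≤ n

lemma mul_le_mul_add_of_le {D D' n a : ℕ} (hD : D' ≤ D) (ha : a ≤ n) (h : D * n ≤ D * a + n) :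
    D' * n ≤ D' * a + n := by
  obtain ⟨e, rfl⟩ := Nat.exists_eq_add_of_le ha
  have := Nat.mul_le_mul_right e hD
  rw [mul_add] at h ⊢
  omega

lemma Clusters.mono {α : Type} [Fintype α] {q : ℕ} {G : SimpleGraph α} {k D D' n : ℕ}
    {A : Fin q → Finset α} (h : Clusters G k D n A) (hD : D' ≤ D) : Clusters G k D' n A where
  disjoint := h.disjoint
  card_le := h.card_le
  le_card i := mul_le_mul_add_of_le hD (h.card_le i) (h.le_card i)
  degree_le i v hv := (Nat.mul_le_mul_right _ hD).trans (h.degree_le i v hv)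
  nonadj_le i T hT hc hi := (Nat.mul_le_mul_right _ hD).trans (h.nonadj_le i T hT hc hi)

lemma exists_isClusters {k q t : ℕ} (hk : 1 ≤ k) (hq : 2 ≤ q) (ht : 1 ≤ t) (D : ℕ) (hD : 1 ≤ D) :
    ∃ K, ∀ n, K ≤ n → ∀ (α : Type) [Fintype α] (G : SimpleGraph α),
      Fintype.card α = q * (n - 1) + 1 → NoBook G k n → NoTarget G (q + 1) t n K →
      ∃ A : Fin q → Finset α, Clusters G k D n A := by
  have hDk : D ≤ 2 * k * D := Nat.le_mul_of_pos_left _ (by omega)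
  obtain ⟨K, hK⟩ := exists_clusters hk hq ht (2 * k * D) (by omega)
  refine ⟨K, fun n hn α _ G hcard hB hT => ?_⟩
  obtain ⟨A, hdisj, hle, hge, hdeg⟩ := hK n hn α G hcard hB hT
  refine ⟨A, hdisj, hle, fun i => ?_,
    fun i v hv => (Nat.mul_le_mul_right _ hDk).trans (hdeg i v hv), fun i T hTA hTc hTi => ?_⟩
  · exact mul_le_mul_add_of_le hDk (hle i) (hge i)
  · have h1 := hB T hTc hTi
    set F : Finset α := {v | ∀ x ∈ T, ¬ G.Adj v x} with hF
    have h2 : {v ∈ (A i)ᶜ | ∀ x ∈ T, ¬ G.Adj v x} = F \ A i := by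
      ext v; simp [hF, and_comm]
    have h3 : A i \ F ⊆ T.biUnion fun x => {v ∈ A i | G.Adj x v} := by
      intro v hv
      simp only [hF, mem_sdiff, mem_filter, mem_univ, true_and, not_forall, not_not] at hv
      obtain ⟨hvA, x, hx, hvx⟩ := hv
      exact mem_biUnion.2 ⟨x, hx, mem_filter.2 ⟨hvA, hvx.symm⟩⟩
    have h4 : 2 * k * D * #(A i \ F) ≤ k * n := by
      calc _ ≤ 2 * k * D * ∑ x ∈ T, #{v ∈ A i | G.Adj x v} :=
            Nat.mul_le_mul_left _ ((card_le_card h3).trans card_biUnion_le)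
        _ = ∑ x ∈ T, 2 * k * D * #{v ∈ A i | G.Adj x v} := mul_sum _ _ _
        _ ≤ #T * n := by
          rw [← smul_eq_mul]
          exact sum_le_card_nsmul _ _ _ fun x hx => hdeg i x (hTA hx)
        _ = k * n := by rw [hTc]
    have h5 : #(F \ A i) + #(A i) ≤ n + #(A i \ F) := by
      rw [card_sdiff_add_card, union_comm, ← card_sdiff_add_card]
      omega
    rw [h2]
    have h6 := Nat.mul_le_mul_left (2 * k * D) h5
    have h7 := hge i
    have h8 : 2 * k * (D * #(F \ A i)) ≤ 2 * k * n := by nlinarith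
    exact Nat.le_of_mul_le_mul_left h8 (by omega)

lemma exists_multipartite_in_clusters (q k t : ℕ) (l : Fin q) (J : Finset (Fin q)) :
    l ∉ J → ∀ C, 1 ≤ C → ∃ C' D, ∀ n, D ≤ n → ∀ (α : Type) [Fintype α] (G : SimpleGraph α)
      (A : Fin q → Finset α), Clusters G k D n A → ∀ U : Fin q → Finset α,
      (∀ j ∈ insert l J, U j ⊆ A j ∧ n ≤ C * #(U j)) →
      ∃ X : Fin q → Finset α, (∀ j ∈ insert l J, X j ⊆ U j) ∧
        (∀ i ∈ insert l J, ∀ j ∈ insert l J, i ≠ j → Complete G (X i) (X j)) ∧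
        (∀ j ∈ J, t ≤ #(X j)) ∧ n ≤ C' * #(X l) := by
  induction J using Finset.induction_on with
  | empty =>
    intro _ C _
    refine ⟨C, 0, fun n _ α _ G A _ U hU => ⟨U, fun _ _ => Subset.rfl, ?_, by simp,
      (hU l (by simp)).2⟩⟩
    intro i hi j hj hij
    simp only [insert_empty_eq, mem_singleton] at hi hj
    exact absurd (hi.trans hj.symm) hij
  | insert j₀ J hj₀ ih =>
    intro hl C hC
    rw [mem_insert, not_or] at hl
    set τ := t + q * k with hτ
    obtain ⟨C', D₁, hD₁⟩ := ih hl.2 (2 * C * 2 ^ τ) (by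
      have := Nat.one_le_two_pow (n := τ); nlinarith)
    refine ⟨C', D₁ + 2 * C * 2 ^ τ + (2 * (C * τ) + 1), fun n hn α _ G A hA U hU => ?_⟩
    set D := D₁ + 2 * C * 2 ^ τ + (2 * (C * τ) + 1) with hD
    obtain ⟨T, hTU, hTc, hTi⟩ : ∃ T ⊆ U j₀, #T = τ ∧ Indep G T := by
      by_contra! hcon
      obtain ⟨hUA, hUn⟩ := hU j₀ (by simp)
      have hUpos : 0 < #(U j₀) := by
        by_contra! h0
        have : #(U j₀) = 0 := by omega
        rw [this] at hUn
        omega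
      obtain ⟨u, hu, hdeg⟩ := exists_large_degree (card_pos.1 hUpos) hcon
      have h1 : #{x ∈ U j₀ | G.Adj u x} ≤ #{x ∈ A j₀ | G.Adj u x} :=
        card_le_card (filter_subset_filter _ hUA)
      have h2 := hA.degree_le j₀ u (hUA hu)
      have h3 : D * #{x ∈ U j₀ | G.Adj u x} ≤ n := (Nat.mul_le_mul_left _ h1).trans h2
      have h4 : n ≤ C * τ * (1 + #{x ∈ U j₀ | G.Adj u x}) := by
        rw [mul_assoc]
        exact hUn.trans (Nat.mul_le_mul_left _ hdeg)
      have h5 : D * n ≤ C * τ * D + C * τ * n := by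
        calc D * n ≤ D * (C * τ * (1 + #{x ∈ U j₀ | G.Adj u x})) := Nat.mul_le_mul_left _ h4
          _ = C * τ * D + C * τ * (D * #{x ∈ U j₀ | G.Adj u x}) := by ring
          _ ≤ _ := Nat.add_le_add_left (Nat.mul_le_mul_left _ h3) _
      have h6 : C * τ * D ≤ C * τ * n := Nat.mul_le_mul_left _ hn
      have h7 : (2 * (C * τ) + 1) * n ≤ D * n := Nat.mul_le_mul_right _ (by omega)
      have h8 : 0 < n := by omega
      nlinarith
    let B : Fin q → Finset α := fun j => {v ∈ U j | k ≤ #{x ∈ T | ¬ G.Adj v x}}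
    have hB : ∀ j ∈ insert l J, n ≤ 2 * C * #(U j \ B j) := by
      intro j hj
      have hjj : j ≠ j₀ := by
        rintro rfl
        rcases mem_insert.1 hj with h | h
        · exact hl.1 h.symm
        · exact hj₀ h
      obtain ⟨hUA, hUn⟩ := hU j (by
        rcases mem_insert.1 hj with h | h <;> simp [h])
      have h1 : B j ⊆ (T.powersetCard k).biUnion
          fun T' => {v ∈ (A j₀)ᶜ | ∀ x ∈ T', ¬ G.Adj v x} := by
        intro v hv
        simp only [B, mem_filter] at hv
        obtain ⟨T', hT', hT'c⟩ := exists_subset_card_eq hv.2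
        rw [mem_biUnion]
        refine ⟨T', mem_powersetCard.2 ⟨hT'.trans (filter_subset _ _), hT'c⟩,
          mem_filter.2 ⟨mem_compl.2 ?_, fun x hx => (mem_filter.1 (hT' hx)).2⟩⟩
        exact Finset.disjoint_left.1 (hA.disjoint j j₀ hjj) (hUA hv.1)
      have h2 : D * #(B j) ≤ 2 ^ τ * n := by
        calc _ ≤ D * ∑ T' ∈ T.powersetCard k, #{v ∈ (A j₀)ᶜ | ∀ x ∈ T', ¬ G.Adj v x} :=
              Nat.mul_le_mul_left _ ((card_le_card h1).trans card_biUnion_le)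
          _ = ∑ T' ∈ T.powersetCard k, D * #{v ∈ (A j₀)ᶜ | ∀ x ∈ T', ¬ G.Adj v x} := mul_sum _ _ _
          _ ≤ #(T.powersetCard k) * n := by
            rw [← smul_eq_mul]
            refine sum_le_card_nsmul _ _ _ fun T' hT' => ?_
            rw [mem_powersetCard] at hT'
            exact hA.nonadj_le j₀ T' (hT'.1.trans (hTU.trans (hU j₀ (by simp)).1)) hT'.2
              fun x hx y hy => hTi x (hT'.1 hx) y (hT'.1 hy)
          _ ≤ 2 ^ τ * n := by
            refine Nat.mul_le_mul_right _ ?_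
            rw [card_powersetCard, hTc]
            exact Nat.choose_le_two_pow _ _
      have h3 : 2 ^ τ * (2 * C * #(B j)) ≤ 2 ^ τ * n := by
        refine le_trans ?_ h2
        calc _ = 2 * C * 2 ^ τ * #(B j) := by ring
          _ ≤ _ := Nat.mul_le_mul_right _ (by omega)
      have h4 : 2 * C * #(B j) ≤ n := Nat.le_of_mul_le_mul_left h3 (by positivity)
      have h5 : #(U j \ B j) + #(B j) = #(U j) :=
        card_sdiff_add_card_eq_card (filter_subset _ _)
      rw [← h5] at hUn
      nlinarith
    choose W hWU P hWP hP using fun j => exists_common_trace G (U j \ B j) T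
    have hWn : ∀ j ∈ insert l J, n ≤ 2 * C * 2 ^ τ * #(W j) := by
      intro j hj
      have := hWP j
      rw [hTc] at this
      calc n ≤ 2 * C * #(U j \ B j) := hB j hj
        _ ≤ 2 * C * (2 ^ τ * #(W j)) := Nat.mul_le_mul_left _ this
        _ = _ := by ring
    have hsub : insert l J ⊆ insert l (insert j₀ J) := insert_subset_insert _ (subset_insert _ _)
    obtain ⟨X, hXW, hXc, hXt, hXl⟩ := hD₁ n (by omega) α G A (hA.mono (by omega)) W
      fun j hj => ⟨(hWU j).trans (sdiff_subset.trans (hU j (hsub hj)).1), hWn j hj⟩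
    set Y : Finset α := {x ∈ T | ∀ j ∈ insert l J, ∀ v ∈ W j, G.Adj v x} with hY
    have hYt : t ≤ #Y := by
      have h1 : T ⊆ Y ∪ (insert l J).biUnion fun j => {x ∈ T | ∃ v ∈ W j, ¬ G.Adj v x} := by
        intro x hx
        simp only [hY, mem_union, mem_filter, mem_biUnion]
        grind
      have h2 : ∀ j ∈ insert l J, #{x ∈ T | ∃ v ∈ W j, ¬ G.Adj v x} ≤ k := by
        intro j _
        rcases (W j).eq_empty_or_nonempty with h0 | ⟨w, hw⟩
        · simp [h0]
        · have h3 := hWU j hw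
          simp only [B, mem_sdiff, mem_filter, not_and, not_le] at h3
          refine le_trans (card_le_card fun x hx => ?_) (h3.2 h3.1).le
          simp only [mem_filter] at hx ⊢
          obtain ⟨hxT, v, hv, hvx⟩ := hx
          refine ⟨hxT, fun hwx => hvx ?_⟩
          have h4 : x ∈ {x ∈ T | G.Adj v x} := by
            rw [hP j v hv, ← hP j w hw]
            exact mem_filter.2 ⟨hxT, hwx⟩
          exact (mem_filter.1 h4).2
      have h3 := (card_le_card h1).trans ((card_union_le _ _).trans
        (Nat.add_le_add_left (card_biUnion_le.trans (sum_le_card_nsmul _ _ _ h2)) _))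
      have h4 : #(insert l J) ≤ q := by simpa using card_le_univ (insert l J)
      have h5 : #(insert l J) * k ≤ q * k := Nat.mul_le_mul_right _ h4
      rw [hTc, smul_eq_mul] at h3
      omega
    have hYX : ∀ j ∈ insert l J, Complete G Y (X j) := by
      intro j hj x hx y hy
      rw [hY, mem_filter] at hx
      exact (hx.2 j hj y (hXW j hj hy)).symm
    have hmem : ∀ j ∈ insert l (insert j₀ J), j ≠ j₀ → j ∈ insert l J := by
      intro j hj hne
      simp only [mem_insert] at hj ⊢
      tauto
    have hne : ∀ j, j ≠ j₀ → Function.update X j₀ Y j = X j := fun j hj => by simp [hj]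
    have heq : Function.update X j₀ Y j₀ = Y := by simp
    refine ⟨Function.update X j₀ Y, fun j hj => ?_, fun i hi j hj hij => ?_, fun j hj => ?_, ?_⟩
    · by_cases h : j = j₀
      · subst h
        rw [heq]
        exact (filter_subset _ _).trans hTU
      · rw [hne j h]
        exact (hXW j (hmem j hj h)).trans ((hWU j).trans sdiff_subset)
    · by_cases h : i = j₀
      · subst h
        rw [heq, hne j hij.symm]
        exact hYX j (hmem j hj hij.symm)
      by_cases h' : j = j₀
      · subst h'
        rw [heq, hne i hij]
        exact (hYX i (hmem i hi hij)).symm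
      · rw [hne i h, hne j h']
        exact hXc i (hmem i hi h) j (hmem j hj h') hij
    · by_cases h : j = j₀
      · subst h
        rwa [heq]
      · rw [hne j h]
        exact hXt j ((mem_insert.1 hj).resolve_left h)
    · rwa [hne l hl.1]

lemma exists_indep_common_nonNeighbour {α : Type} {G : SimpleGraph α} {A Y : Finset α} {k d : ℕ}
    (hk : 1 ≤ k) (hdeg : ∀ x ∈ A, #{y ∈ A | G.Adj x y} ≤ d) (hA : 6 * (k * (1 + d)) ≤ #A)
    (hY : ∀ v ∈ Y, 3 * #{x ∈ A | G.Adj v x} ≤ 2 * #A) (m : ℕ) (hm : m ≤ k) :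
    ∃ T ⊆ A, #T = m ∧ Indep G T ∧ #Y ≤ 6 ^ m * #{v ∈ Y | ∀ x ∈ T, ¬ G.Adj v x} := by
  induction m with
  | zero => exact ⟨∅, empty_subset _, rfl, by simp [Indep], by simp⟩
  | succ m ih =>
    obtain ⟨T, hTA, hTc, hTi, hTY⟩ := ih (by omega)
    set Y' : Finset α := {v ∈ Y | ∀ x ∈ T, ¬ G.Adj v x} with hY'
    set B : Finset α := T.biUnion fun x => insert x {y ∈ A | G.Adj x y} with hB
    have hBc : 6 * #B ≤ #A := by
      have h1 : #B ≤ m * (1 + d) := by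
        rw [← hTc]
        refine card_biUnion_le_card_mul _ _ _ fun x hx => (card_insert_le _ _).trans ?_
        have := hdeg x (hTA hx)
        omega
      have h2 : m * (1 + d) ≤ k * (1 + d) := Nat.mul_le_mul_right _ (by omega)
      omega
    have hApos : 0 < #A := by
      have : 1 * 1 ≤ k * (1 + d) := Nat.mul_le_mul hk (by omega)
      omega
    have hne : (A \ B).Nonempty := by
      rw [← card_pos]
      have := le_card_sdiff B A
      omega
    have hdense : ∀ v ∈ Y', #(A \ B) ≤ 6 * #{x ∈ A \ B | ¬ G.Adj v x} := by
      intro v hv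
      have h1 := hY v (mem_filter.1 hv).1
      have h2 : A ⊆ {x ∈ A | G.Adj v x} ∪ (B ∪ {x ∈ A \ B | ¬ G.Adj v x}) := by
        intro x hx
        simp only [mem_union, mem_filter, mem_sdiff]
        tauto
      have h3 := (card_le_card h2).trans ((card_union_le _ _).trans
        (Nat.add_le_add_left (card_union_le _ _) _))
      have h4 := card_le_card (sdiff_subset (s := A) (t := B))
      omega
    obtain ⟨x, hx, hxY⟩ : ∃ x ∈ A \ B, #Y' ≤ 6 * #{v ∈ Y' | ¬ G.Adj v x} := by
      refine exists_le_of_sum_le hne ?_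
      have h1 : ∑ x ∈ A \ B, #{v ∈ Y' | ¬ G.Adj v x} = ∑ v ∈ Y', #{x ∈ A \ B | ¬ G.Adj v x} := by
        simp_rw [card_filter]
        exact sum_comm
      rw [← mul_sum, h1, mul_sum, sum_const, smul_eq_mul, mul_comm, ← smul_eq_mul]
      exact card_nsmul_le_sum _ _ _ hdense
    rw [mem_sdiff, hB, mem_biUnion] at hx
    obtain ⟨hxA, hxB⟩ := hx
    have hxT : ∀ y ∈ T, y ≠ x ∧ ¬ G.Adj y x := by
      refine fun y hy => ⟨?_, fun h => ?_⟩
      · rintro rfl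
        exact hxB ⟨y, hy, mem_insert_self _ _⟩
      · exact hxB ⟨y, hy, mem_insert_of_mem (mem_filter.2 ⟨hxA, h⟩)⟩
    refine ⟨insert x T, insert_subset hxA hTA, ?_, ?_, ?_⟩
    · rw [card_insert_of_notMem (fun h => (hxT x h).1 rfl), hTc]
    · intro y hy z hz
      rcases mem_insert.1 hy with rfl | hy' <;> rcases mem_insert.1 hz with rfl | hz'
      · exact G.loopless.irrefl _
      · exact fun h => (hxT z hz').2 h.symm
      · exact (hxT y hy').2
      · exact hTi y hy' z hz'
    · have h1 : {v ∈ Y | ∀ y ∈ insert x T, ¬ G.Adj v y} = {v ∈ Y' | ¬ G.Adj v x} := by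
        ext v
        simp only [hY', mem_filter, mem_insert, forall_eq_or_imp]
        tauto
      rw [h1, pow_succ, mul_assoc]
      exact hTY.trans (Nat.mul_le_mul_left _ hxY)

lemma exists_multipartite_in_clusters_uniform (q k t C : ℕ) (hC : 1 ≤ C) :
    ∃ C' D, ∀ (l : Fin q) (J : Finset (Fin q)), l ∉ J → ∀ n, D ≤ n →
      ∀ (α : Type) [Fintype α] (G : SimpleGraph α)
      (A : Fin q → Finset α), Clusters G k D n A → ∀ U : Fin q → Finset α,
      (∀ j ∈ insert l J, U j ⊆ A j ∧ n ≤ C * #(U j)) →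
      ∃ X : Fin q → Finset α, (∀ j ∈ insert l J, X j ⊆ U j) ∧
        (∀ i ∈ insert l J, ∀ j ∈ insert l J, i ≠ j → Complete G (X i) (X j)) ∧
        (∀ j ∈ insert l J, t ≤ #(X j) ∧ 0 < #(X j)) ∧ n ≤ C' * #(X l) := by
  have h : ∀ (l : Fin q) (J : Finset (Fin q)), ∃ C' D, l ∉ J → _ := fun l J =>
    (Classical.em (l ∉ J)).elim
      (fun hl => let ⟨C', D, hCD⟩ := exists_multipartite_in_clusters q k (t + 1) l J hl C hC
        ⟨C', D, fun _ => hCD⟩)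
      (fun hl => ⟨0, 0, fun h => absurd h hl⟩)
  choose fC fD hfD using h
  set C' := 1 + ∑ l, ∑ J, fC l J with hC'
  set D := ∑ l, ∑ J, fD l J + C' * (t + 1) with hD
  refine ⟨C', D, fun l J hl n hn α _ G A hA U hU => ?_⟩
  have h1 : ∀ f : Fin q → Finset (Fin q) → ℕ, f l J ≤ ∑ l, ∑ J, f l J := fun f =>
    (single_le_sum (f := fun J => f l J) (fun _ _ => Nat.zero_le _) (mem_univ J)).trans
      (single_le_sum (f := fun l => ∑ J, f l J) (fun _ _ => Nat.zero_le _) (mem_univ l))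
  have h2 := h1 fC
  have h3 := h1 fD
  obtain ⟨X, hXU, hXc, hXt, hXl⟩ := hfD l J hl n (by omega) α G A (hA.mono (by omega)) U hU
  have hXl' : n ≤ C' * #(X l) := hXl.trans (Nat.mul_le_mul_right _ (by omega))
  refine ⟨X, hXU, hXc, fun j hj => ?_, hXl'⟩
  have : t + 1 ≤ #(X j) := by
    rcases mem_insert.1 hj with rfl | hj
    · exact Nat.le_of_mul_le_mul_left ((show C' * (t + 1) ≤ n by omega).trans hXl') (by omega)
    · exact hXt j hj
  omega

lemma Clusters.card_sparse_le {α : Type} [Fintype α] {G : SimpleGraph α} {k q D n : ℕ}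
    {A : Fin q → Finset α} (hA : Clusters G k D n A) (hk : 1 ≤ k) (hD : 24 * k ≤ D) (hn : D ≤ n)
    {i j : Fin q} (hij : i ≠ j) {L : ℕ} (hL : L * 6 ^ k ≤ D) :
    L * #{v ∈ A i | 3 * #{x ∈ A j | G.Adj v x} ≤ 2 * #(A j)} ≤ n := by
  set Y : Finset α := {v ∈ A i | 3 * #{x ∈ A j | G.Adj v x} ≤ 2 * #(A j)} with hY
  have hdeg : ∀ x ∈ A j, #{y ∈ A j | G.Adj x y} ≤ n / D := fun x hx => by
    rw [Nat.le_div_iff_mul_le (by omega), mul_comm]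
    exact hA.degree_le j x hx
  have hn2 : n ≤ 2 * #(A j) := by
    have := mul_le_mul_add_of_le (show 2 ≤ D by omega) (hA.card_le j) (hA.le_card j)
    omega
  have hbig : 6 * (k * (1 + n / D)) ≤ #(A j) := by
    have h1 : D * (n / D) ≤ n := Nat.mul_div_le n D
    have h2 : 24 * k * (n / D) ≤ n := (Nat.mul_le_mul_right _ hD).trans h1
    nlinarith
  obtain ⟨T, hTA, hTc, hTi, hTY⟩ := exists_indep_common_nonNeighbour (Y := Y) hk hdeg hbig
    (fun v hv => (mem_filter.1 hv).2) k le_rfl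
  have hTY' : #Y ≤ 6 ^ k * #{v ∈ Y | ∀ x ∈ T, ¬ G.Adj v x} := by convert hTY
  have h1 : {v ∈ Y | ∀ x ∈ T, ¬ G.Adj v x} ⊆ {v ∈ (A j)ᶜ | ∀ x ∈ T, ¬ G.Adj v x} := by
    refine filter_subset_filter _ fun v hv => mem_compl.2 ?_
    exact Finset.disjoint_left.1 (hA.disjoint i j hij) (mem_filter.1 hv).1
  calc L * #Y ≤ L * (6 ^ k * #{v ∈ Y | ∀ x ∈ T, ¬ G.Adj v x}) := Nat.mul_le_mul_left _ hTY'
    _ = L * 6 ^ k * #{v ∈ Y | ∀ x ∈ T, ¬ G.Adj v x} := by ring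
    _ ≤ D * #{v ∈ (A j)ᶜ | ∀ x ∈ T, ¬ G.Adj v x} := Nat.mul_le_mul hL (card_le_card h1)
    _ ≤ n := hA.nonadj_le j T hTA hTc hTi

/-- The vertices with few neighbours in `A i` and many in every other `A j`. -/
noncomputable def typical {α : Type} [Fintype α] {q : ℕ} (G : SimpleGraph α) (C n : ℕ)
    (A : Fin q → Finset α) (i : Fin q) : Finset α :=
  {v | C * #{x ∈ A i | G.Adj v x} < n ∧ ∀ j, j ≠ i → 2 * #(A j) < 3 * #{x ∈ A j | G.Adj v x}}

lemma Clusters.le_card_typical {α : Type} [Fintype α] {G : SimpleGraph α} {k q C D n : ℕ}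
    {A : Fin q → Finset α} (hA : Clusters G k D n A) (hk : 1 ≤ k) (hD : 24 * k ≤ D) (hn : D ≤ n)
    (hCD : C < D) (hL : 24 * q * 6 ^ k ≤ D) (i : Fin q) :
    n - n / 12 ≤ #(A i ∩ typical G C n A i) := by
  have h1 : A i ⊆ (A i ∩ typical G C n A i) ∪
      univ.biUnion fun j => if j = i then ∅ else
        {v ∈ A i | 3 * #{x ∈ A j | G.Adj v x} ≤ 2 * #(A j)} := by
    intro v hv
    by_cases h : ∀ j, j ≠ i → 2 * #(A j) < 3 * #{x ∈ A j | G.Adj v x}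
    · refine mem_union_left _ (mem_inter.2 ⟨hv, mem_filter.2 ⟨mem_univ _, ?_, h⟩⟩)
      have h2 := hA.degree_le i v hv
      rcases Nat.eq_zero_or_pos #{x ∈ A i | G.Adj v x} with h0 | h0
      · rw [h0]; omega
      · exact (Nat.mul_lt_mul_of_pos_right hCD h0).trans_le h2
    · push Not at h
      obtain ⟨j, hj, hjv⟩ := h
      refine mem_union_right _ (mem_biUnion.2 ⟨j, mem_univ _, ?_⟩)
      simp [hj, hv, hjv]
  have h2 := (card_le_card h1).trans ((card_union_le _ _).trans
    (Nat.add_le_add_left card_biUnion_le _))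
  have h3 : 24 * q * ∑ j, #(if j = i then ∅ else
      {v ∈ A i | 3 * #{x ∈ A j | G.Adj v x} ≤ 2 * #(A j)}) ≤ q * n := by
    rw [mul_sum]
    refine (sum_le_card_nsmul _ _ n fun j _ => ?_).trans (by simp)
    by_cases hj : j = i
    · simp [hj]
    · simp only [hj, if_false]
      exact hA.card_sparse_le hk hD hn (Ne.symm hj) hL
  have h4 : 24 * ∑ j, #(if j = i then ∅ else
      {v ∈ A i | 3 * #{x ∈ A j | G.Adj v x} ≤ 2 * #(A j)}) ≤ n :=
    Nat.le_of_mul_le_mul_left (by linarith) i.pos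
  have h5 := mul_le_mul_add_of_le (show 24 ≤ D by omega) (hA.card_le i) (hA.le_card i)
  omega

lemma false_of_typical_cover {α : Type} [Fintype α] {G : SimpleGraph α} {k q n : ℕ}
    (hk : 1 ≤ k) (hn : 24 * k ≤ n) (hcard : Fintype.card α = q * (n - 1) + 1)
    (hB : NoBook G k n) {A : Fin q → Finset α} (hAn : ∀ i, #(A i) ≤ n)
    (hlarge : ∀ i, n - n / 12 ≤ #(A i ∩ typical G (2 * k * 8 ^ k) n A i))
    (hind : ∀ i, Indep G (typical G (2 * k * 8 ^ k) n A i))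
    (hlow : ∀ v, ∃ i, 2 * k * 8 ^ k * #{x ∈ A i | G.Adj v x} < n) : False := by
  set C := 2 * k * 8 ^ k with hC
  set M := n - n / 12 with hM
  choose I hIsub hIc using fun i => exists_subset_card_eq (hlarge i)
  have hIA : ∀ i, I i ⊆ A i := fun i => (hIsub i).trans inter_subset_left
  have hIty : ∀ i, I i ⊆ typical G C n A i := fun i => (hIsub i).trans inter_subset_right
  set W := M.choose k with hW
  have hW0 : 0 < W := Nat.choose_pos (by omega)
  let f : Fin q → α → ℕ := fun i v => (#{x ∈ I i | ¬ G.Adj v x}).choose k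
  have hpt : ∀ v, W ≤ ∑ i, f i v := by
    intro v
    obtain ⟨i, hi⟩ := hlow v
    have hone : f i v ≤ ∑ i, f i v :=
      single_le_sum (f := fun i => f i v) (fun _ _ => Nat.zero_le _) (mem_univ i)
    have hnon : ∀ j, M ≤ #{x ∈ I j | ¬ G.Adj v x} + #{x ∈ A j | G.Adj v x} := by
      intro j
      have h1 := card_filter_add_card_filter_not (s := I j) (fun x => G.Adj v x)
      have h2 : #{x ∈ I j | G.Adj v x} ≤ #{x ∈ A j | G.Adj v x} :=
        card_le_card (filter_subset_filter _ (hIA j))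
      rw [hIc] at h1
      omega
    by_cases h : ∀ j, j ≠ i → 2 * #(A j) < 3 * #{x ∈ A j | G.Adj v x}
    · have hv : v ∈ typical G C n A i := mem_filter.2 ⟨mem_univ _, hi, h⟩
      have h1 : {x ∈ I i | ¬ G.Adj v x} = I i :=
        filter_true_of_mem fun x hx => hind i v hv x (hIty i hx)
      have h2 : f i v = W := by simp only [f, h1, hIc i, hW, hM]
      omega
    · push Not at h
      obtain ⟨j, hj, hjv⟩ := h
      have htwo : f i v + f j v ≤ ∑ i, f i v := by
        rw [← sum_pair hj.symm (f := fun i => f i v)]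
        exact sum_le_sum_of_subset (subset_univ _)
      refine le_trans ?_ htwo
      set x := #{x ∈ A i | G.Adj v x} with hx
      have h1 : (M - x).choose k ≤ f i v :=
        Nat.choose_le_choose _ (by have := hnon i; omega)
      have h2 : W ≤ 8 ^ k * f j v := by
        have := hnon j
        have := hAn j
        have := choose_le_pow_mul_choose (m := M) (d := #{x ∈ I j | ¬ G.Adj v x}) (k := k) (K := 4)
          (by omega) (by omega)
        simpa using this
      have h3 := choose_mul_sub_le (m := M) hk x
      have h4 : 8 ^ k * (x * k) ≤ M := by
        have : 2 * (8 ^ k * (x * k)) = C * x := by rw [hC]; ring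
        omega
      have h5 : M * (8 ^ k * W) ≤ M * (8 ^ k * (M - x).choose k + W) := by
        have h6 := Nat.mul_le_mul_left (8 ^ k) h3
        have h7 := Nat.mul_le_mul_right W h4
        nlinarith
      have h6 := Nat.le_of_mul_le_mul_left h5 (show 0 < M by omega)
      have h7 : 8 ^ k * W ≤ 8 ^ k * (f i v + f j v) := by
        have := Nat.mul_le_mul_left (8 ^ k) h1
        rw [mul_add]
        omega
      exact Nat.le_of_mul_le_mul_left h7 (by positivity)
  have hlb : Fintype.card α * W ≤ ∑ v, ∑ i, f i v := by
    rw [← smul_eq_mul, ← card_univ]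
    exact card_nsmul_le_sum _ _ _ fun v _ => hpt v
  have hub : ∑ v, ∑ i, f i v ≤ q * (W * (n - 1)) := by
    rw [sum_comm]
    refine (sum_le_card_nsmul univ _ (W * (n - 1)) fun i _ => ?_).trans (by simp)
    have := sum_choose_le hB (V := I i)
      (fun x hx y hy => hind i x (hIty i hx) y (hIty i hy))
    rwa [hIc i] at this
  rw [hcard] at hlb
  nlinarith

/-- Beyond a suitable `K`, a graph on `q (n - 1) + 1` vertices cannot avoid both a complete
`(q + 1)`-partite subgraph and a book in the complement. -/
theorem exists_not_noBook_noTarget {k q t : ℕ} (hk : 1 ≤ k) (hq : 2 ≤ q) (ht : 1 ≤ t) :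
    ∃ K, ∀ n, K ≤ n → ∀ (α : Type) [Fintype α] (G : SimpleGraph α),
      Fintype.card α = q * (n - 1) + 1 → NoBook G k n → NoTarget G (q + 1) t n K → False := by
  set C := 2 * k * 8 ^ k with hC
  have hC6 : 6 ≤ C := by
    have h1 : 8 ^ 1 ≤ 8 ^ k := Nat.pow_le_pow_right (by norm_num) hk
    nlinarith
  obtain ⟨C', D₀, hD₀⟩ := exists_multipartite_in_clusters_uniform q k t C (by omega)
  set D := D₀ + 24 * k + (C + 1) + 24 * q * 6 ^ k with hD
  obtain ⟨K, hK⟩ := exists_isClusters (q := q) hk hq ht D (by omega)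
  refine ⟨K + C' + D, fun n hn α _ G hcard hB hT => ?_⟩
  obtain ⟨A, hA⟩ := hK n (by omega) α G hcard hB (hT.mono (by omega))
  have : Nontrivial (Fin q) := Fin.nontrivial_iff_two_le.2 hq
  have hTC : NoTarget G (q + 1) t n C' := hT.mono (by omega)
  refine false_of_typical_cover hk (by omega) hcard hB hA.card_le
    (hA.le_card_typical hk (by omega) (by omega) (by omega) (by omega)) (fun i u hu v hv huv => ?_)
    (fun v => ?_)
  · obtain ⟨l, hl⟩ := exists_ne i
    have hmem : ∀ j, j ∈ insert l ((univ.erase i).erase l) ↔ j ≠ i := by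
      intro j
      simp only [mem_insert, mem_erase, mem_univ, and_true]
      grind
    obtain ⟨X, hXU, hXc, hXt, hXl⟩ := hD₀ l ((univ.erase i).erase l) (by simp) n (by omega) α G A
      (hA.mono (by omega)) (fun j => {x ∈ A j | G.Adj u x ∧ G.Adj v x}) (by
        intro j hj
        rw [hmem] at hj
        refine ⟨filter_subset _ _, ?_⟩
        have h1 := (mem_filter.1 hu).2.2 j hj
        have h2 := (mem_filter.1 hv).2.2 j hj
        have h3 : #{x ∈ A j | G.Adj u x} + #{x ∈ A j | G.Adj v x} ≤
            #(A j) + #{x ∈ A j | G.Adj u x ∧ G.Adj v x} := by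
          rw [← card_union_add_card_inter, ← filter_and]
          exact Nat.add_le_add_right
            (card_le_card (union_subset (filter_subset _ _) (filter_subset _ _))) _
        have h4 := mul_le_mul_add_of_le (show 2 ≤ D by omega) (hA.card_le j) (hA.le_card j)
        have h5 : 6 * #{x ∈ A j | G.Adj u x ∧ G.Adj v x} ≤
          C * #{x ∈ A j | G.Adj u x ∧ G.Adj v x} := Nat.mul_le_mul_right _ hC6
        omega)
    have hne : ∀ j, j ≠ i → Function.update X i {v} j = X j := fun j hj => by simp [hj]
    have heq : Function.update X i {v} i = {v} := by simp
    have hvX : ∀ j, j ≠ i → Complete G {v} (X j) := fun j hj x hx y hy => by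
      rw [mem_singleton.1 hx]
      exact (mem_filter.1 (hXU j ((hmem j).2 hj) hy)).2.2
    refine hTC (Option (Fin q)) (fun o => o.elim {u} (Function.update X i {v})) none (some i)
      (some l) (by simp) (by simp) (by simp) (by simpa using hl.symm)
      (PairwiseComplete.option ?_ ?_) ?_ ?_ (by simpa [hl] using hXl)
    · intro j j' hjj
      by_cases hj : j = i
      · subst hj
        rw [heq, hne j' hjj.symm]
        exact hvX j' hjj.symm
      by_cases hj' : j' = i
      · subst hj'
        rw [heq, hne j hjj]
        exact (hvX j hjj).symm
      · rw [hne j hj, hne j' hj']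
        exact hXc j ((hmem j).2 hj) j' ((hmem j').2 hj') hjj
    · intro j x hx y hy
      rw [mem_singleton.1 hx]
      by_cases hj : j = i
      · subst hj
        rw [heq, mem_singleton] at hy
        rwa [hy]
      · rw [hne j hj] at hy
        exact (mem_filter.1 (hXU j ((hmem j).2 hj) hy)).2.1
    · rintro (_ | j)
      · exact singleton_nonempty u
      · simp only [Option.elim_some]
        by_cases hj : j = i
        · subst hj
          rw [heq]
          exact singleton_nonempty v
        · rw [hne j hj]
          exact card_pos.1 (hXt j ((hmem j).2 hj)).2
    · rintro (_ | j) h0 h1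
      · exact absurd rfl h0
      · have hj : j ≠ i := by simpa using h1
        simp only [Option.elim_some]
        rw [hne j hj]
        exact (hXt j ((hmem j).2 hj)).1
  · by_contra! hall
    obtain ⟨l⟩ : Nonempty (Fin q) := inferInstance
    obtain ⟨i, hi⟩ := exists_ne l
    have hmem : ∀ j, j ∈ insert l (univ.erase l) := by
      intro j
      simp only [mem_insert, mem_erase, mem_univ, and_true]
      tauto
    obtain ⟨X, hXU, hXc, hXt, hXl⟩ := hD₀ l (univ.erase l) (by simp) n (by omega) α G A
      (hA.mono (by omega)) (fun j => {x ∈ A j | G.Adj v x})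
      (fun j _ => ⟨filter_subset _ _, hall j⟩)
    refine hTC (Option (Fin q)) (fun o => o.elim {v} X) none (some i)
      (some l) (by simp) (by simp) (by simp) (by simpa using hi)
      (PairwiseComplete.option ?_ ?_) ?_ ?_ hXl
    · exact fun j j' hjj => hXc j (hmem j) j' (hmem j') hjj
    · intro j x hx y hy
      rw [mem_singleton.1 hx]
      exact (mem_filter.1 (hXU j (hmem j) hy)).2
    · rintro (_ | j)
      · exact singleton_nonempty v
      · exact card_pos.1 (hXt j (hmem j)).2
    · rintro (_ | j) h0 h1
      · exact absurd rfl h0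
      · exact (hXt j (hmem j)).1

lemma hasCopy_of_parts {α : Type} {H : SimpleGraph α} {p : ℕ} {a : Fin p → ℕ}
    {V : Fin p → Finset α} (hV : PairwiseComplete H V) (ha : ∀ i, a i ≤ #(V i)) :
    HasCopy H (completeMultipartiteGraph fun i => Fin (a i)) := by
  have h : ∀ i, Nonempty (Fin (a i) ↪ V i) := fun i =>
    Function.Embedding.nonempty_of_card_le (by simpa using ha i)
  have hadj : ∀ x y : (Σ i : Fin p, Fin (a i)), x.1 ≠ y.1 →
      H.Adj ((h x.1).some x.2 : α) ((h y.1).some y.2) := fun x y hxy =>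
    hV _ _ hxy _ (Subtype.prop _) _ (Subtype.prop _)
  refine ⟨⟨fun x => ((h x.1).some x.2 : α), fun {x y} hxy => hadj x y hxy⟩, ?_⟩
  rintro ⟨i, x⟩ ⟨j, y⟩ hxy
  by_cases hij : i = j
  · subst hij
    simpa using hxy
  · exact absurd hxy (hadj ⟨i, x⟩ ⟨j, y⟩ hij).ne

lemma noBook_of_not_hasCopy {α : Type} [Fintype α] {G : SimpleGraph α} {k n : ℕ}
    (h : ¬ HasCopy Gᶜ (Book k n)) : NoBook G k n := by
  intro T hT hTi
  by_contra! hn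
  set N : Finset α := {v | ∀ x ∈ T, ¬ G.Adj v x} with hN
  let e := (T.equivFinOfCardEq hT).symm
  refine h (hasCopy_of_parts
    (V := fun i => if hi : (i : ℕ) < k then {(e ⟨i, hi⟩ : α)} else N \ T) ?_ ?_)
  · intro i j hij x hx y hy
    have hpage : ∀ z ∈ T, ∀ w ∈ N \ T, Gᶜ.Adj z w := by
      intro z hz w hw
      rw [mem_sdiff, hN, mem_filter] at hw
      rw [compl_adj]
      exact ⟨fun hzw => hw.2 (hzw ▸ hz), fun hzw => hw.1.2 z hz hzw.symm⟩
    by_cases hi : (i : ℕ) < k <;> by_cases hj : (j : ℕ) < k <;>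
      simp only [hi, hj, dif_pos, dif_neg, mem_singleton, not_false_eq_true] at hx hy
    · subst hx hy
      rw [compl_adj]
      refine ⟨fun h => hij ?_, hTi _ (Subtype.prop _) _ (Subtype.prop _)⟩
      have := e.injective (Subtype.ext h)
      simpa [Fin.ext_iff] using this
    · subst hx
      exact hpage _ (Subtype.prop _) _ hy
    · subst hy
      exact (hpage _ (Subtype.prop _) _ hx).symm
    · omega
  · intro i
    by_cases hi : (i : ℕ) < k
    · simp [hi]
    · have := le_card_sdiff T N
      simp only [hi, if_false, dif_neg, not_false_eq_true]
      omega

lemma exists_equiv_three {ι : Type} [Fintype ι] {p : ℕ} (hp : 3 ≤ p) (hι : Fintype.card ι = p)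
    {i₀ i₁ i₂ : ι} (h01 : i₀ ≠ i₁) (h02 : i₀ ≠ i₂) (h12 : i₁ ≠ i₂) :
    ∃ e : Fin p ≃ ι, e ⟨0, by omega⟩ = i₀ ∧ e ⟨1, by omega⟩ = i₁ ∧ e ⟨p - 1, by omega⟩ = i₂ := by
  let e₀ : Fin p ≃ ι := (Fintype.equivFinOfCardEq hι).symm
  let j : Fin 3 → ι := ![i₀, i₁, i₂]
  let m : Fin 3 → ι := ![e₀ ⟨0, by omega⟩, e₀ ⟨1, by omega⟩, e₀ ⟨p - 1, by omega⟩]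
  have hj : Function.Injective j := by
    intro a b
    fin_cases a <;> fin_cases b <;> simp [j, h01, h02, h12, h01.symm, h02.symm, h12.symm]
  have hm : Function.Injective m := by
    intro a b
    fin_cases a <;> fin_cases b <;> simp [m] <;> omega
  obtain ⟨σ, hσ⟩ := (Equiv.Perm.isMultiplyPretransitive ι 3).exists_smul_eq ⟨m, hm⟩ ⟨j, hj⟩
  have hσ' : ∀ x, σ (m x) = j x := fun x => DFunLike.congr_fun hσ x
  exact ⟨e₀.trans σ, hσ' 0, hσ' 1, hσ' 2⟩

lemma noTarget_of_not_hasCopy {α : Type} {G : SimpleGraph α} {p t n K : ℕ} (hp : 3 ≤ p)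
    {a : Fin p → ℕ} (ht : ∀ i : Fin p, (i : ℕ) < p - 1 → a i ≤ t)
    (hK : (K + 1) * a ⟨p - 1, by omega⟩ ≤ n) (h0 : a ⟨0, by omega⟩ = 1) (h1 : a ⟨1, by omega⟩ = 1)
    (h : ¬ HasCopy G (KMulti a)) : NoTarget G p t n K := by
  intro ι _ V i₀ i₁ i₂ hι h01 h02 h12 hV hne hVt hn
  obtain ⟨e, he0, he1, he2⟩ := exists_equiv_three hp hι h01 h02 h12
  refine h (hasCopy_of_parts (V := fun i => V (e i))
    (fun i j hij => hV _ _ (e.injective.ne hij)) fun i => ?_)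
  by_cases hi0 : i = ⟨0, by omega⟩
  · rw [hi0, h0]
    exact card_pos.2 (hne _)
  by_cases hi1 : i = ⟨1, by omega⟩
  · rw [hi1, h1]
    exact card_pos.2 (hne _)
  by_cases hi2 : i = ⟨p - 1, by omega⟩
  · rw [hi2, he2]
    by_contra! hlt
    have := Nat.mul_le_mul_left K hlt.le
    nlinarith
  · refine (ht i ?_).trans (hVt _ ?_ ?_)
    · simp only [Fin.ext_iff] at hi2
      omega
    · exact he0 ▸ e.injective.ne hi0
    · exact he1 ▸ e.injective.ne hi1

lemma not_ramsey_of_le {p k n N : ℕ} (hp : 1 ≤ p) (hk : 1 ≤ k) (hkn : k ≤ n) {a : Fin p → ℕ}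
    (ha : ∀ i, 1 ≤ a i) (hN : N ≤ (p - 1) * (n - 1)) :
    ∃ G : SimpleGraph (Fin N), ¬ HasCopy G (KMulti a) ∧ ¬ HasCopy Gᶜ (Book k n) := by
  refine ⟨SimpleGraph.mk (fun v w => (v : ℕ) / (n - 1) ≠ w / (n - 1)) ⟨fun _ _ h => h.symm⟩
    ⟨fun _ h => h rfl⟩, ?_, ?_⟩
  · rintro ⟨f, -⟩
    let c : Fin p → Fin (p - 1) := fun i =>
      ⟨(f ⟨i, ⟨0, ha i⟩⟩ : ℕ) / (n - 1), Nat.div_lt_of_lt_mul (by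
        rw [mul_comm]
        exact (Fin.is_lt _).trans_le hN)⟩
    obtain ⟨i, j, hij, hc⟩ := Fintype.exists_ne_map_eq_of_card_lt c (by simp; omega)
    have hadj : (KMulti a).Adj ⟨i, ⟨0, ha i⟩⟩ ⟨j, ⟨0, ha j⟩⟩ := hij
    exact f.map_adj hadj (congrArg Fin.val hc)
  · rintro ⟨f, hf⟩
    have hpos : 0 < if ((0 : Fin (k + 1)) : ℕ) < k then 1 else n - k := by
      simp [show 0 < k by omega]
    have hcol : ∀ x, (f x : ℕ) / (n - 1) = (f ⟨0, ⟨0, hpos⟩⟩ : ℕ) / (n - 1) := by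
      rintro ⟨i, x⟩
      by_cases hi : i = 0
      · subst hi
        congr
        have := x.2
        simp only [Fin.val_zero, show 0 < k by omega, if_true] at this
        ext
        simp; omega
      · have hadj : (Book k n).Adj ⟨i, x⟩ ⟨0, ⟨0, hpos⟩⟩ := hi
        by_contra hne
        exact ((compl_adj _ _ _).1 (f.map_adj hadj)).2 hne
    have hn : 0 < n - 1 := by
      rcases Nat.eq_zero_or_pos (n - 1) with h | h
      · rw [h, mul_zero] at hN
        exact absurd (f ⟨0, ⟨0, hpos⟩⟩).is_lt (by omega)
      · exact h
    have hcard := Fintype.card_le_of_injective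
      (fun x => (⟨(f x : ℕ) % (n - 1), Nat.mod_lt _ hn⟩ : Fin (n - 1))) (fun x y hxy => by
        refine hf (Fin.ext ?_)
        rw [← Nat.div_add_mod (f x : ℕ) (n - 1), ← Nat.div_add_mod (f y : ℕ) (n - 1), hcol x,
          hcol y]
        simpa using hxy)
    simp [Fin.sum_univ_castSucc] at hcard
    omega

lemma exists_forall_hasCopy {k p t : ℕ} (hk : 2 ≤ k) (hp : 2 ≤ p) (ht : 2 ≤ t) :
    ∃ K : ℕ, ∀ n, K ≤ n → ∀ a : Fin p → ℕ, (∀ i : Fin p, (i : ℕ) < p - 1 → a i ≤ t) →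
      (∀ i : Fin p, (i : ℕ) = p - 1 → (K + 1) * a i ≤ n) → (∀ i : Fin p, (i : ℕ) ≤ 1 → a i = 1) →
      ∀ G : SimpleGraph (Fin ((p - 1) * (n - 1) + 1)),
        HasCopy G (KMulti a) ∨ HasCopy Gᶜ (Book k n) := by
  rcases hp.eq_or_lt with rfl | hp3
  · refine ⟨k, fun n hn a _ _ h1 G => ?_⟩
    by_contra! h
    have hempty : ∀ x y, ¬ G.Adj x y := by
      intro x y hxy
      refine h.1 (hasCopy_of_parts (V := ![{x}, {y}]) ?_ ?_)
      · intro i j hij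
        fin_cases i <;> fin_cases j <;> simp_all [Complete, hxy.symm]
      · intro i
        fin_cases i
        · simpa using (h1 0 (by simp)).le
        · simpa using (h1 1 (by simp)).le
    obtain ⟨T, -, hT⟩ := exists_subset_card_eq
      (s := (univ : Finset (Fin ((2 - 1) * (n - 1) + 1)))) (n := k) (by simp; omega)
    have := noBook_of_not_hasCopy h.2 T hT fun x _ y _ => hempty x y
    simp [hempty] at this
    omega
  · obtain ⟨K, hK⟩ := exists_not_noBook_noTarget (k := k) (q := p - 1) (t := t) (by omega)
      (by omega) (by omega)
    refine ⟨K, fun n hn a hat haK h1 G => ?_⟩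
    by_contra! h
    have hT := noTarget_of_not_hasCopy hp3 hat (haK _ rfl) (h1 _ (by simp)) (h1 _ le_rfl) h.1
    exact hK n hn _ G (Fintype.card_fin _) (noBook_of_not_hasCopy h.2)
      (by rwa [Nat.sub_add_cancel (by omega)])

end BookGoodness

/-- Theorem 1.3 (Fox–He–Wigderson): for all `k, p, t ≥ 2` there are `δ > 0` and `n₀` such
that for all `n ≥ n₀` and positive `a₁ ≤ ⋯ ≤ a_{p-1} ≤ t`, `a_{p-1} ≤ a_p ≤ δn` with
`a₁ = a₂ = 1`, `r(K_p(a₁,…,a_p), B_{k,n}) = (p-1)(n-1) + 1`. -/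
theorem ramsey_fhw (k p t : ℕ) (hk : 2 ≤ k) (hp : 2 ≤ p) (ht : 2 ≤ t) :
    ∃ δ : ℝ, 0 < δ ∧ ∃ n₀ : ℕ, ∀ n : ℕ, n₀ ≤ n →
      ∀ a : Fin p → ℕ, (∀ i, 1 ≤ a i) → Monotone a →
        (∀ i : Fin p, (i : ℕ) < p - 1 → a i ≤ t) →
        ((a ⟨p - 1, by omega⟩ : ℕ) : ℝ) ≤ δ * n →
        a ⟨0, by omega⟩ = 1 → a ⟨1, by omega⟩ = 1 →
        ramseyNumber (KMulti a) (Book k n) = (p - 1) * (n - 1) + 1 := by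
  obtain ⟨K, hK⟩ := BookGoodness.exists_forall_hasCopy hk hp ht
  refine ⟨1 / (K + 1), by positivity, K + k, fun n hn a ha _ hat haδ h0 h1 => ?_⟩
  have haK : ∀ i : Fin p, (i : ℕ) = p - 1 → (K + 1) * a i ≤ n := by
    rintro ⟨_, _⟩ rfl
    rw [div_mul_eq_mul_div, one_mul, le_div_iff₀' (by positivity)] at haδ
    exact_mod_cast haδ
  have ha1 : ∀ i : Fin p, (i : ℕ) ≤ 1 → a i = 1 := by
    rintro ⟨_ | _ | i, _⟩ hi
    · exact h0
    · exact h1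
    · simp at hi
  refine le_antisymm (Nat.sInf_le (hK n (by omega) a hat haK ha1)) ?_
  refine le_csInf ⟨_, hK n (by omega) a hat haK ha1⟩ fun N hN => ?_
  by_contra! hlt
  obtain ⟨G, hG₁, hG₂⟩ := BookGoodness.not_ramsey_of_le (p := p) (k := k) (n := n) (N := N)
    (by omega) (by omega) (by omega) ha (by omega)
  exact (hN G).elim hG₁ hG₂
end

section
/- For every p, t ≥ 2 and all integers 1 ≤ a₂ ≤ ⋯ ≤ a_{p−1} ≤ t there exist γ > 0, δ > 0 and n₀ such that for all n ≥ n₀ and every integer a_p with a_{p−1} ≤ a_p ≤ δn the following holds: if G is a K_p(1,a₂,…,a_p)-free graph on n vertices with minimum degree at least (1 − 1/(p−1) − γ)n, then there is a partition V(G) = V₁ ⊔ ⋯ ⊔ V_{p−1} such that for every i ∈ {1,…,p−1}, each vertex of V_i has at most a₂ − 1 neighbors in V_i. -/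
open SimpleGraph

/-- The number of neighbors of `v` inside the set `A`. -/
noncomputable def degIn {V : Type*} (G : SimpleGraph V) (v : V) (A : Set V) : ℕ :=
  {u ∈ A | G.Adj v u}.ncard

section JoinedSets

variable {V : Type*}

/-- The neighbours of `v` in the finite set `S`. -/
noncomputable def nbrIn (G : SimpleGraph V) (v : V) (S : Finset V) : Finset V :=
  by classical exact S.filter fun u => G.Adj v u

/-- The non-neighbours of `v` in the finite set `S`. -/
noncomputable def nonNbrIn (G : SimpleGraph V) (v : V) (S : Finset V) : Finset V :=
  by classical exact S.filter fun u => ¬ G.Adj v u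

/-- The sets `B 0, …, B (s - 1)` are pairwise completely joined in `G`. -/
def JoinedSets (G : SimpleGraph V) (B : ℕ → Finset V) (s : ℕ) : Prop :=
  ∀ i j, i < j → j < s → ∀ x ∈ B i, ∀ y ∈ B j, G.Adj x y

/-- `G` has no completely joined sets of sizes at least `1, s, t, …, t, M` (`r + 1` sets). -/
def Avoids (G : SimpleGraph V) (r s t M : ℕ) : Prop :=
  ∀ B : ℕ → Finset V, JoinedSets G B (r + 1) → (B 0).Nonempty → s ≤ (B 1).card →
    (∀ k, 2 ≤ k → k < r → t ≤ (B k).card) → M ≤ (B r).card → False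

variable {G : SimpleGraph V}

@[simp] lemma mem_nbrIn {v u : V} {S : Finset V} : u ∈ nbrIn G v S ↔ u ∈ S ∧ G.Adj v u := by
  simp [nbrIn]

@[simp] lemma mem_nonNbrIn {v u : V} {S : Finset V} :
    u ∈ nonNbrIn G v S ↔ u ∈ S ∧ ¬ G.Adj v u := by
  simp [nonNbrIn]

lemma nbrIn_subset (v : V) (S : Finset V) : nbrIn G v S ⊆ S := fun _ h => (mem_nbrIn.1 h).1

lemma card_nbrIn_add_card_nonNbrIn (v : V) (S : Finset V) :
    (nbrIn G v S).card + (nonNbrIn G v S).card = S.card := by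
  classical
  unfold nbrIn nonNbrIn
  convert Finset.card_filter_add_card_filter_not (s := S) (fun u => G.Adj v u)

lemma card_nbrIn_le (v : V) (S : Finset V) : (nbrIn G v S).card ≤ S.card :=
  Finset.card_le_card (nbrIn_subset v S)

lemma nonNbrIn_mono (v : V) {S S' : Finset V} (h : S ⊆ S') :
    nonNbrIn G v S ⊆ nonNbrIn G v S' := fun u hu => by
  rw [mem_nonNbrIn] at hu ⊢
  exact ⟨h hu.1, hu.2⟩

lemma JoinedSets.adj {A : ℕ → Finset V} {r i j : ℕ} (hA : JoinedSets G A r) (hi : i < r) (hj : j < r)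
    (hij : i ≠ j) {x y : V} (hx : x ∈ A i) (hy : y ∈ A j) : G.Adj x y := by
  rcases lt_or_gt_of_ne hij with h | h
  · exact hA i j h hj x hx y hy
  · exact (hA j i h hi y hy x hx).symm

lemma hasCopy_of_joined {p : ℕ} (c : Fin p → ℕ) (B : ℕ → Finset V) (hB : JoinedSets G B p)
    (hc : ∀ i : Fin p, c i ≤ (B i).card) : HasCopy G (KMulti c) := by
  let f : (Σ i : Fin p, Fin (c i)) → V := fun x =>
    ((B x.1).equivFin.symm (Fin.castLE (hc x.1) x.2) : V)
  have hmem : ∀ x, f x ∈ B x.1 := fun x => Finset.coe_mem _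
  have hadj : ∀ x y, x.1 ≠ y.1 → G.Adj (f x) (f y) := fun x y h =>
    hB.adj x.1.2 y.1.2 (fun h' => h (Fin.ext h')) (hmem x) (hmem y)
  refine ⟨⟨f, fun {x y} h => hadj x y ?_⟩, ?_⟩
  · simpa [KMulti] using h
  · intro x y hxy
    have hxy : f x = f y := hxy
    by_cases h : x.1 = y.1
    · obtain ⟨i, k⟩ := x
      obtain ⟨j, l⟩ := y
      obtain rfl : i = j := h
      have := (B i).equivFin.symm.injective (Subtype.ext hxy)
      exact congrArg (Sigma.mk i) (Fin.castLE_injective _ this)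
    · exact absurd hxy (hadj x y h).ne

lemma exists_common_nbrIn (A : ℕ → Finset V) {s T m : ℕ} (hA : ∀ i < s, (A i).card = T)
    (hm : 1 ≤ m) (Y : Finset V) (hY : 2 ^ (s * T) * m ≤ Y.card) :
    ∃ Y' ⊆ Y, m ≤ Y'.card ∧ ∃ y₀ ∈ Y', ∀ y ∈ Y', ∀ i < s,
      nbrIn G y (A i) = nbrIn G y₀ (A i) := by
  classical
  set D := (Finset.range s).biUnion A with hD
  have hDc : D.card ≤ s * T := by
    have := Finset.card_biUnion_le_card_mul (Finset.range s) A T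
      (fun i hi => (hA i (Finset.mem_range.1 hi)).le)
    simpa using this
  obtain ⟨S, -, hS⟩ := Finset.exists_le_card_fiber_of_mul_le_card_of_maps_to
    (s := Y) (t := D.powerset) (f := fun y => nbrIn G y D) (n := m)
    (fun y _ => Finset.mem_powerset.2 (nbrIn_subset y D)) ⟨∅, by simp⟩
    (by
      rw [Finset.card_powerset]
      exact le_trans (Nat.mul_le_mul_right _ (Nat.pow_le_pow_right (by norm_num) hDc)) hY)
  refine ⟨_, Finset.filter_subset _ _, hS, ?_⟩
  obtain ⟨y₀, hy₀⟩ := Finset.card_pos.1 (lt_of_lt_of_le hm hS)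
  refine ⟨y₀, hy₀, fun y hy i hi => ?_⟩
  have h : nbrIn G y D = nbrIn G y₀ D :=
    (Finset.mem_filter.1 hy).2.trans (Finset.mem_filter.1 hy₀).2.symm
  ext u
  have hu := Finset.ext_iff.1 h u
  simp only [mem_nbrIn] at hu ⊢
  constructor
  · rintro ⟨h1, h2⟩
    exact ⟨h1, (hu.1 ⟨Finset.mem_biUnion.2 ⟨i, Finset.mem_range.2 hi, h1⟩, h2⟩).2⟩
  · rintro ⟨h1, h2⟩
    exact ⟨h1, (hu.2 ⟨Finset.mem_biUnion.2 ⟨i, Finset.mem_range.2 hi, h1⟩, h2⟩).2⟩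

lemma JoinedSets.exists_shrink {B : ℕ → Finset V} {s T : ℕ} (hB : JoinedSets G B s)
    (hT : ∀ i < s, T ≤ (B i).card) :
    ∃ B' : ℕ → Finset V, JoinedSets G B' s ∧ ∀ i < s, (B' i).card = T := by
  have : ∀ i, ∃ S ⊆ B i, i < s → S.card = T := by
    intro i
    by_cases hi : i < s
    · obtain ⟨S, h1, h2⟩ := Finset.exists_subset_card_eq (hT i hi)
      exact ⟨S, h1, fun _ => h2⟩
    · exact ⟨∅, by simp, fun h => absurd h hi⟩
  choose B' h1 h2 using this
  exact ⟨B', fun i j hij hj x hx y hy => hB i j hij hj x (h1 i hx) y (h1 j hy), h2⟩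

lemma exists_joined_subset (U : ℕ → Finset V) (c : ℕ → ℕ) (t m q : ℕ)
    (hmiss : ∀ i j, i < j → j < q → ∀ x ∈ U i, (nonNbrIn G x (U j)).card ≤ m)
    (hc : ∀ i, i + 1 < q → c i ≤ t) (hU : ∀ i < q, c i + q * t * m ≤ (U i).card) :
    ∃ B : ℕ → Finset V, JoinedSets G B q ∧ ∀ i < q, B i ⊆ U i ∧ (B i).card = c i := by
  classical
  suffices H : ∀ k ≤ q, ∃ B : ℕ → Finset V, JoinedSets G B k ∧
      ∀ i < k, B i ⊆ U i ∧ (B i).card = c i from H q le_rfl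
  intro k
  induction k with
  | zero => exact fun _ => ⟨fun _ => ∅, fun i j _ hj => absurd hj (by omega), by simp⟩
  | succ k ih =>
    intro hk
    obtain ⟨B, hB, hBU⟩ := ih (by omega)
    set D := (Finset.range k).biUnion B with hD
    have hDc : D.card ≤ k * t := by
      have := Finset.card_biUnion_le_card_mul (Finset.range k) B t (fun i hi => by
        have hi := Finset.mem_range.1 hi
        rw [(hBU i hi).2]
        exact hc i (by omega))
      simpa using this
    set R := D.biUnion fun x => nonNbrIn G x (U k) with hR
    have hRc : R.card ≤ k * t * m := by
      refine (Finset.card_biUnion_le_card_mul D _ m fun x hx => ?_).trans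
        (Nat.mul_le_mul_right _ hDc)
      obtain ⟨i, hi, hx⟩ := Finset.mem_biUnion.1 hx
      have hi := Finset.mem_range.1 hi
      exact hmiss i k hi (by omega) x ((hBU i hi).1 hx)
    have h1 : c k ≤ (U k \ R).card := by
      have h2 := Finset.le_card_sdiff R (U k)
      have h3 := hU k (by omega)
      have h4 : k * t * m ≤ q * t * m :=
        Nat.mul_le_mul_right _ (Nat.mul_le_mul_right _ (by omega))
      omega
    obtain ⟨S, hS, hSc⟩ := Finset.exists_subset_card_eq h1
    refine ⟨fun i => if i = k then S else B i, ?_, ?_⟩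
    · intro i j hij hj x hx y hy
      simp only [show i ≠ k by omega, if_false] at hx
      by_cases hjk : j = k
      · subst hjk
        simp only [if_true] at hy
        have hy' := Finset.mem_sdiff.1 (hS hy)
        by_contra hxy
        exact hy'.2 (Finset.mem_biUnion.2 ⟨x, Finset.mem_biUnion.2
          ⟨i, Finset.mem_range.2 hij, hx⟩, mem_nonNbrIn.2 ⟨hy'.1, hxy⟩⟩)
      · simp only [hjk, if_false] at hy
        exact hB i j hij (by omega) x hx y hy
    · intro i hi
      by_cases hik : i = k
      · subst hik
        simpa using ⟨fun u hu => (Finset.mem_sdiff.1 (hS hu)).1, hSc⟩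
      · simpa [hik] using hBU i (by omega)

variable [Fintype V]

lemma le_sum_card_nbrIn (A : ℕ → Finset V) {s T : ℕ} (hA : ∀ i < s, (A i).card = T) {d : ℝ}
    (hd : ∀ v, d ≤ (nbrIn G v Finset.univ).card) :
    s * T * d ≤ ∑ v, ∑ i ∈ Finset.range s, ((nbrIn G v (A i)).card : ℝ) := by
  classical
  have key : ∀ i, ∑ v, ((nbrIn G v (A i)).card : ℝ)
      = ∑ a ∈ A i, ((nbrIn G a Finset.univ).card : ℝ) := by
    intro i
    have h := Finset.sum_card_bipartiteAbove_eq_sum_card_bipartiteBelow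
      (s := (Finset.univ : Finset V)) (t := A i) (r := fun v u => G.Adj v u)
    have h1 : ∀ v, (nbrIn G v (A i)) = Finset.bipartiteAbove (fun v u => G.Adj v u) (A i) v := by
      intro v; ext u; simp [Finset.mem_bipartiteAbove]
    have h2 : ∀ a, (nbrIn G a Finset.univ)
        = Finset.bipartiteBelow (fun v u => G.Adj v u) (Finset.univ : Finset V) a := by
      intro v; ext u; simp [Finset.mem_bipartiteBelow, G.adj_comm]
    simp only [h1, h2]
    exact_mod_cast h
  rw [Finset.sum_comm]
  calc (s : ℝ) * T * d = ∑ i ∈ Finset.range s, (T : ℝ) * d := by simp [mul_assoc]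
    _ ≤ _ := Finset.sum_le_sum fun i hi => by
      rw [key, ← hA i (Finset.mem_range.1 hi), ← nsmul_eq_mul]
      exact Finset.card_nsmul_le_sum _ _ _ fun a _ => hd a

lemma sum_range_le {f : ℕ → ℝ} {s : ℕ} {T : ℝ} (hf : ∀ i < s, f i ≤ T) {i : ℕ} (hi : i < s) :
    ∑ k ∈ Finset.range s, f k ≤ (s - 1) * T + f i := by
  rw [← Finset.add_sum_erase _ _ (Finset.mem_range.2 hi)]
  have := Finset.sum_le_card_nsmul ((Finset.range s).erase i) f T
    (fun k hk => hf k (Finset.mem_range.1 (Finset.mem_of_mem_erase hk)))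
  rw [Finset.card_erase_of_mem (Finset.mem_range.2 hi), Finset.card_range, nsmul_eq_mul,
    Nat.cast_sub (by omega)] at this
  push_cast at this
  linarith

lemma sum_range_le_of_two {f : ℕ → ℝ} {s : ℕ} {T : ℝ} (hf : ∀ i < s, f i ≤ T) {i j : ℕ}
    (hi : i < s) (hj : j < s) (hij : i ≠ j) :
    ∑ k ∈ Finset.range s, f k ≤ (s - 2) * T + f i + f j := by
  have hj' : j ∈ (Finset.range s).erase i :=
    Finset.mem_erase.2 ⟨hij.symm, Finset.mem_range.2 hj⟩
  rw [← Finset.add_sum_erase _ _ (Finset.mem_range.2 hi), ← Finset.add_sum_erase _ _ hj']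
  have := Finset.sum_le_card_nsmul (((Finset.range s).erase i).erase j) f T
    (fun k hk => hf k (Finset.mem_range.1 (Finset.mem_of_mem_erase (Finset.mem_of_mem_erase hk))))
  rw [Finset.card_erase_of_mem hj', Finset.card_erase_of_mem (Finset.mem_range.2 hi),
    Finset.card_range, nsmul_eq_mul, Nat.sub_sub, Nat.cast_sub (by omega)] at this
  push_cast at this
  linarith

end JoinedSets

lemma exists_joined_of_le_degree (r : ℕ) (s : ℕ) (hs : 1 ≤ s) : s ≤ r → ∀ T : ℕ, 1 ≤ T →
    ∃ n₀ : ℕ, ∀ (V : Type) [Fintype V] (G : SimpleGraph V), n₀ ≤ Fintype.card V →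
      (∀ v, (1 - 1 / (r : ℝ) - 1 / (4 * (r : ℝ) ^ 2)) * Fintype.card V
        ≤ (nbrIn G v Finset.univ).card) →
      ∃ A : ℕ → Finset V, JoinedSets G A s ∧ ∀ i < s, (A i).card = T := by
  induction s, hs using Nat.le_induction with
  | base =>
    intro _ T _
    refine ⟨T, fun V _ G hn _ => ?_⟩
    obtain ⟨S, -, hS⟩ := Finset.exists_subset_card_eq (s := (Finset.univ : Finset V)) (n := T)
      (by simpa using hn)
    exact ⟨fun _ => S, fun i j hij hj => absurd hj (by omega), fun _ _ => hS⟩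
  | succ s hs ih =>
    intro hsr T hT
    obtain ⟨n₀, hn₀⟩ := ih (by omega) (4 * r * T) (by
      have : 1 ≤ 4 * r := by omega
      exact Nat.one_le_iff_ne_zero.2 (by positivity))
    refine ⟨max n₀ (2 * r * (2 ^ (s * (4 * r * T)) * T)), fun V _ G hn hdeg => ?_⟩
    classical
    obtain ⟨A, hA, hAc⟩ := hn₀ V G (le_trans (le_max_left _ _) hn) hdeg
    have hn2 := le_trans (le_max_right _ _) hn
    set n := Fintype.card V with hndef
    have hsum := le_sum_card_nbrIn A hAc hdeg
    set Y : Finset V := Finset.univ.filter fun v => ∀ i < s, T ≤ (nbrIn G v (A i)).card with hY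
    have hle : ∀ v, ∀ i < s, ((nbrIn G v (A i)).card : ℝ) ≤ 4 * r * T := fun v i hi => by
      have := card_nbrIn_le (G := G) v (A i)
      rw [hAc i hi] at this
      exact_mod_cast this
    have hpt : ∀ v, ∑ i ∈ Finset.range s, ((nbrIn G v (A i)).card : ℝ)
        ≤ ((s - 1) * (4 * r * T) + T) + if v ∈ Y then (4 * r * T : ℝ) else 0 := by
      intro v
      by_cases hv : v ∈ Y
      · rw [if_pos hv]
        have h1 := sum_range_le (hle v) (i := 0) (by omega)
        have h2 := hle v 0 (by omega)
        have : (0 : ℝ) ≤ T := by positivity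
        linarith
      · rw [if_neg hv]
        simp only [hY, Finset.mem_filter, Finset.mem_univ, true_and, not_forall, not_le] at hv
        obtain ⟨i, hi, hiT⟩ := hv
        have h1 := sum_range_le (hle v) hi
        have h2 : ((nbrIn G v (A i)).card : ℝ) ≤ T := by exact_mod_cast hiT.le
        linarith
    have hsum2 := hsum.trans (Finset.sum_le_sum fun v _ => hpt v)
    rw [Finset.sum_add_distrib, Finset.sum_const, ← Finset.sum_filter, Finset.sum_const,
      Finset.card_univ, Finset.filter_mem_eq_inter, Finset.univ_inter, nsmul_eq_mul,
      nsmul_eq_mul, ← hndef] at hsum2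
    have hr0 : (0 : ℝ) < r := by exact_mod_cast (by omega : 0 < r)
    have hT0 : (0 : ℝ) < T := by exact_mod_cast hT
    have hsr' : (s : ℝ) + 1 ≤ r := by exact_mod_cast hsr
    have hYbig : (n : ℝ) ≤ 2 * r * Y.card := by
      push_cast at hsum2
      have e : (s : ℝ) * (4 * r * T) * ((1 - 1 / r - 1 / (4 * (r : ℝ) ^ 2)) * n)
          = s * T * n * (4 * r - 4 - 1 / r) := by field_simp
      rw [e] at hsum2
      have h4 : (s : ℝ) * (1 / r) ≤ 1 := by
        rw [mul_one_div, div_le_one hr0]; linarith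
      have h5 : (s : ℝ) * (4 * r - 4 - 1 / r) ≥ 4 * s * r - 4 * (r - 1) - 1 := by nlinarith
      have h6 : (T * n : ℝ) * (4 * s * r - 4 * (r - 1) - 1) ≤ T * n * (s * (4 * r - 4 - 1 / r)) :=
        mul_le_mul_of_nonneg_left h5 (by positivity)
      have h7 : (T : ℝ) * (2 * n) ≤ T * (4 * r * Y.card) := by nlinarith
      have := le_of_mul_le_mul_left h7 hT0
      linarith
    have hYn : 2 ^ (s * (4 * r * T)) * T ≤ Y.card := by
      have h1 : n ≤ 2 * r * Y.card := by exact_mod_cast hYbig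
      exact Nat.le_of_mul_le_mul_left (hn2.trans h1) (by omega)
    obtain ⟨Y', hY'Y, hY'c, y₀, hy₀, hcom⟩ := exists_common_nbrIn (G := G) A hAc hT Y hYn
    refine JoinedSets.exists_shrink
      (B := fun i => if i < s then nbrIn G y₀ (A i) else Y') ?_ ?_
    · intro i j hij hj x hx y hy
      simp only [show i < s by omega, if_true] at hx
      by_cases hjs : j < s
      · simp only [hjs, if_true] at hy
        exact hA i j hij hjs x (nbrIn_subset _ _ hx) y (nbrIn_subset _ _ hy)
      · simp only [hjs, if_false] at hy
        rw [← hcom y hy i (by omega)] at hx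
        exact (mem_nbrIn.1 hx).2.symm
    · intro i hi
      by_cases his : i < s
      · simp only [his, if_true]
        have := hY'Y hy₀
        simp only [hY, Finset.mem_filter, Finset.mem_univ, true_and] at this
        exact this i his
      · simpa [his] using hY'c

section Partition

variable {V : Type*} [Fintype V] {G : SimpleGraph V}

lemma exists_near_partition {r s t M T : ℕ} (hr : 2 ≤ r) (ht : 1 ≤ t) (hs : s ≤ t) (hM : 1 ≤ M)
    (hav : Avoids G r s t M) (A : ℕ → Finset V) (hA : JoinedSets G A r)
    (hAc : ∀ i < r, (A i).card = T) (hT : 4 * t ≤ T) {d : ℝ}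
    (hd : ∀ v, d ≤ (nbrIn G v Finset.univ).card) :
    ∃ W : ℕ → Finset V, (∀ i < r, ∀ j < r, i ≠ j → Disjoint (W i) (W j)) ∧
      (∀ i < r, ∀ v ∈ W i, (nbrIn G v (W i)).card < 2 ^ (r * T) * M) ∧
      ∃ X : Finset V, (∀ v ∉ X, ∃ i < r, v ∈ W i) ∧
        (T : ℝ) * X.card ≤ 5 * T * (2 ^ (r * T) * M)
          + 4 * (Fintype.card V * ((r - 1) * T + t) - r * T * d) := by
  classical
  set W : ℕ → Finset V := fun i => Finset.univ.filter fun v =>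
    (nbrIn G v (A i)).card < t ∧ ∀ j < r, j ≠ i → 3 * T ≤ 4 * (nbrIn G v (A j)).card with hW
  have memW : ∀ i v, v ∈ W i ↔ (nbrIn G v (A i)).card < t ∧
      ∀ j < r, j ≠ i → 3 * T ≤ 4 * (nbrIn G v (A j)).card := by
    intro i v; simp [hW]
  set Y : Finset V := Finset.univ.filter fun v => ∀ i < r, t ≤ (nbrIn G v (A i)).card with hY
  have memY : ∀ v, v ∈ Y ↔ ∀ i < r, t ≤ (nbrIn G v (A i)).card := by
    intro v; simp [hY]
  have hYc : Y.card < 2 ^ (r * T) * M := by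
    by_contra hcon
    obtain ⟨Y', hY'Y, hY'c, y₀, hy₀, hcom⟩ :=
      exists_common_nbrIn (G := G) A hAc hM Y (not_lt.1 hcon)
    have hy₀Y := (memY y₀).1 (hY'Y hy₀)
    refine hav (fun i => if i < r then nbrIn G y₀ (A i) else Y') ?_ ?_ ?_ ?_ ?_
    · intro i j hij hj x hx y hy
      simp only [show i < r by omega, if_true] at hx
      by_cases hjs : j < r
      · simp only [hjs, if_true] at hy
        exact hA i j hij hjs x (nbrIn_subset _ _ hx) y (nbrIn_subset _ _ hy)
      · simp only [hjs, if_false] at hy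
        rw [← hcom y hy i (by omega)] at hx
        exact (mem_nbrIn.1 hx).2.symm
    · simp only [show 0 < r by omega, if_true]
      exact Finset.card_pos.1 (lt_of_lt_of_le ht (hy₀Y 0 (by omega)))
    · simp only [show 1 < r by omega, if_true]
      exact hs.trans (hy₀Y 1 (by omega))
    · intro k _ hk
      simp only [hk, if_true]
      exact hy₀Y k hk
    · simpa using hY'c
  refine ⟨W, ?_, ?_, ?_⟩
  · intro i hi j hj hij
    rw [Finset.disjoint_left]
    intro v hvi hvj
    have h1 := ((memW i v).1 hvi).1
    have h2 := ((memW j v).1 hvj).2 i hi hij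
    omega
  · intro i hi v hv
    -- the indices below are relabelled by `e` so that `i` is left out
    by_contra hcon
    obtain ⟨Y', hY'Y, hY'c, y₀, hy₀, hcom⟩ :=
      exists_common_nbrIn (G := G) A hAc hM _ (not_lt.1 hcon)
    have hvW := ((memW i v).1 hv).2
    have hyW := ((memW i y₀).1 (nbrIn_subset _ _ (hY'Y hy₀))).2
    set e : ℕ → ℕ := fun k => if k = i then 0 else k with he
    have her : ∀ k < r, e k < r := by intro k hk; simp only [he]; split_ifs <;> omega
    have hei : ∀ k, k ≠ 0 → e k ≠ i := by intro k hk; simp only [he]; split_ifs <;> omega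
    have heinj : ∀ k l, k ≠ 0 → l ≠ 0 → k ≠ l → e k ≠ e l := by
      intro k l hk hl hkl; simp only [he]; split_ifs <;> omega
    have hcard : ∀ k, k ≠ 0 → k < r → t ≤ (nbrIn G v (nbrIn G y₀ (A (e k)))).card := by
      intro k hk hkr
      have h1 := hvW (e k) (her k hkr) (hei k hk)
      have h2 := hyW (e k) (her k hkr) (hei k hk)
      have h3 := card_nbrIn_add_card_nonNbrIn (G := G) v (nbrIn G y₀ (A (e k)))
      have h4 := card_nbrIn_add_card_nonNbrIn (G := G) v (A (e k))
      have h5 := Finset.card_le_card (nonNbrIn_mono (G := G) v (nbrIn_subset (G := G) y₀ (A (e k))))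
      have h6 := hAc (e k) (her k hkr)
      omega
    refine hav (fun k => if k = 0 then {v} else if k < r then nbrIn G v (nbrIn G y₀ (A (e k)))
      else Y') ?_ ?_ ?_ ?_ ?_
    · intro k l hkl hl x hx y hy
      simp only [show l ≠ 0 by omega, if_false] at hy
      simp only [show k < r by omega, if_true] at hx
      by_cases hk : k = 0
      · simp only [hk, if_true, Finset.mem_singleton] at hx
        subst hx
        split_ifs at hy
        · exact (mem_nbrIn.1 hy).2
        · exact (mem_nbrIn.1 (hY'Y hy)).2
      · simp only [hk, if_false] at hx
        have hx := nbrIn_subset _ _ hx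
        split_ifs at hy with hlr
        · exact hA.adj (her k (by omega)) (her l hlr) (heinj k l hk (by omega) (by omega))
            (nbrIn_subset _ _ hx) (nbrIn_subset _ _ (nbrIn_subset _ _ hy))
        · rw [← hcom y hy _ (her k (by omega))] at hx
          exact (mem_nbrIn.1 hx).2.symm
    · simp
    · simp only [one_ne_zero, if_false, show 1 < r by omega, if_true]
      exact hs.trans (hcard 1 one_ne_zero (by omega))
    · intro k hk hkr
      simp only [show k ≠ 0 by omega, if_false, hkr, if_true]
      exact hcard k (by omega) hkr
    · simpa [show r ≠ 0 by omega] using hY'c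
  · set X' : Finset V := Finset.univ.filter fun v => v ∉ Y ∧ ∀ i < r, v ∉ W i with hX'
    have memX' : ∀ v, v ∈ X' ↔ v ∉ Y ∧ ∀ i < r, v ∉ W i := by intro v; simp [hX']
    refine ⟨X' ∪ Y, ?_, ?_⟩
    · intro v hv
      by_contra hcon
      push Not at hcon
      rw [Finset.mem_union, not_or] at hv
      exact hv.1 ((memX' v).2 ⟨hv.2, hcon⟩)
    have hsum := le_sum_card_nbrIn A hAc hd
    have hle : ∀ v, ∀ i < r, ((nbrIn G v (A i)).card : ℝ) ≤ T := fun v i hi => by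
      have := card_nbrIn_le (G := G) v (A i)
      rw [hAc i hi] at this
      exact_mod_cast this
    have hpt : ∀ v, ∑ i ∈ Finset.range r, ((nbrIn G v (A i)).card : ℝ)
        ≤ (((r - 1) * T + t) + if v ∈ Y then (T : ℝ) else 0)
          + if v ∈ X' then (-(T / 4) : ℝ) else 0 := by
      intro v
      have ht0 : (0 : ℝ) ≤ t := by positivity
      by_cases hv : v ∈ Y
      · rw [if_pos hv, if_neg (fun h => ((memX' v).1 h).1 hv)]
        have h1 := sum_range_le (hle v) (i := 0) (by omega)
        have h2 := hle v 0 (by omega)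
        linarith
      · rw [if_neg hv]
        have hv' := hv
        simp only [memY, not_forall, not_le] at hv'
        obtain ⟨i, hi, hit⟩ := hv'
        have h2 : ((nbrIn G v (A i)).card : ℝ) ≤ t := by exact_mod_cast hit.le
        by_cases hx : v ∈ X'
        · rw [if_pos hx]
          have h3 := ((memX' v).1 hx).2 i hi
          rw [memW] at h3
          push Not at h3
          obtain ⟨j, hj, hji, hjT⟩ := h3 hit
          have h1 := sum_range_le_of_two (hle v) hi hj hji.symm
          have h4 : 4 * ((nbrIn G v (A j)).card : ℝ) ≤ 3 * T := by exact_mod_cast hjT.le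
          linarith
        · rw [if_neg hx]
          have h1 := sum_range_le (hle v) hi
          linarith
    have hsum2 := hsum.trans (Finset.sum_le_sum fun v _ => hpt v)
    rw [Finset.sum_add_distrib, Finset.sum_add_distrib, Finset.sum_const, ← Finset.sum_filter,
      ← Finset.sum_filter, Finset.sum_const, Finset.sum_const, Finset.card_univ,
      Finset.filter_mem_eq_inter, Finset.univ_inter, Finset.filter_mem_eq_inter,
      Finset.univ_inter, nsmul_eq_mul, nsmul_eq_mul, nsmul_eq_mul] at hsum2
    have hXc : ((X' ∪ Y).card : ℝ) ≤ X'.card + Y.card := by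
      exact_mod_cast Finset.card_union_le X' Y
    have hYc' : (Y.card : ℝ) ≤ 2 ^ (r * T) * M := by exact_mod_cast hYc.le
    have hT0 : (0 : ℝ) ≤ T := by positivity
    have h1 := mul_le_mul_of_nonneg_left hXc hT0
    have h2 := mul_le_mul_of_nonneg_left hYc' hT0
    nlinarith

lemma exists_coloring_of_near_partition {r s t M : ℕ} (hr : 2 ≤ r) (ht : 1 ≤ t) (hst : s ≤ t)
    (hav : Avoids G r s t M) {ξ : ℝ} (hξ : 0 < ξ) (hξs : 100 * (r : ℝ) ^ 3 * t ^ 2 * ξ ≤ 1)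
    (hd : ∀ v, (1 - 1 / (r : ℝ) - ξ) * Fintype.card V ≤ (nbrIn G v Finset.univ).card)
    (W : ℕ → Finset V) (hdis : ∀ i < r, ∀ j < r, i ≠ j → Disjoint (W i) (W j))
    (hsp : ∀ i < r, ∀ v ∈ W i, ((nbrIn G v (W i)).card : ℝ) ≤ ξ * Fintype.card V)
    (X : Finset V) (hX : ∀ v ∉ X, ∃ i < r, v ∈ W i) (hXc : (X.card : ℝ) ≤ ξ * Fintype.card V)
    (hM : (M : ℝ) ≤ ξ * Fintype.card V) (htn : (t : ℝ) ≤ ξ * Fintype.card V) :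
    ∃ c : V → ℕ, (∀ v, c v < r) ∧
      ∀ v, ∀ S : Finset V, (∀ u ∈ S, c u = c v ∧ G.Adj v u) → S.card < s := by
  classical
  set n := Fintype.card V with hn
  have hr2 : (2 : ℝ) ≤ r := by exact_mod_cast hr
  have hr0 : (0 : ℝ) < r := by linarith
  have ht1 : (1 : ℝ) ≤ t := by exact_mod_cast ht
  have hn0 : (0 : ℝ) ≤ n := by positivity
  have hξn : (0 : ℝ) ≤ ξ * n := by positivity
  have hnon : ∀ v, ((nonNbrIn G v Finset.univ).card : ℝ) ≤ (1 / r + ξ) * n := by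
    intro v
    have h1 : ((nbrIn G v Finset.univ).card : ℝ) + (nonNbrIn G v Finset.univ).card = n := by
      exact_mod_cast card_nbrIn_add_card_nonNbrIn (G := G) v Finset.univ
    have h2 := hd v
    linarith
  have hsplit : ∀ v i, ((nbrIn G v (W i)).card : ℝ) + (nonNbrIn G v (W i)).card = (W i).card :=
    fun v i => by exact_mod_cast card_nbrIn_add_card_nonNbrIn (G := G) v (W i)
  have hupper : ∀ i < r, ((W i).card : ℝ) ≤ (1 / r + 2 * ξ) * n := by
    intro i hi
    rcases (W i).eq_empty_or_nonempty with h | ⟨v, hv⟩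
    · rw [h]
      simp only [Finset.card_empty, Nat.cast_zero]
      positivity
    · have h1 := hsp i hi v hv
      have h2 : ((nonNbrIn G v (W i)).card : ℝ) ≤ (nonNbrIn G v Finset.univ).card := by
        exact_mod_cast Finset.card_le_card (nonNbrIn_mono v (Finset.subset_univ _))
      have h3 := hnon v
      have h4 := hsplit v i
      linarith
  have hlower : ∀ i < r, (1 / r - 3 * r * ξ) * n ≤ ((W i).card : ℝ) := by
    intro i hi
    have h1 : (n : ℝ) ≤ X.card + ∑ k ∈ Finset.range r, ((W k).card : ℝ) := by
      have h2 : (Finset.univ : Finset V) ⊆ X ∪ (Finset.range r).biUnion W := by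
        intro v _
        by_cases hv : v ∈ X
        · exact Finset.mem_union_left _ hv
        · obtain ⟨i, hi, hvi⟩ := hX v hv
          exact Finset.mem_union_right _ (Finset.mem_biUnion.2 ⟨i, Finset.mem_range.2 hi, hvi⟩)
      have h3 := (Finset.card_le_card h2).trans (Finset.card_union_le _ _)
      have h4 := h3.trans (Nat.add_le_add_left (Finset.card_biUnion_le) _)
      exact_mod_cast h4
    have h2 := sum_range_le (f := fun k => ((W k).card : ℝ)) hupper hi
    have h3 : ((r : ℝ) - 1) * ((1 / r + 2 * ξ) * n)
        = n - 1 / r * n + 2 * r * (ξ * n) - 2 * (ξ * n) := by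
      field_simp
      ring
    have h4 : 0 ≤ r * (ξ * n) := by positivity
    simp only [h3] at h2
    linarith
  have hmiss : ∀ η : ℝ, ∀ v, ∀ i < r, ∀ j < r, i ≠ j → ((nbrIn G v (W i)).card : ℝ) ≤ η * n →
      ((nonNbrIn G v (W j)).card : ℝ) ≤ (ξ + η + 3 * r * ξ) * n := by
    intro η v i hi j hj hij hη
    have h1 : ((nonNbrIn G v (W i)).card : ℝ) + (nonNbrIn G v (W j)).card
        ≤ (nonNbrIn G v Finset.univ).card := by
      have hd' : Disjoint (nonNbrIn G v (W i)) (nonNbrIn G v (W j)) := by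
        rw [Finset.disjoint_left]
        intro u hu hu'
        exact Finset.disjoint_left.1 (hdis i hi j hj hij) (mem_nonNbrIn.1 hu).1
          (mem_nonNbrIn.1 hu').1
      have := Finset.card_le_card (Finset.union_subset
        (nonNbrIn_mono (G := G) v (Finset.subset_univ (W i)))
        (nonNbrIn_mono (G := G) v (Finset.subset_univ (W j))))
      rw [Finset.card_union_of_disjoint hd'] at this
      exact_mod_cast this
    have h2 := hnon v
    have h3 := hsplit v i
    have h4 := hlower i hi
    linarith
  set m₁ := ⌊4 * r * ξ * n⌋₊ with hm₁
  have hm₁le : (m₁ : ℝ) ≤ 4 * r * ξ * n := Nat.floor_le (by positivity)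
  have hmissW : ∀ i < r, ∀ j < r, i ≠ j → ∀ v ∈ W i, (nonNbrIn G v (W j)).card ≤ m₁ := by
    intro i hi j hj hij v hv
    apply Nat.le_floor
    refine (hmiss ξ v i hi j hj hij (hsp i hi v hv)).trans ?_
    nlinarith
  have hclass : ∀ v, ∃ i < r, ((nbrIn G v (W i)).card : ℝ) ≤ (5 * r ^ 2 * t * ξ) * n := by
    intro v
    by_contra hcon
    push Not at hcon
    obtain ⟨B, hB, hBU⟩ := exists_joined_subset (G := G) (fun i => nbrIn G v (W i))
      (fun i => if i + 1 < r then t else M) t m₁ r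
      (fun i j hij hj x hx => (Finset.card_le_card (nonNbrIn_mono x (nbrIn_subset _ _))).trans
        (hmissW i (by omega) j hj (by omega) x (nbrIn_subset _ _ hx)))
      (fun i hi => by simp [hi])
      (fun i hi => by
        have h1 := hcon i hi
        have h2 : (((if i + 1 < r then t else M : ℕ)) : ℝ) ≤ ξ * n := by split_ifs <;> assumption
        have h3 : (r * t * m₁ : ℝ) ≤ r * t * (4 * r * ξ * n) :=
          mul_le_mul_of_nonneg_left hm₁le (by positivity)
        have h4 : ξ * n ≤ r ^ 2 * t * (ξ * n) := by
          refine le_mul_of_one_le_left hξn ?_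
          nlinarith
        have h5 : (((if i + 1 < r then t else M) + r * t * m₁ : ℕ) : ℝ)
            ≤ (nbrIn G v (W i)).card := by
          push_cast at h2 ⊢
          nlinarith
        exact_mod_cast h5)
    refine hav (fun k => if k = 0 then {v} else B (k - 1)) ?_ ?_ ?_ ?_ ?_
    · intro k l hkl hl x hx y hy
      simp only [show l ≠ 0 by omega, if_false] at hy
      by_cases hk : k = 0
      · simp only [hk, if_true, Finset.mem_singleton] at hx
        subst hx
        exact (mem_nbrIn.1 ((hBU (l - 1) (by omega)).1 hy)).2
      · simp only [hk, if_false] at hx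
        exact hB (k - 1) (l - 1) (by omega) (by omega) x hx y hy
    · simp
    · have := (hBU 0 (by omega)).2
      simp only [show 0 + 1 < r by omega, if_true] at this
      simpa [this] using hst
    · intro k hk hkr
      have := (hBU (k - 1) (by omega)).2
      simp only [show k - 1 + 1 < r by omega, if_true] at this
      simp [show k ≠ 0 by omega, this]
    · have := (hBU (r - 1) (by omega)).2
      simp only [show ¬ (r - 1 + 1 < r) by omega, if_false] at this
      simp [show r ≠ 0 by omega, this]
  choose c hcr hc using hclass
  refine ⟨c, hcr, fun v S₀ hS₀ => ?_⟩
  by_contra hcon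
  obtain ⟨S, hSS₀, hSc⟩ := Finset.exists_subset_card_eq (not_lt.1 hcon)
  have hS : ∀ u ∈ S, c u = c v ∧ G.Adj v u := fun u hu => hS₀ u (hSS₀ hu)
  set i := c v with hi
  have hir : i < r := hcr v
  set m₂ := ⌊8 * r ^ 2 * t * ξ * n⌋₊ with hm₂
  have hm₂le : (m₂ : ℝ) ≤ 8 * r ^ 2 * t * ξ * n := Nat.floor_le (by positivity)
  have hmissS : ∀ x ∈ insert v S, ∀ j < r, j ≠ i → (nonNbrIn G x (W j)).card ≤ m₂ := by
    intro x hx j hj hji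
    have hcx : c x = i := by
      rcases Finset.mem_insert.1 hx with h | h
      · rw [h]
      · exact (hS x h).1
    have h1 := hc x
    rw [hcx] at h1
    apply Nat.le_floor
    refine (hmiss _ x i hir j hj hji.symm h1).trans ?_
    have h2 : (1 : ℝ) + 3 * r ≤ 3 * r ^ 2 * t := by
      have : (r : ℝ) ^ 2 ≤ r ^ 2 * t := le_mul_of_one_le_right (by positivity) ht1
      nlinarith
    have h3 := mul_le_mul_of_nonneg_right h2 hξn
    nlinarith
  -- the indices `1, …, r - 1` are relabelled so that `i` is left out
  set e : ℕ → ℕ := fun k => if k + 1 = i then 0 else k + 1 with he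
  have her : ∀ k, k < r - 1 → e k < r := by intro k hk; simp only [he]; split_ifs <;> omega
  have hei : ∀ k, e k ≠ i := by intro k; simp only [he]; split_ifs <;> omega
  have heinj : ∀ k l, k ≠ l → e k ≠ e l := by
    intro k l hkl; simp only [he]; split_ifs <;> omega
  set R : ℕ → Finset V := fun k => (insert v S).biUnion fun x => nonNbrIn G x (W (e k)) with hR
  have hRc : ∀ k, k < r - 1 → (R k).card ≤ 2 * t * m₂ := by
    intro k hk
    refine (Finset.card_biUnion_le_card_mul _ _ m₂ fun x hx =>
      hmissS x hx (e k) (her k hk) (hei k)).trans (Nat.mul_le_mul_right _ ?_)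
    have := Finset.card_insert_le v S
    omega
  have hadj : ∀ k, ∀ x ∈ insert v S, ∀ y ∈ W (e k) \ R k, G.Adj x y := by
    intro k x hx y hy
    rw [Finset.mem_sdiff] at hy
    by_contra hxy
    exact hy.2 (Finset.mem_biUnion.2 ⟨x, hx, mem_nonNbrIn.2 ⟨hy.1, hxy⟩⟩)
  obtain ⟨B, hB, hBU⟩ := exists_joined_subset (G := G) (fun k => W (e k) \ R k)
    (fun k => if k + 1 < r - 1 then t else M) t m₁ (r - 1)
    (fun k l hkl hl x hx => (Finset.card_le_card (nonNbrIn_mono x Finset.sdiff_subset)).trans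
      (hmissW _ (her k (by omega)) _ (her l hl) (heinj k l (by omega)) x
        (Finset.mem_sdiff.1 hx).1))
    (fun k hk => by simp [hk])
    (fun k hk => by
      have h1 := hlower (e k) (her k hk)
      have h2 : (((if k + 1 < r - 1 then t else M : ℕ)) : ℝ) ≤ ξ * n := by
        split_ifs <;> assumption
      have h3 : (r * t * m₁ : ℝ) ≤ r * t * (4 * r * ξ * n) :=
        mul_le_mul_of_nonneg_left hm₁le (by positivity)
      have h3' : (((r - 1) * t * m₁ : ℕ) : ℝ) ≤ r * t * m₁ := by
        exact_mod_cast Nat.mul_le_mul_right _ (Nat.mul_le_mul_right _ (Nat.sub_le r 1))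
      have h4 : ((R k).card : ℝ) ≤ 2 * t * m₂ := by exact_mod_cast hRc k hk
      have h5 : (2 * t * m₂ : ℝ) ≤ 2 * t * (8 * r ^ 2 * t * ξ * n) :=
        mul_le_mul_of_nonneg_left hm₂le (by positivity)
      have h6 : ((W (e k)).card : ℝ) ≤ (W (e k) \ R k).card + (R k).card := by
        have := Finset.le_card_sdiff (R k) (W (e k))
        exact_mod_cast (by omega : (W (e k)).card ≤ (W (e k) \ R k).card + (R k).card)
      have h7 : 100 * r ^ 2 * t ^ 2 * ξ ≤ 1 / (r : ℝ) := by
        rw [le_div_iff₀ hr0]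
        linarith
      have h8 := mul_le_mul_of_nonneg_right h7 hn0
      have hb : (r : ℝ) ≤ r ^ 2 * t ^ 2 :=
        (le_self_pow₀ (by linarith) two_ne_zero).trans
          (le_mul_of_one_le_right (by positivity) (one_le_pow₀ ht1))
      have ha : (1 : ℝ) ≤ r ^ 2 * t ^ 2 := by linarith
      have hc' : (r : ℝ) ^ 2 * t ≤ r ^ 2 * t ^ 2 :=
        mul_le_mul_of_nonneg_left (le_self_pow₀ ht1 two_ne_zero) (by positivity)
      have ha' := mul_le_mul_of_nonneg_right ha hξn
      have hb' := mul_le_mul_of_nonneg_right hb hξn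
      have hc'' := mul_le_mul_of_nonneg_right hc' hξn
      have h9 : (((if k + 1 < r - 1 then t else M) + (r - 1) * t * m₁ : ℕ) : ℝ)
          ≤ (W (e k) \ R k).card := by
        rw [Nat.cast_add]
        linarith
      exact_mod_cast h9)
  refine hav (fun k => if k = 0 then {v} else if k = 1 then S else B (k - 2)) ?_ ?_ ?_ ?_ ?_
  · intro k l hkl hl x hx y hy
    simp only [show l ≠ 0 by omega, if_false] at hy
    by_cases hk : k = 0
    · simp only [hk, if_true, Finset.mem_singleton] at hx
      subst hx
      split_ifs at hy with hl1
      · exact (hS y hy).2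
      · exact hadj _ x (Finset.mem_insert_self _ _) y ((hBU (l - 2) (by omega)).1 hy)
    · simp only [hk, if_false, show l ≠ 1 by omega] at hx hy
      split_ifs at hx with hk1
      · exact hadj _ x (Finset.mem_insert_of_mem hx) y ((hBU (l - 2) (by omega)).1 hy)
      · exact hB (k - 2) (l - 2) (by omega) (by omega) x hx y hy
  · simp
  · simp [hSc]
  · intro k hk hkr
    have := (hBU (k - 2) (by omega)).2
    simp only [show k - 2 + 1 < r - 1 by omega, if_true] at this
    simp [show k ≠ 0 by omega, show k ≠ 1 by omega, this]
  · have := (hBU (r - 2) (by omega)).2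
    simp only [show ¬ (r - 2 + 1 < r - 1) by omega, if_false] at this
    simp [show r ≠ 0 by omega, show r ≠ 1 by omega, this]

end Partition

lemma exists_coloring_of_avoids (r t : ℕ) (hr : 2 ≤ r) (ht : 1 ≤ t) :
    ∃ γ : ℝ, 0 < γ ∧ ∃ δ : ℝ, 0 < δ ∧ ∃ n₀ : ℕ, ∀ (V : Type) [Fintype V] (G : SimpleGraph V),
      n₀ ≤ Fintype.card V → ∀ s M : ℕ, s ≤ t → 1 ≤ M → (M : ℝ) ≤ δ * Fintype.card V →
      Avoids G r s t M →
      (∀ v, (1 - 1 / (r : ℝ) - γ) * Fintype.card V ≤ (nbrIn G v Finset.univ).card) →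
      ∃ c : V → ℕ, (∀ v, c v < r) ∧
        ∀ v, ∀ S : Finset V, (∀ u ∈ S, c u = c v ∧ G.Adj v u) → S.card < s := by
  have hr2 : (2 : ℝ) ≤ r := by exact_mod_cast hr
  have hr0 : (0 : ℝ) < r := by linarith
  have ht1 : (1 : ℝ) ≤ t := by exact_mod_cast ht
  set ξ : ℝ := 1 / (100 * (r : ℝ) ^ 3 * t ^ 2) with hξdef
  have hξ : 0 < ξ := by positivity
  have hξs : 100 * (r : ℝ) ^ 3 * t ^ 2 * ξ = 1 := by rw [hξdef]; field_simp
  have hξ1 : ξ ≤ 1 := by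
    rw [hξdef, div_le_one (by positivity)]
    have : (1 : ℝ) ≤ r ^ 3 := one_le_pow₀ (by linarith)
    have : (1 : ℝ) ≤ t ^ 2 := one_le_pow₀ ht1
    nlinarith
  have hξr : ξ * r ≤ 1 := by
    have h1 : (1 : ℝ) ≤ r ^ 2 := one_le_pow₀ (by linarith)
    have h2 : (1 : ℝ) ≤ t ^ 2 := one_le_pow₀ ht1
    have h3 : (1 : ℝ) ≤ r ^ 2 * t ^ 2 := one_le_mul_of_one_le_of_one_le h1 h2
    have h4 := mul_le_mul_of_nonneg_left h3 (by positivity : (0 : ℝ) ≤ ξ * r)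
    nlinarith
  set T := ⌈16 * t / ξ⌉₊ with hT
  have hTle : 16 * t / ξ ≤ (T : ℝ) := Nat.le_ceil _
  have hTξ : 16 * t ≤ ξ * (T : ℝ) := by rwa [div_le_iff₀' hξ] at hTle
  have hT4 : 4 * t ≤ T := by
    have h1 : ξ * (T : ℝ) ≤ T := mul_le_of_le_one_left (by positivity) hξ1
    have : (4 * t : ℝ) ≤ T := by linarith
    exact_mod_cast this
  have hT0 : (0 : ℝ) < T := by
    exact_mod_cast (by omega : 0 < T)
  obtain ⟨n₀, hn₀⟩ := exists_joined_of_le_degree r r (by omega) le_rfl T (by omega)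
  refine ⟨ξ / (16 * r), by positivity, ξ / (20 * 2 ^ (r * T)), by positivity,
    max n₀ ⌈t / ξ⌉₊, fun V _ G hn s M hs hM hMn hav hdeg => ?_⟩
  have hn1 : n₀ ≤ Fintype.card V := le_trans (le_max_left _ _) hn
  have hn2 : (t : ℝ) ≤ ξ * Fintype.card V := by
    have h1 : t / ξ ≤ (Fintype.card V : ℝ) :=
      (Nat.le_ceil _).trans (by exact_mod_cast le_trans (le_max_right _ _) hn)
    rwa [div_le_iff₀' hξ] at h1
  have hnn : (0 : ℝ) ≤ Fintype.card V := by positivity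
  have hξn : 0 ≤ ξ * Fintype.card V := by positivity
  have hpow : (1 : ℝ) ≤ 2 ^ (r * T) := one_le_pow₀ (by norm_num)
  have hMD : (2 : ℝ) ^ (r * T) * M ≤ ξ / 20 * Fintype.card V := by
    calc (2 : ℝ) ^ (r * T) * M ≤ 2 ^ (r * T) * (ξ / (20 * 2 ^ (r * T)) * Fintype.card V) :=
          mul_le_mul_of_nonneg_left hMn (by positivity)
      _ = _ := by field_simp
  have hMM : (M : ℝ) ≤ 2 ^ (r * T) * M := le_mul_of_one_le_left (by positivity) hpow
  obtain ⟨A, hA, hAc⟩ := hn₀ V G hn1 (fun v => le_trans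
    (mul_le_mul_of_nonneg_right (by
      have : ξ / (16 * r) ≤ 1 / (4 * (r : ℝ) ^ 2) := by
        rw [div_le_div_iff₀ (by positivity) (by positivity)]
        nlinarith
      linarith) hnn) (hdeg v))
  obtain ⟨W, hdis, hsp, X, hX, hXc⟩ := exists_near_partition hr ht hs hM hav A hA hAc hT4 hdeg
  refine exists_coloring_of_near_partition hr ht hs hav hξ hξs.le (fun v => le_trans
    (mul_le_mul_of_nonneg_right (by
      have : ξ / (16 * r) ≤ ξ := div_le_self hξ.le (by linarith)
      linarith) hnn) (hdeg v)) W hdis (fun i hi v hv => ?_) X hX ?_ (by linarith) hn2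
  · have : ((nbrIn G v (W i)).card : ℝ) ≤ 2 ^ (r * T) * M := by exact_mod_cast (hsp i hi v hv).le
    linarith
  · have e : (r : ℝ) * T * ((1 - 1 / r - ξ / (16 * r)) * Fintype.card V)
        = Fintype.card V * ((r - 1) * T) - T * (ξ * Fintype.card V) / 16 := by
      field_simp
    rw [e] at hXc
    have h1 := mul_le_mul_of_nonneg_left hMD hT0.le
    have h2 := mul_le_mul_of_nonneg_right hTξ hnn
    refine le_of_mul_le_mul_left ?_ hT0
    nlinarith

/-- Lemma 3.4: for `p, t ≥ 2` and fixed sizes `1 = a₁ ≤ a₂ ≤ ⋯ ≤ a_{p-1} ≤ t`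
(given as `a : Fin (p-1) → ℕ`) there are `γ, δ > 0` and `n₀` such that for all `n ≥ n₀`
and `a_{p-1} ≤ a_p ≤ δn`, every `K_p(1,a₂,…,a_p)`-free graph on `n` vertices with minimum
degree at least `(1 - 1/(p-1) - γ)n` admits a partition `V(G) = V₁ ⊔ ⋯ ⊔ V_{p-1}` where
each vertex of `V_i` has at most `a₂ - 1` neighbors in `V_i`. -/
theorem aes_stability (p t : ℕ) (hp : 2 ≤ p) (ht : 2 ≤ t)
    (a : Fin (p - 1) → ℕ) (ha1 : a ⟨0, by omega⟩ = 1) (hpos : ∀ i, 1 ≤ a i)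
    (hmono : Monotone a) (hle : ∀ i, a i ≤ t) :
    ∃ γ : ℝ, 0 < γ ∧ ∃ δ : ℝ, 0 < δ ∧ ∃ n₀ : ℕ, ∀ n : ℕ, n₀ ≤ n →
      ∀ ap : ℕ, a ⟨p - 2, by omega⟩ ≤ ap → (ap : ℝ) ≤ δ * n →
      ∀ G : SimpleGraph (Fin n),
        ¬ HasCopy G (KMulti (fun i : Fin p =>
            if h : (i : ℕ) < p - 1 then a ⟨(i : ℕ), h⟩ else ap)) →
        (∀ v, (1 - 1 / ((p : ℝ) - 1) - γ) * n ≤ ((G.neighborSet v).ncard : ℝ)) →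
        ∃ P : Fin (p - 1) → Set (Fin n),
          (Pairwise fun i j => Disjoint (P i) (P j)) ∧ (⋃ i, P i) = Set.univ ∧
          ∀ i, ∀ v ∈ P i,
            degIn G v (P i) ≤ (if h : (1 : ℕ) < p - 1 then a ⟨1, h⟩ else ap) - 1 := by
  obtain ⟨r, rfl⟩ : ∃ r, p = r + 1 := ⟨p - 1, by omega⟩
  have hcast : (((r + 1 : ℕ) : ℝ) - 1) = r := by push_cast; ring
  have hncard : ∀ {n : ℕ} (G : SimpleGraph (Fin n)) (v : Fin n),
      (G.neighborSet v).ncard = (nbrIn G v Finset.univ).card := by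
    intro n G v
    rw [← Set.ncard_coe_finset]
    congr 1
    ext u
    simp
  rcases Nat.lt_or_ge r 2 with hr | hr
  · obtain rfl : r = 1 := by omega
    refine ⟨1, one_pos, 1, one_pos, 0, fun n _ ap hap _ G hfree _ => ⟨fun _ => Set.univ, ?_, ?_, ?_⟩⟩
    · intro i j hij
      exact absurd (Subsingleton.elim (α := Fin 1) i j) hij
    · exact Set.iUnion_const _
    · intro i v _
      have hap1 : 1 ≤ ap := (hpos _).trans hap
      by_contra hcon
      apply hfree
      refine hasCopy_of_joined _ (fun k => if k = 0 then {v} else nbrIn G v Finset.univ) ?_ ?_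
      · intro k l hkl hl x hx y hy
        obtain rfl : k = 0 := by omega
        obtain rfl : l = 1 := by omega
        simp only [if_true, Finset.mem_singleton] at hx
        subst hx
        simpa using hy
      · have hdeg : degIn G v Set.univ = (nbrIn G v Finset.univ).card := by
          rw [← hncard]
          unfold degIn
          congr 1
          ext u
          simp
        rw [hdeg] at hcon
        intro k
        fin_cases k
        · simpa using ha1.le
        · simp at hcon ⊢
          omega
  · obtain ⟨γ, hγ, δ, hδ, n₀, H⟩ := exists_coloring_of_avoids r t hr (by omega)
    refine ⟨γ, hγ, δ, hδ, n₀, fun n hn ap hap hapn G hfree hdeg => ?_⟩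
    have h1r : 1 < r + 1 - 1 := by omega
    have hav : Avoids G r (a ⟨1, h1r⟩) t ap := by
      intro B hB h0 h1 hk hr'
      refine hfree (hasCopy_of_joined _ B hB fun i => ?_)
      obtain ⟨i, hi⟩ := i
      dsimp only
      split_ifs with h
      · rcases Nat.lt_or_ge i 2 with h2 | h2
        · interval_cases i
          · rw [ha1]
            exact Finset.card_pos.2 h0
          · exact h1
        · exact (hle _).trans (hk i h2 (by omega))
      · obtain rfl : i = r := by omega
        exact hr'
    obtain ⟨c, hcr, hc⟩ := H (Fin n) G (by simpa using hn) _ ap (hle ⟨1, h1r⟩)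
      ((hpos _).trans hap) (by simpa using hapn) hav (fun v => by
        have := hdeg v
        rw [hncard, hcast] at this
        simpa using this)
    refine ⟨fun i => {v | c v = i}, ?_, ?_, ?_⟩
    · intro i j hij
      rw [Set.disjoint_left]
      intro v hv hv'
      exact hij (Fin.ext (Eq.trans (Eq.symm hv) hv'))
    · ext v
      simp only [Set.mem_iUnion, Set.mem_ofPred_eq, Set.mem_univ, iff_true]
      exact ⟨⟨c v, hcr v⟩, rfl⟩
    · intro i v hv
      rw [dif_pos h1r]
      have hfin : {u ∈ {w | c w = i} | G.Adj v u}.Finite := Set.toFinite _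
      have := hc v hfin.toFinset (fun u hu => by
        have hu := hfin.mem_toFinset.1 hu
        exact ⟨hu.1.trans (Eq.symm hv), hu.2⟩)
      unfold degIn
      rw [Set.ncard_eq_toFinset_card _ hfin]
      exact Nat.le_sub_one_of_lt this
end

section
/- For all integers k, p, t ≥ 2 and every α > 0 there exists μ₀ > 0 such that for every 0 < μ ≤ μ₀ there exist δ > 0 and n₀ with the following property for all n ≥ n₀: for all positive integers a₁ ≤ a₂ ≤ ⋯ ≤ a_{p−1} ≤ t and a_{p−1} ≤ a_p ≤ δn, if G is a graph on N ≥ (p − 1 − μ)n vertices such that G is K_p(a₁,…,a_p)-free and the complement of G contains no B_{k,n}, then all but at most αN vertices of G have degree at least (1 − 1/(p−1) − α)N. -/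
open SimpleGraph

/-- `k`-subsets of a `j`-element subset make up a proportion of at least about `(j / M) ^ k` of the
`k`-subsets of an `M`-element set. -/
lemma choose_mul_pow_le (k : ℕ) {j M : ℕ} (hj : k ≤ j) (hM : 0 < M) :
    (((j : ℝ) - k) / M) ^ k * (M.choose k : ℝ) ≤ (j.choose k : ℝ) := by
  have hjk : (k : ℝ) ≤ j := by exact_mod_cast hj
  have hM' : (0 : ℝ) < M := by exact_mod_cast hM
  have h1 := Nat.pow_le_choose (α := ℝ) k j
  have h2 := Nat.choose_le_pow_div (α := ℝ) k M
  have hcast : ((j + 1 - k : ℕ) : ℝ) = (j : ℝ) + 1 - k := by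
    rw [Nat.cast_sub (by omega)]
    push_cast
    ring
  rw [hcast] at h1
  calc (((j : ℝ) - k) / M) ^ k * (M.choose k : ℝ)
      ≤ (((j : ℝ) - k) / M) ^ k * ((M : ℝ) ^ k / k.factorial) := by
        have : 0 ≤ ((j : ℝ) - k) / M := div_nonneg (by linarith) hM'.le
        gcongr
    _ = ((j : ℝ) - k) ^ k / k.factorial := by
        rw [div_pow]
        field_simp
    _ ≤ ((j : ℝ) + 1 - k) ^ k / k.factorial := by
        have : 0 ≤ (j : ℝ) - k := by linarith
        gcongr
        linarith
    _ ≤ _ := h1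

/-- Removing boundedly many elements from a large set hardly changes its number of
`k`-subsets. -/
lemma exists_choose_le_mul_choose_sub (k m : ℕ) {ε : ℝ} (hε : 0 < ε) :
    ∃ M₀ : ℕ, ∀ M : ℕ, M₀ ≤ M →
      (M.choose k : ℝ) ≤ (1 + ε) * ((M - m).choose k : ℝ) := by
  obtain ⟨A, hA⟩ := exists_nat_gt ((k : ℝ) * (m + k) * (1 + ε) / ε)
  refine ⟨A + m + k + 1, fun M hM => ?_⟩
  have hM0 : (0 : ℝ) < M := by exact_mod_cast (by omega : 0 < M)
  have hMA : (A : ℝ) ≤ M := by exact_mod_cast (by omega : A ≤ M)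
  have hMmk : ((m : ℝ) + k) ≤ M := by exact_mod_cast (by omega : m + k ≤ M)
  have h := choose_mul_pow_le k (j := M - m) (M := M) (by omega) (by omega)
  rw [Nat.cast_sub (by omega)] at h
  have hb := one_add_mul_le_pow (a := -(((m : ℝ) + k) / M))
    (by
      have : ((m : ℝ) + k) / M ≤ 1 := (div_le_one hM0).2 hMmk
      linarith) k
  have heq : ((M : ℝ) - m - k) / M = 1 + -(((m : ℝ) + k) / M) := by
    field_simp
    ring
  rw [heq] at h
  have hprop : 1 ≤ (1 + ε) * (1 + (k : ℝ) * -(((m : ℝ) + k) / M)) := by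
    have h3 : (k : ℝ) * (m + k) * (1 + ε) ≤ ε * M := by
      rw [div_lt_iff₀ hε] at hA
      nlinarith
    have h4 : (1 + ε) * ((k : ℝ) * (((m : ℝ) + k) / M)) ≤ ε := by
      rw [show (1 + ε) * ((k : ℝ) * (((m : ℝ) + k) / M)) = (k : ℝ) * (m + k) * (1 + ε) / M by
        ring, div_le_iff₀ hM0]
      exact h3
    linarith
  have hC : (0 : ℝ) ≤ M.choose k := by positivity
  calc (M.choose k : ℝ)
      ≤ (1 + ε) * (1 + (k : ℝ) * -(((m : ℝ) + k) / M)) * (M.choose k : ℝ) :=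
        le_mul_of_one_le_left hC hprop
    _ ≤ (1 + ε) * (1 + -(((m : ℝ) + k) / M)) ^ k * (M.choose k : ℝ) := by gcongr
    _ = (1 + ε) * ((1 + -(((m : ℝ) + k) / M)) ^ k * (M.choose k : ℝ)) := by ring
    _ ≤ _ := by gcongr

section Joined

open Finset

variable {V : Type*}

/-- The first `r` sets of the family `T` are completely joined to each other in `G`. -/
def PairwiseJoined (G : SimpleGraph V) (r : ℕ) (T : ℕ → Finset V) : Prop :=
  ∀ i < r, ∀ j < r, i ≠ j → ∀ x ∈ T i, ∀ y ∈ T j, G.Adj x y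

/-- The vertex set `S` spans no edge of `G`. -/
def SpansNoEdge (G : SimpleGraph V) (S : Finset V) : Prop :=
  ∀ x ∈ S, ∀ y ∈ S, ¬ G.Adj x y

/-- Every independent `k`-set of `G` has at most `n` common non-neighbours (itself included). -/
def BookBound (G : SimpleGraph V) (k n : ℕ) : Prop :=
  ∀ Q C : Finset V, #Q = k → SpansNoEdge G Q → (∀ u ∈ C, ∀ x ∈ Q, ¬ G.Adj u x) → #C ≤ n

/-- Any `q` pairwise joined `t`-sets of `G` have fewer than `L` common neighbours. -/
def JoinBound (G : SimpleGraph V) (q t L : ℕ) : Prop :=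
  ∀ (T : ℕ → Finset V) (P : Finset V), PairwiseJoined G q T → (∀ i < q, #(T i) = t) →
    (∀ u ∈ P, ∀ i < q, ∀ x ∈ T i, G.Adj u x) → #P < L

lemma SpansNoEdge.mono {G : SimpleGraph V} {S S' : Finset V} (h : SpansNoEdge G S)
    (hS : S' ⊆ S) : SpansNoEdge G S' :=
  fun x hx y hy => h x (hS hx) y (hS hy)

lemma PairwiseJoined.mono {G : SimpleGraph V} {r : ℕ} {T T' : ℕ → Finset V}
    (h : PairwiseJoined G r T) (hT : ∀ i < r, T' i ⊆ T i) : PairwiseJoined G r T' :=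
  fun i hi j hj hij x hx y hy => h i hi j hj hij x (hT i hi hx) y (hT j hj hy)

/-- A complete multipartite graph is found by choosing large enough pairwise joined sets. -/
lemma hasCopy_completeMultipartiteGraph {ι : Type*} (G : SimpleGraph V) (b : ι → ℕ)
    (T : ι → Finset V) (hb : ∀ i, b i ≤ #(T i))
    (hT : ∀ i j, i ≠ j → ∀ x ∈ T i, ∀ y ∈ T j, G.Adj x y) :
    HasCopy G (completeMultipartiteGraph fun i => Fin (b i)) := by
  let e : ∀ i, Fin (b i) → V := fun i x => ((T i).equivFin.symm (Fin.castLE (hb i) x) : V)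
  have he : ∀ i x, e i x ∈ T i := fun i x => ((T i).equivFin.symm (Fin.castLE (hb i) x)).2
  have hinj : ∀ i, Function.Injective (e i) := fun i x y h =>
    Fin.castLE_injective (hb i) ((T i).equivFin.symm.injective (Subtype.ext h))
  refine ⟨⟨fun z => e z.1 z.2, fun {z w} h => hT _ _ h _ (he _ _) _ (he _ _)⟩, ?_⟩
  rintro ⟨i, x⟩ ⟨j, y⟩ h
  change e i x = e j y at h
  by_cases hij : i = j
  · subst hij
    rw [hinj i h]
  · have := hT i j hij _ (he i x) _ (he j y)
    rw [h] at this
    exact absurd this (G.loopless.irrefl _)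

lemma joinBound_of_not_hasCopy (G : SimpleGraph V) {p t : ℕ} (hp : 0 < p) (a : Fin p → ℕ)
    (ha : ∀ i : Fin p, (i : ℕ) < p - 1 → a i ≤ t) (h : ¬ HasCopy G (KMulti a)) :
    JoinBound G (p - 1) t (a ⟨p - 1, by omega⟩) := by
  intro T P hT ht hP
  by_contra! hc
  refine h (hasCopy_completeMultipartiteGraph G a
    (fun i => if (i : ℕ) < p - 1 then T i else P) (fun i => ?_) (fun i j hij x hx y hy => ?_))
  · split_ifs with hi
    · exact (ha i hi).trans (ht _ hi).ge
    · rwa [show i = ⟨p - 1, by omega⟩ from Fin.ext (by simp; omega)]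
  · have hij' : (i : ℕ) ≠ j := fun h => hij (Fin.ext h)
    split_ifs at hx hy with hi hj hj
    · exact hT _ hi _ hj hij' x hx y hy
    · exact (hP y hy _ hi x hx).symm
    · exact hP x hx _ hj y hy
    · omega

lemma bookBound_of_not_hasCopy (G : SimpleGraph V) {k n : ℕ} (hkn : k ≤ n)
    (h : ¬ HasCopy Gᶜ (Book k n)) : BookBound G k n := by
  classical
  intro Q C hQ hind hC
  by_contra! hc
  let e : Fin k ≃ Q := (finCongr hQ.symm).trans Q.equivFin.symm
  have heQ : ∀ i, (e i : V) ∈ Q := fun i => (e i).2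
  refine h (hasCopy_completeMultipartiteGraph Gᶜ _
    (fun i => if hi : (i : ℕ) < k then {(e ⟨i, hi⟩ : V)} else C \ Q) (fun i => ?_)
    (fun i j hij x hx y hy => ?_))
  · split_ifs with hi
    · simp
    · have := le_card_sdiff Q C
      omega
  · have hij' : (i : ℕ) ≠ j := fun h => hij (Fin.ext h)
    rw [compl_adj]
    split_ifs at hx hy with hi hj hj
    · rw [mem_singleton] at hx hy
      subst hx hy
      refine ⟨fun h => hij' ?_, hind _ (heQ _) _ (heQ _)⟩
      simpa using e.injective (Subtype.ext h)
    · rw [mem_singleton] at hx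
      subst hx
      rw [mem_sdiff] at hy
      exact ⟨fun h => hy.2 (h ▸ heQ _), fun h => hC y hy.1 _ (heQ _) h.symm⟩
    · rw [mem_singleton] at hy
      subst hy
      rw [mem_sdiff] at hx
      exact ⟨fun h => hx.2 (h ▸ heQ _), hC x hx.1 _ (heQ _)⟩
    · omega

/-- A large vertex set contains an independent `m`-set or an `s`-clique with at least `L` common
neighbours, where "large" is linear in `L`. -/
lemma exists_clique_or_spansNoEdge (s m : ℕ) : ∃ C : ℕ, ∀ {V : Type*} (G : SimpleGraph V)
    (L : ℕ) (P : Finset V), C * (L + 1) ≤ #P →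
      (∃ S ⊆ P, #S = m ∧ SpansNoEdge G S) ∨
      ∃ K ⊆ P, #K = s ∧ G.IsClique (K : Set V) ∧
        ∃ D ⊆ P, L ≤ #D ∧ ∀ u ∈ D, ∀ x ∈ K, G.Adj u x := by
  classical
  induction s generalizing m with
  | zero =>
    refine ⟨1, fun G L P hP => Or.inr ⟨∅, by simp, by simp, by simp, P, subset_rfl, by omega, ?_⟩⟩
    simp
  | succ s ihs =>
    induction m with
    | zero => exact ⟨0, fun G L P _ => Or.inl ⟨∅, by simp, by simp, by simp [SpansNoEdge]⟩⟩
    | succ m ihm =>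
      obtain ⟨C₁, h₁⟩ := ihs (m + 1)
      obtain ⟨C₂, h₂⟩ := ihm
      refine ⟨C₁ + C₂ + 1, fun {V} G L P hP => ?_⟩
      have hexp : (C₁ + C₂ + 1) * (L + 1) = C₁ * (L + 1) + C₂ * (L + 1) + (L + 1) := by ring
      obtain ⟨v, hv⟩ : P.Nonempty := card_pos.1 (by omega)
      have hsplit : #{u ∈ P.erase v | G.Adj v u} + #{u ∈ P.erase v | ¬ G.Adj v u} + 1 = #P := by
        rw [card_filter_add_card_filter_not, card_erase_add_one hv]
      have hsub : ∀ (q : V → Prop) [DecidablePred q], {u ∈ P.erase v | q u} ⊆ P := fun q _ =>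
        (filter_subset _ _).trans (erase_subset _ _)
      by_cases hC : C₁ * (L + 1) ≤ #{u ∈ P.erase v | G.Adj v u}
      · obtain ⟨S, hS, hSm, hSi⟩ | ⟨K, hK, hKs, hKc, D, hD, hDL, hDK⟩ := h₁ G L _ hC
        · exact Or.inl ⟨S, hS.trans (hsub _), hSm, hSi⟩
        · have hKv : ∀ x ∈ K, x ≠ v ∧ G.Adj v x := fun x hx => by
            have := hK hx
            simp only [mem_filter, mem_erase] at this
            exact ⟨this.1.1, this.2⟩
          refine Or.inr ⟨insert v K, insert_subset hv (hK.trans (hsub _)), ?_, ?_, D,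
            hD.trans (hsub _), hDL, fun u hu x hx => ?_⟩
          · rw [card_insert_of_notMem (fun h => (hKv v h).1 rfl), hKs]
          · rw [coe_insert, isClique_insert]
            exact ⟨hKc, fun b hb _ => (hKv b hb).2⟩
          · obtain rfl | hx := mem_insert.1 hx
            · exact (mem_filter.1 (hD hu)).2.symm
            · exact hDK u hu x hx
      · have hC' : C₂ * (L + 1) ≤ #{u ∈ P.erase v | ¬ G.Adj v u} := by omega
        obtain ⟨S, hS, hSm, hSi⟩ | ⟨K, hK, hKs, hKc, D, hD, hDL, hDK⟩ := h₂ G L _ hC'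
        · have hSv : ∀ x ∈ S, x ≠ v ∧ ¬ G.Adj v x := fun x hx => by
            have := hS hx
            simp only [mem_filter, mem_erase] at this
            exact ⟨this.1.1, this.2⟩
          refine Or.inl ⟨insert v S, insert_subset hv (hS.trans (hsub _)), ?_, ?_⟩
          · rw [card_insert_of_notMem (fun h => (hSv v h).1 rfl), hSm]
          · intro x hx y hy
            obtain rfl | hxS := mem_insert.1 hx <;> obtain rfl | hyS := mem_insert.1 hy
            · exact G.loopless.irrefl _
            · exact (hSv y hyS).2
            · exact fun h => (hSv x hxS).2 h.symm
            · exact hSi x hxS y hyS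
        · exact Or.inr ⟨K, hK.trans (hsub _), hKs, hKc, D, hD.trans (hsub _), hDL, hDK⟩

/-- A clique of size `q * t` splits into `q` pairwise joined `t`-sets. -/
lemma JoinBound.card_lt_of_isClique {G : SimpleGraph V} {q t L : ℕ} (h : JoinBound G q t L)
    {K D : Finset V} (hK : G.IsClique (K : Set V)) (hKc : #K = q * t)
    (hD : ∀ u ∈ D, ∀ x ∈ K, G.Adj u x) : #D < L := by
  classical
  let e : Fin q × Fin t ≃ K := finProdFinEquiv.trans ((finCongr hKc.symm).trans K.equivFin.symm)
  have he : ∀ z, (e z : V) ∈ K := fun z => (e z).2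
  have hinj : Function.Injective fun z => (e z : V) := Subtype.val_injective.comp e.injective
  let T : ℕ → Finset V := fun i =>
    if hi : i < q then univ.image fun j => (e (⟨i, hi⟩, j) : V) else ∅
  have hT : ∀ i (hi : i < q), T i = univ.image fun j => (e (⟨i, hi⟩, j) : V) :=
    fun i hi => dif_pos hi
  refine h T D (fun i hi j hj hij x hx y hy => ?_) (fun i hi => ?_) (fun u hu i hi x hx => ?_)
  · rw [hT i hi] at hx
    rw [hT j hj] at hy
    obtain ⟨a, -, rfl⟩ := mem_image.1 hx
    obtain ⟨b, -, rfl⟩ := mem_image.1 hy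
    refine hK (he _) (he _) fun hab => hij ?_
    have := hinj hab
    simp only [Prod.mk.injEq, Fin.mk.injEq] at this
    exact this.1
  · rw [hT i hi, card_image_of_injective, card_univ, Fintype.card_fin]
    intro a b hab
    have := hinj hab
    simpa using this
  · rw [hT i hi] at hx
    obtain ⟨a, -, rfl⟩ := mem_image.1 hx
    exact hD u hu _ (he _)

open Classical in
/-- Many vertices with at least `m` neighbours in each of `r` bounded sets have, after passing to
a positive proportion of them, `m` common neighbours in each of these sets. -/
lemma exists_common_subfamily (G : SimpleGraph V) (r M m : ℕ) (T : ℕ → Finset V) (P : Finset V)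
    (hTM : ∀ i < r, #(T i) = M) (hP : ∀ u ∈ P, ∀ i < r, m ≤ #{x ∈ T i | G.Adj u x}) :
    ∃ T' : ℕ → Finset V, ∃ P' ⊆ P, #P ≤ 2 ^ (r * M) * #P' ∧
      (P.Nonempty → (∀ i < r, T' i ⊆ T i) ∧ ∀ i < r, #(T' i) = m) ∧
      ∀ u ∈ P', ∀ i < r, ∀ x ∈ T' i, G.Adj u x := by
  obtain rfl | hne := P.eq_empty_or_nonempty
  · exact ⟨fun _ => ∅, ∅, by simp, by simp, by simp, by simp⟩
  let U := (range r).biUnion T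
  have hU : #U ≤ r * M := by
    simpa using card_biUnion_le_card_mul (range r) T M fun i hi => (hTM i (mem_range.1 hi)).le
  let f : V → Finset V := fun u => {x ∈ U | G.Adj u x}
  obtain ⟨b, hb, hmax⟩ := exists_max_image (P.image f) (fun b => #{u ∈ P | f u = b})
    (hne.image f)
  obtain ⟨u₀, hu₀, rfl⟩ := mem_image.1 hb
  have hT' : ∀ i, ∃ S : Finset V, i < r → S ⊆ {x ∈ T i | G.Adj u₀ x} ∧ #S = m := fun i => by
    by_cases hi : i < r
    · obtain ⟨S, hS⟩ := exists_subset_card_eq (hP u₀ hu₀ i hi)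
      exact ⟨S, fun _ => hS⟩
    · exact ⟨∅, fun h => absurd h hi⟩
  choose T' hT' using hT'
  refine ⟨T', {u ∈ P | f u = f u₀}, filter_subset _ _, ?_, fun _ => ⟨fun i hi =>
    (hT' i hi).1.trans (filter_subset _ _), fun i hi => (hT' i hi).2⟩, fun u hu i hi x hx => ?_⟩
  · calc #P ≤ #{u ∈ P | f u = f u₀} * #(P.image f) := card_le_mul_card_image P _ hmax
      _ ≤ #{u ∈ P | f u = f u₀} * #U.powerset := by
        gcongr
        exact image_subset_iff.2 fun u _ => mem_powerset.2 (filter_subset _ _)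
      _ ≤ 2 ^ (r * M) * #{u ∈ P | f u = f u₀} := by
        rw [card_powerset, mul_comm]
        gcongr
        norm_num
  · have hx' := mem_filter.1 ((hT' i hi).1 hx)
    have : x ∈ f u₀ := mem_filter.2 ⟨mem_biUnion.2 ⟨i, mem_range.2 hi, hx'.1⟩, hx'.2⟩
    rw [← (mem_filter.1 hu).2] at this
    exact (mem_filter.1 this).2

open Classical in
/-- Double counting pairs of a vertex and a `k`-subset of `S` in its non-neighbourhood. -/
lemma BookBound.sum_choose_le [Fintype V] {G : SimpleGraph V} {k n : ℕ} (h : BookBound G k n)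
    {S : Finset V} (hS : SpansNoEdge G S) :
    ∑ u, (#{x ∈ S | ¬ G.Adj u x}).choose k ≤ (#S).choose k * n := by
  calc ∑ u, (#{x ∈ S | ¬ G.Adj u x}).choose k
      = ∑ u, #(bipartiteAbove (fun u Q => ∀ x ∈ Q, ¬ G.Adj u x) (S.powersetCard k) u) := by
        refine sum_congr rfl fun u _ => ?_
        rw [← card_powersetCard]
        congr 1
        ext Q
        simp only [mem_powersetCard, mem_bipartiteAbove, subset_iff, mem_filter]
        grind
    _ = ∑ Q ∈ S.powersetCard k, #(bipartiteBelow (fun u Q => ∀ x ∈ Q, ¬ G.Adj u x) univ Q) :=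
        sum_card_bipartiteAbove_eq_sum_card_bipartiteBelow _
    _ ≤ ∑ Q ∈ S.powersetCard k, n := by
        refine sum_le_sum fun Q hQ => ?_
        rw [mem_powersetCard] at hQ
        exact h Q _ hQ.2 (hS.mono hQ.1) fun u hu => ((mem_bipartiteBelow _).1 hu).2
    _ = _ := by simp

open Classical in
/-- The vertices with fewer than `m` neighbours in `S`. -/
noncomputable def fewNeighbors [Fintype V] (G : SimpleGraph V) (m : ℕ) (S : Finset V) :
    Finset V :=
  {u | #{x ∈ S | G.Adj u x} < m}

open Classical in
lemma sub_le_card_of_mem_fewNeighbors [Fintype V] {G : SimpleGraph V} {m : ℕ} {S : Finset V}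
    {u : V} (hu : u ∈ fewNeighbors G m S) : #S - m ≤ #{x ∈ S | ¬ G.Adj u x} := by
  have h1 := (mem_filter.1 hu).2
  have h2 := card_filter_add_card_filter_not (s := S) (fun x => G.Adj u x)
  omega

lemma BookBound.card_fewNeighbors_le [Fintype V] {G : SimpleGraph V} {k n m : ℕ}
    (h : BookBound G k n) {S : Finset V} (hS : SpansNoEdge G S) (hk : k ≤ #S) {ε : ℝ}
    (hε : 0 < ε) (hc : ((#S).choose k : ℝ) ≤ (1 + ε) * ((#S - m).choose k : ℝ)) :
    (#(fewNeighbors G m S) : ℝ) ≤ (1 + ε) * n := by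
  classical
  have hpos : (0 : ℝ) < (#S).choose k := by exact_mod_cast Nat.choose_pos hk
  have hpos' : (0 : ℝ) < (#S - m).choose k := by
    by_contra! hle
    nlinarith
  have hsum : #(fewNeighbors G m S) * (#S - m).choose k ≤ (#S).choose k * n :=
    calc #(fewNeighbors G m S) * (#S - m).choose k
        = ∑ u ∈ fewNeighbors G m S, (#S - m).choose k := by simp
      _ ≤ ∑ u ∈ fewNeighbors G m S, (#{x ∈ S | ¬ G.Adj u x}).choose k :=
          sum_le_sum fun u hu => Nat.choose_le_choose k (sub_le_card_of_mem_fewNeighbors hu)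
      _ ≤ ∑ u, (#{x ∈ S | ¬ G.Adj u x}).choose k :=
          sum_le_sum_of_subset (subset_univ _)
      _ ≤ _ := h.sum_choose_le hS
  have hsum' : (#(fewNeighbors G m S) : ℝ) * (#S - m).choose k ≤ (#S).choose k * n := by
    exact_mod_cast hsum
  refine le_of_mul_le_mul_right ?_ hpos'
  have : ((#S).choose k : ℝ) * n ≤ (1 + ε) * ((#S - m).choose k : ℝ) * n := by gcongr
  linarith

open Classical in
/-- The vertices with at least `m` neighbours in each of the sets `T 0, …, T (r - 1)`. -/
noncomputable def commonPool [Fintype V] (G : SimpleGraph V) (m r : ℕ) (T : ℕ → Finset V) :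
    Finset V :=
  {u | ∀ i < r, m ≤ #{x ∈ T i | G.Adj u x}}

lemma card_le_card_commonPool_add [Fintype V] (G : SimpleGraph V) (m r : ℕ)
    (T : ℕ → Finset V) :
    Fintype.card V ≤ #(commonPool G m r T) + ∑ i ∈ range r, #(fewNeighbors G m (T i)) := by
  classical
  calc Fintype.card V = #(univ : Finset V) := card_univ.symm
    _ ≤ #(commonPool G m r T ∪ (range r).biUnion fun i => fewNeighbors G m (T i)) := by
        refine card_le_card fun u _ => ?_
        simp only [commonPool, fewNeighbors, mem_union, mem_filter, mem_univ, true_and,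
          mem_biUnion, mem_range]
        by_contra! hcon
        obtain ⟨⟨i, hi, hlt⟩, h2⟩ := hcon
        exact absurd hlt (h2 i hi).not_gt
    _ ≤ _ := (card_union_le _ _).trans (by gcongr; exact card_biUnion_le)

/-- Under the book and join bounds, every dense vertex set `X` contains the first part of a
complete `(r + 1)`-partite family of independent `m`-sets, for any `r + 1 ≤ q`. -/
lemma exists_pairwiseJoined.{u} (k q t r m : ℕ) (hr : r + 1 ≤ q) {α : ℝ} (hα : 0 < α) :
    ∃ c : ℝ, 0 < c ∧ ∀ {V : Type u} [Fintype V] (G : SimpleGraph V) (n L : ℕ) (X : Finset V),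
      (L : ℝ) + 1 ≤ c * Fintype.card V → ((q : ℝ) - 1 / 4) * n ≤ Fintype.card V →
      BookBound G k n → JoinBound G q t L → α * Fintype.card V ≤ #X →
      ∃ T : ℕ → Finset V, PairwiseJoined G (r + 1) T ∧
        (∀ i < r + 1, SpansNoEdge G (T i) ∧ #(T i) = m) ∧ T 0 ⊆ X := by
  have hindep : ∀ m : ℕ, ∃ C : ℝ, 0 < C ∧ ∀ {V : Type u} (G : SimpleGraph V) (L : ℕ)
      (P : Finset V), JoinBound G q t L → C * ((L : ℝ) + 1) ≤ #P →
      ∃ S ⊆ P, #S = m ∧ SpansNoEdge G S := fun m => by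
    obtain ⟨C, hC⟩ := exists_clique_or_spansNoEdge (q * t) m
    refine ⟨C + 1, by positivity, fun G L P hJ hP => ?_⟩
    have hP' : (C + 1) * (L + 1) ≤ #P := by exact_mod_cast hP
    obtain h | ⟨K, -, hK, hKc, D, -, hLD, hD⟩ := hC G L P (by nlinarith)
    · exact h
    · exact absurd (hJ.card_lt_of_isClique hKc hK hD) hLD.not_gt
  induction r generalizing m with
  | zero =>
    obtain ⟨C, hC0, hC⟩ := hindep m
    refine ⟨α / C, by positivity, fun {V} _ G n L X hL hn hB hJ hX => ?_⟩
    obtain ⟨S, hSX, hSm, hS⟩ := hC G L X hJ (by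
      calc C * ((L : ℝ) + 1) ≤ C * (α / C * Fintype.card V) := by gcongr
        _ = α * Fintype.card V := by field_simp
        _ ≤ _ := hX)
    exact ⟨fun _ => S, fun i hi j hj hij => by omega, fun _ _ => ⟨hS, hSm⟩, hSX⟩
  | succ r ih =>
    have hq : (0 : ℝ) < q := by exact_mod_cast (by omega : 0 < q)
    obtain ⟨M₀, hM₀⟩ := exists_choose_le_mul_choose_sub k m (ε := 1 / (2 * q)) (by positivity)
    let M := M₀ + k
    obtain ⟨c, hc0, hc⟩ := ih M (by omega)
    obtain ⟨C, hC0, hC⟩ := hindep m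
    refine ⟨min c (1 / (4 * q * 2 ^ ((r + 1) * M) * C)), by positivity,
      fun {V} _ G n L X hL hn hB hJ hX => ?_⟩
    classical
    set N : ℝ := (Fintype.card V : ℝ) with hN
    have hN0 : 0 ≤ N := by positivity
    obtain ⟨T, hTj, hT, hTX⟩ := hc G n L X (hL.trans (by gcongr; exact min_le_left _ _)) hn hB hJ hX
    let P := commonPool G m (r + 1) T
    have hPcard : N ≤ 4 * q * #P := by
      have h1 : N ≤ #P + ∑ i ∈ range (r + 1), (#(fewNeighbors G m (T i)) : ℝ) := by
        rw [hN]
        exact_mod_cast card_le_card_commonPool_add G m (r + 1) T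
      have h2 : ∑ i ∈ range (r + 1), (#(fewNeighbors G m (T i)) : ℝ) ≤
          (r + 1) * ((1 + 1 / (2 * q)) * n) := by
        calc ∑ i ∈ range (r + 1), (#(fewNeighbors G m (T i)) : ℝ)
            ≤ ∑ i ∈ range (r + 1), (1 + 1 / (2 * q)) * (n : ℝ) := by
              refine sum_le_sum fun i hi => ?_
              obtain ⟨hTi, hTM⟩ := hT i (mem_range.1 hi)
              refine hB.card_fewNeighbors_le hTi (by omega) (by positivity) ?_
              rw [hTM]
              exact hM₀ M (by omega)
          _ = _ := by simp
      have h3 : ((r : ℝ) + 1) * ((1 + 1 / (2 * q)) * n) ≤ (q - 1 / 2) * n := by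
        rw [← mul_assoc]
        gcongr
        have : (r : ℝ) + 1 + 1 ≤ q := by exact_mod_cast hr
        calc ((r : ℝ) + 1) * (1 + 1 / (2 * q)) ≤ (q - 1) * (1 + 1 / (2 * q)) := by
              gcongr
              linarith
          _ ≤ q - 1 / 2 := by
              have : 0 < 1 / (2 * (q : ℝ)) := by positivity
              have : (q : ℝ) * (1 / (2 * q)) = 1 / 2 := by field_simp
              nlinarith
      have hP1 : N ≤ #P + (q - 1 / 2) * n := by linarith
      have hq1 : (1 : ℝ) ≤ q := by exact_mod_cast (by omega : 1 ≤ q)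
      have hn0 : (0 : ℝ) ≤ n := by positivity
      nlinarith [mul_le_mul_of_nonneg_left hP1 (by linarith : (0 : ℝ) ≤ q - 1 / 4),
        mul_le_mul_of_nonneg_left hn (by linarith : (0 : ℝ) ≤ q - 1 / 2)]
    obtain ⟨T', P', hP'P, hPP', hT', hP'⟩ := exists_common_subfamily G (r + 1) M m T P
      (fun i hi => (hT i hi).2) fun u hu => (mem_filter.1 hu).2
    have hL1 : 0 < (L : ℝ) + 1 := by positivity
    have hPP'' : (#P : ℝ) ≤ 2 ^ ((r + 1) * M) * #P' := by exact_mod_cast hPP'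
    have hLP : C * ((L : ℝ) + 1) ≤ #P' := by
      have h1 : (L : ℝ) + 1 ≤ 1 / (4 * q * 2 ^ ((r + 1) * M) * C) * N :=
        hL.trans (by gcongr; exact min_le_right _ _)
      rw [div_mul_eq_mul_div, one_mul, le_div_iff₀ (by positivity)] at h1
      have h2 : N ≤ 4 * q * (2 ^ ((r + 1) * M) * #P') := hPcard.trans (by gcongr)
      have h3 : (0 : ℝ) < 4 * q * 2 ^ ((r + 1) * M) := by positivity
      refine le_of_mul_le_mul_left ?_ h3
      linarith
    obtain ⟨S, hSP, hSm, hS⟩ := hC G L P' hJ hLP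
    have hPne : P.Nonempty := by
      have : (0 : ℝ) < #P' := (mul_pos hC0 hL1).trans_le hLP
      exact (card_pos.1 (by exact_mod_cast this)).mono hP'P
    obtain ⟨hT'T, hT'm⟩ := hT' hPne
    have hlt : ∀ i < r + 1, Function.update T' (r + 1) S i = T' i := fun i hi =>
      Function.update_of_ne hi.ne _ _
    have hT'j := hTj.mono hT'T
    refine ⟨Function.update T' (r + 1) S, fun i hi j hj hij x hx y hy => ?_, fun i hi => ?_, ?_⟩
    · obtain hi | rfl := Nat.lt_succ_iff_lt_or_eq.1 hi <;>
        obtain hj | rfl := Nat.lt_succ_iff_lt_or_eq.1 hj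
      · rw [hlt i hi] at hx
        rw [hlt j hj] at hy
        exact hT'j i hi j hj hij x hx y hy
      · rw [hlt i hi] at hx
        rw [Function.update_self] at hy
        exact (hP' y (hSP hy) i hi x hx).symm
      · rw [hlt j hj] at hy
        rw [Function.update_self] at hx
        exact hP' x (hSP hx) j hj y hy
      · exact absurd rfl hij
    · obtain hi | rfl := Nat.lt_succ_iff_lt_or_eq.1 hi
      · rw [hlt i hi]
        exact ⟨(hT i hi).1.mono (hT'T i hi), hT'm i hi⟩
      · rw [Function.update_self]
        exact ⟨hS, hSm⟩
    · rw [hlt 0 (by omega)]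
      exact (hT'T 0 (by omega)).trans hTX

open Classical in
/-- If the vertices of `S` have average non-degree well above `#(fewNeighbors G m S)`, then many
vertices outside `fewNeighbors G m S` miss a positive proportion of `S`. -/
lemma le_card_manyNonneighbors [Fintype V] (G : SimpleGraph V) (m : ℕ) {S : Finset V}
    (hS : 0 < #S) {b d : ℝ} (hb : 0 ≤ b) (hd : ∀ x ∈ S, d ≤ #{u | ¬ G.Adj u x}) :
    d ≤ #(fewNeighbors G m S) +
      #{u ∈ (fewNeighbors G m S)ᶜ | b * #S ≤ #{x ∈ S | ¬ G.Adj u x}} + b * Fintype.card V := by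
  set A := fewNeighbors G m S
  set U := {u ∈ Aᶜ | b * #S ≤ (#{x ∈ S | ¬ G.Adj u x} : ℝ)}
  have hS' : (0 : ℝ) < #S := by exact_mod_cast hS
  have hdouble : ∑ u, #{x ∈ S | ¬ G.Adj u x} = ∑ x ∈ S, #{u | ¬ G.Adj u x} :=
    sum_card_bipartiteAbove_eq_sum_card_bipartiteBelow (s := univ) (t := S)
      fun u x => ¬ G.Adj u x
  have hlow : #S * d ≤ ∑ u, (#{x ∈ S | ¬ G.Adj u x} : ℝ) := by
    calc #S * d = ∑ x ∈ S, d := by simp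
      _ ≤ ∑ x ∈ S, (#{u | ¬ G.Adj u x} : ℝ) := sum_le_sum hd
      _ = _ := by exact_mod_cast hdouble.symm
  have hup : ∑ u, (#{x ∈ S | ¬ G.Adj u x} : ℝ) ≤
      ∑ u, ((if u ∈ A then (#S : ℝ) else 0) + (if u ∈ U then (#S : ℝ) else 0) + b * #S) := by
    refine sum_le_sum fun u _ => ?_
    have h1 : (#{x ∈ S | ¬ G.Adj u x} : ℝ) ≤ #S := by exact_mod_cast card_filter_le _ _
    have h2 : 0 ≤ b * #S := by positivity
    by_cases hA : u ∈ A
    · rw [if_pos hA]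
      split_ifs <;> linarith
    · rw [if_neg hA]
      split_ifs with hU
      · linarith
      · have : ¬ b * #S ≤ (#{x ∈ S | ¬ G.Adj u x} : ℝ) := fun h =>
          hU (mem_filter.2 ⟨mem_compl.2 hA, h⟩)
        linarith
  rw [sum_add_distrib, sum_add_distrib, ← sum_filter, ← sum_filter] at hup
  simp only [filter_univ_mem, sum_const, nsmul_eq_mul, card_univ] at hup
  refine le_of_mul_le_mul_left ?_ hS'
  linarith

open Classical in
lemma BookBound.card_fewNeighbors_add_le [Fintype V] {G : SimpleGraph V} {k n m : ℕ}
    (h : BookBound G k n) {S : Finset V} (hS : SpansNoEdge G S) {ε b : ℝ}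
    (hε : 0 < ε) (hb : 0 < b) (hk : 0 < #S) (hkb : 2 * k ≤ b * #S) (hkS : k ≤ #S)
    (hc : ((#S).choose k : ℝ) ≤ (1 + ε) * ((#S - m).choose k : ℝ)) :
    (#(fewNeighbors G m S) : ℝ) +
      (b / 2) ^ k * #{u ∈ (fewNeighbors G m S)ᶜ | b * #S ≤ #{x ∈ S | ¬ G.Adj u x}} ≤
      (1 + ε) * n := by
  set A := fewNeighbors G m S
  set U := {u ∈ Aᶜ | b * #S ≤ (#{x ∈ S | ¬ G.Adj u x} : ℝ)}
  have hS' : (0 : ℝ) < #S := by exact_mod_cast hk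
  have hpos : (0 : ℝ) < (#S).choose k := by exact_mod_cast Nat.choose_pos hkS
  have hdisj : Disjoint A U := disjoint_left.2 fun u hA hU =>
    (mem_compl.1 (mem_filter.1 hU).1) hA
  have hsum : ∑ u, ((#{x ∈ S | ¬ G.Adj u x}).choose k : ℝ) ≤ (#S).choose k * n := by
    exact_mod_cast h.sum_choose_le hS
  have hA : #A * ((#S - m).choose k : ℝ) ≤
      ∑ u ∈ A, ((#{x ∈ S | ¬ G.Adj u x}).choose k : ℝ) := by
    rw [← nsmul_eq_mul]
    refine card_nsmul_le_sum _ _ _ fun u hu => ?_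
    exact_mod_cast Nat.choose_le_choose k (sub_le_card_of_mem_fewNeighbors hu)
  have hU : #U * ((b / 2) ^ k * (#S).choose k) ≤
      ∑ u ∈ U, ((#{x ∈ S | ¬ G.Adj u x}).choose k : ℝ) := by
    rw [← nsmul_eq_mul]
    refine card_nsmul_le_sum _ _ _ fun u hu => ?_
    have hbu := (mem_filter.1 hu).2
    have hku : (k : ℝ) ≤ #{x ∈ S | ¬ G.Adj u x} := by
      have : (0 : ℝ) ≤ k := by positivity
      linarith
    refine le_trans ?_ (choose_mul_pow_le k (M := #S) (by exact_mod_cast hku) hk)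
    have : b / 2 ≤ ((#{x ∈ S | ¬ G.Adj u x} : ℝ) - k) / #S := by
      rw [le_div_iff₀ hS']
      linarith
    gcongr
  have hAU : ∑ u ∈ A, ((#{x ∈ S | ¬ G.Adj u x}).choose k : ℝ) +
      ∑ u ∈ U, ((#{x ∈ S | ¬ G.Adj u x}).choose k : ℝ) ≤
      ∑ u, ((#{x ∈ S | ¬ G.Adj u x}).choose k : ℝ) := by
    rw [← sum_union hdisj]
    exact sum_le_sum_of_subset_of_nonneg (subset_univ _) fun _ _ _ => by positivity
  have hA' : (#A : ℝ) * (#S).choose k ≤ (1 + ε) * (#A * ((#S - m).choose k : ℝ)) := by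
    calc (#A : ℝ) * (#S).choose k ≤ #A * ((1 + ε) * ((#S - m).choose k : ℝ)) := by gcongr
      _ = _ := by ring
  refine le_of_mul_le_mul_right ?_ hpos
  have hU0 : 0 ≤ #U * ((b / 2) ^ k * (#S).choose k) := by positivity
  nlinarith [mul_nonneg hε.le hU0]

lemma density_contradiction {q N n a u L θ α ε : ℝ} (hq : 1 ≤ q) (hN : 0 < N) (hn : 0 ≤ n)
    (hα : 0 < α) (hθ : 0 < θ) (hα1 : α ≤ 1) (hθ1 : θ ≤ 1) (hε : ε = θ * α / 16)
    (hnN : (q - ε) * n ≤ N) (hu : N / q + α * N ≤ a + u + α / 8 * N)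
    (hau : a + θ * u ≤ (1 + ε) * n) (hu0 : 0 ≤ u) (hL : L ≤ ε * N)
    (hcover : N ≤ L + (a + (q - 1) * ((1 + ε) * n))) : False := by
  have hε0 : 0 < ε := by rw [hε]; positivity
  have hεα : ε ≤ α / 16 := by rw [hε]; nlinarith
  have hn2 : n ≤ 2 * N := by nlinarith
  have hqn : q * n ≤ (1 + 2 * ε) * N := by nlinarith
  have hnq : n ≤ N / q + 2 * ε * N := by
    have h1 : n ≤ (1 + 2 * ε) * N / q := by
      rw [le_div_iff₀ (by linarith)]
      linarith
    have h2 : 2 * ε * N / q ≤ 2 * ε * N := div_le_self (by positivity) hq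
    have h3 : (1 + 2 * ε) * N / q = N / q + 2 * ε * N / q := by ring
    linarith
  have hεn : ε * n ≤ 2 * ε * N := by nlinarith
  have hθu : θ * u ≥ 0 := by positivity
  have hεN : ε * N ≤ α / 16 * N := by gcongr
  have hu' : α / 2 * N ≤ u := by nlinarith
  have hθu' : θ * (α / 2 * N) ≤ θ * u := by gcongr
  have hθε : θ * (α / 2 * N) = 8 * (ε * N) := by rw [hε]; ring
  have hsum : N + 7 * (ε * N) ≤ q * n + ε * (q * n) := by nlinarith
  have hεqn : ε * (q * n) ≤ ε * (2 * N) := by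
    refine mul_le_mul_of_nonneg_left ?_ hε0.le
    nlinarith
  nlinarith [mul_pos hε0 hN]

open Classical in
/-- Under the book and join bounds only few vertices have degree below the Turán density. -/
lemma exists_card_lowDegree_le.{u} (k q t : ℕ) (hq : 1 ≤ q) {α : ℝ} (hα : 0 < α) (hα1 : α ≤ 1) :
    ∃ μ : ℝ, 0 < μ ∧ μ ≤ 1 / 4 ∧ ∃ c : ℝ, 0 < c ∧
      ∀ {V : Type u} [Fintype V] (G : SimpleGraph V) (n L : ℕ) (X : Finset V),
        (L : ℝ) + 1 ≤ c * Fintype.card V → ((q : ℝ) - μ) * n ≤ Fintype.card V →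
        BookBound G k n → JoinBound G q t L →
        (∀ x ∈ X, (#{u | G.Adj x u} : ℝ) < (1 - 1 / q - α) * Fintype.card V) →
        (#X : ℝ) ≤ α * Fintype.card V := by
  set b : ℝ := α / 8 with hb
  set θ : ℝ := (b / 2) ^ k with hθ
  have hb0 : 0 < b := by positivity
  have hθ0 : 0 < θ := by positivity
  have hθ1 : θ ≤ 1 := pow_le_one₀ (by positivity) (by linarith)
  set ε : ℝ := θ * α / 16 with hε
  have hε0 : 0 < ε := by positivity
  have hε1 : ε ≤ 1 / 4 := by nlinarith
  obtain ⟨M₀, hM₀⟩ := exists_choose_le_mul_choose_sub k t hε0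
  obtain ⟨M₁, hM₁⟩ := exists_nat_ge (2 * k / b)
  let M := M₀ + M₁ + k + 1
  have hkb : 2 * (k : ℝ) ≤ b * M := by
    have : (M₁ : ℝ) ≤ M := by exact_mod_cast (by omega : M₁ ≤ M)
    rw [div_le_iff₀ hb0] at hM₁
    nlinarith
  obtain ⟨c, hc0, hc⟩ := exists_pairwiseJoined.{u} k q t (q - 1) M (by omega) hα
  refine ⟨ε, hε0, hε1, min c (ε / 2 ^ (q * M)), by positivity,
    fun {V} _ G n L X hL hn hB hJ hX => ?_⟩
  by_contra! hcon
  set N : ℝ := (Fintype.card V : ℝ) with hN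
  have hN0 : 0 ≤ N := by positivity
  obtain ⟨T, hTj, hT, hTX⟩ := hc G n L X (hL.trans (by gcongr; exact min_le_left _ _))
    (le_trans (by gcongr) hn) hB hJ hcon.le
  rw [Nat.sub_add_cancel hq] at hTj hT
  have hNpos : 0 < N := by
    rcases hN0.lt_or_eq with h | h
    · exact h
    · rw [← h, mul_zero] at hL
      have : (0 : ℝ) ≤ L := by positivity
      linarith
  obtain ⟨hT0, hT0M⟩ := hT 0 (by omega)
  have hchoose : ∀ i < q, ((#(T i)).choose k : ℝ) ≤ (1 + ε) * ((#(T i) - t).choose k : ℝ) :=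
    fun i hi => by
      rw [(hT i hi).2]
      exact hM₀ M (by omega)
  have hnondeg : ∀ x ∈ T 0, N / q + α * N ≤ (#{u | ¬ G.Adj u x} : ℝ) := fun x hx => by
    have h1 := hX x (hTX hx)
    have h2 : (#{u | G.Adj x u} : ℝ) + #{u | ¬ G.Adj x u} = N := by
      rw [hN]
      exact_mod_cast (card_filter_add_card_filter_not (s := univ) (fun u => G.Adj x u)).trans
        card_univ
    simp only [G.adj_comm _ x]
    have h3 : (1 - 1 / q - α) * N = N - N / q - α * N := by ring
    linarith
  have hmany := le_card_manyNonneighbors G t (S := T 0) (by omega) hb0.le hnondeg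
  have hfew := hB.card_fewNeighbors_add_le hT0 hε0 hb0 (by omega) (by rwa [hT0M]) (by omega)
    (hchoose 0 (by omega))
  have hpool : (#(commonPool G t q T) : ℝ) ≤ ε * N := by
    obtain ⟨T', P', -, hPP', hT', hP'⟩ := exists_common_subfamily G q M t T (commonPool G t q T)
      (fun i hi => (hT i hi).2) fun u hu => (mem_filter.1 hu).2
    obtain hP | hP := (commonPool G t q T).eq_empty_or_nonempty
    · rw [hP]
      simp only [card_empty, Nat.cast_zero]
      positivity
    · obtain ⟨hT'T, hT't⟩ := hT' hP
      have h1 := hJ T' P' (hTj.mono hT'T) hT't hP'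
      have h2 : (#P' : ℝ) ≤ L + 1 := by exact_mod_cast (by omega : #P' ≤ L + 1)
      have h3 : (L : ℝ) + 1 ≤ ε / 2 ^ (q * M) * N :=
        hL.trans (by gcongr; exact min_le_right _ _)
      calc (#(commonPool G t q T) : ℝ) ≤ 2 ^ (q * M) * #P' := by exact_mod_cast hPP'
        _ ≤ 2 ^ (q * M) * (ε / 2 ^ (q * M) * N) := by
          gcongr
          exact h2.trans h3
        _ = ε * N := by field_simp
  have hcover : N ≤ #(commonPool G t q T) +
      (#(fewNeighbors G t (T 0)) + ((q : ℝ) - 1) * ((1 + ε) * n)) := by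
    have h1 : N ≤ #(commonPool G t q T) +
        ∑ i ∈ range (q - 1 + 1), (#(fewNeighbors G t (T i)) : ℝ) := by
      rw [hN, Nat.sub_add_cancel hq]
      exact_mod_cast card_le_card_commonPool_add G t q T
    have h2 : ∑ i ∈ range (q - 1), (#(fewNeighbors G t (T (i + 1))) : ℝ) ≤
        ((q : ℝ) - 1) * ((1 + ε) * n) := by
      calc ∑ i ∈ range (q - 1), (#(fewNeighbors G t (T (i + 1))) : ℝ)
          ≤ ∑ i ∈ range (q - 1), (1 + ε) * (n : ℝ) := by
            refine sum_le_sum fun i hi => ?_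
            have hi' : i + 1 < q := by
              rw [mem_range] at hi
              omega
            obtain ⟨hTi, hTM⟩ := hT (i + 1) hi'
            exact hB.card_fewNeighbors_le hTi (by omega) hε0 (hchoose _ hi')
        _ = _ := by simp [Nat.cast_sub hq]
    rw [sum_range_succ'] at h1
    linarith
  exact density_contradiction (by exact_mod_cast hq) hNpos (by positivity) hα hθ0 hα1 hθ1 hε hn
    hmany hfew (by positivity) hpool hcover

end Joined

/-- Lemma 3.8: for `k, p, t ≥ 2` and `α > 0`, for all sufficiently small `μ > 0` there are
`δ > 0` and `n₀` such that for all `n ≥ n₀`, positive `a₁ ≤ ⋯ ≤ a_{p-1} ≤ t`,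
`a_{p-1} ≤ a_p ≤ δn`: if `G` is a `K_p(a₁,…,a_p)`-free graph on `N ≥ (p-1-μ)n` vertices
whose complement is `B_{k,n}`-free, then all but at most `αN` vertices of `G` have degree
at least `(1 - 1/(p-1) - α)N`. -/
theorem degree_lemma (k p t : ℕ) (hk : 2 ≤ k) (hp : 2 ≤ p) (ht : 2 ≤ t)
    (α : ℝ) (hα : 0 < α) :
    ∃ μ₀ : ℝ, 0 < μ₀ ∧ ∀ μ : ℝ, 0 < μ → μ ≤ μ₀ →
      ∃ δ : ℝ, 0 < δ ∧ ∃ n₀ : ℕ, ∀ n : ℕ, n₀ ≤ n →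
        ∀ a : Fin p → ℕ, (∀ i, 1 ≤ a i) → Monotone a →
          (∀ i : Fin p, (i : ℕ) < p - 1 → a i ≤ t) →
          ((a ⟨p - 1, by omega⟩ : ℕ) : ℝ) ≤ δ * n →
          ∀ N : ℕ, ((p : ℝ) - 1 - μ) * n ≤ (N : ℝ) →
          ∀ G : SimpleGraph (Fin N),
            ¬ HasCopy G (KMulti a) → ¬ HasCopy Gᶜ (Book k n) →
            (({v : Fin N |
                ((G.neighborSet v).ncard : ℝ) < (1 - 1 / ((p : ℝ) - 1) - α) * N}.ncard : ℝ)
              ≤ α * N) := by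
  classical
  obtain ⟨μ₀, hμ₀, hμ₀1, c, hc0, hc⟩ := exists_card_lowDegree_le.{0} k (p - 1) t (by omega)
    (lt_min hα one_pos) (min_le_right α 1)
  have hpq : ((p - 1 : ℕ) : ℝ) = (p : ℝ) - 1 := by
    rw [Nat.cast_sub (by omega), Nat.cast_one]
  have hp2 : (2 : ℝ) ≤ p := by exact_mod_cast hp
  obtain ⟨n₁, hn₁⟩ := exists_nat_ge (4 / c)
  refine ⟨μ₀, hμ₀, fun μ hμ hμμ₀ => ⟨c / 4, by positivity, n₁ + k, ?_⟩⟩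
  intro n hn a _ _ hat hap N hN G hGK hGB
  have hnN : (n : ℝ) ≤ 2 * N := by
    have : (0 : ℝ) ≤ n := by positivity
    nlinarith
  have hL : ((a ⟨p - 1, by omega⟩ : ℕ) : ℝ) + 1 ≤ c * Fintype.card (Fin N) := by
    rw [Fintype.card_fin]
    have h1 : (n₁ : ℝ) ≤ n := by exact_mod_cast (by omega : n₁ ≤ n)
    rw [div_le_iff₀ hc0] at hn₁
    nlinarith
  have hmain := hc G n (a ⟨p - 1, by omega⟩)
    (Finset.univ.filter fun v => ((G.neighborSet v).ncard : ℝ) <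
      (1 - 1 / ((p : ℝ) - 1) - α) * N) hL
    (by
      rw [hpq, Fintype.card_fin]
      refine le_trans ?_ hN
      gcongr)
    (bookBound_of_not_hasCopy G (by omega) hGB)
    (joinBound_of_not_hasCopy G (by omega) a hat hGK) (fun v hv => by
      rw [Finset.mem_filter] at hv
      have hcard : (G.neighborSet v).ncard = (Finset.univ.filter fun u => G.Adj v u).card := by
        rw [← Set.ncard_coe_finset]
        congr 1
        ext u
        simp
      rw [hpq, Fintype.card_fin, ← hcard]
      refine hv.2.trans_le ?_
      gcongr
      exact min_le_left _ _)
  rw [Fintype.card_fin] at hmain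
  have hset : {v : Fin N | ((G.neighborSet v).ncard : ℝ) < (1 - 1 / ((p : ℝ) - 1) - α) * N} =
      ((Finset.univ.filter fun v => ((G.neighborSet v).ncard : ℝ) <
        (1 - 1 / ((p : ℝ) - 1) - α) * N : Finset (Fin N)) : Set (Fin N)) := by
    ext v
    simp
  rw [hset, Set.ncard_coe_finset]
  refine hmain.trans ?_
  gcongr
  exact min_le_left _ _
end
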